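/- (Main theorem) For every even natural number k ≥ 2, as g → ∞, (1/#H_{2g+1}) Σ_{D ∈ H_{2g+1}} L(1/2, χ_D)^k ≫_k g^{k(k+1)/2}, i.e. the k-th moment of L(1/2, χ_D) averaged over monic square-free D of degree 2g+1 is bounded below by a positive constant (depending on k and q) times (log_q |D|)^{k(k+1)/2}. -/

import Mathlib

open Polynomial Filter Asymptotics
open scoped Classical

variable {Fq : Type} [Field Fq] [Fintype Fq]

/-- Norm of a polynomial: `|f| = q^(deg f)` for `f ≠ 0`, and `|0| = 0`. -/
noncomputable def pnorm (f : Polynomial Fq) : ℝ :=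
  if f = 0 then 0 else (Fintype.card Fq : ℝ) ^ f.natDegree

/-- Monic polynomials of degree `n`. -/
def monicDeg (Fq : Type) [Field Fq] (n : ℕ) : Set (Polynomial Fq) :=
  {f | f.Monic ∧ f.natDegree = n}

/-- `H_{2g+1}`: monic square-free polynomials of degree `2g+1`. -/
def Hset (Fq : Type) [Field Fq] (g : ℕ) : Set (Polynomial Fq) :=
  {D | D.Monic ∧ Squarefree D ∧ D.natDegree = 2 * g + 1}

/-- Quadratic residue symbol `(D/P)` for an irreducible `P`. -/
noncomputable def quadCharP (D P : Polynomial Fq) : ℤ :=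
  if P ∣ D then 0 else if ∃ x : Polynomial Fq, P ∣ (x ^ 2 - D) then 1 else -1

/-- Jacobi-type quadratic residue symbol `(D/n)`, extended multiplicatively over
irreducible factors of `n`. -/
noncomputable def jacobi (D n : Polynomial Fq) : ℤ :=
  ((UniqueFactorizationMonoid.factors n).map (quadCharP D)).prod

/-- The quadratic Dirichlet L-function `L(s, χ_D)` as a finite sum
`Σ_{n=0}^{deg D - 1} (Σ_{f monic, deg f = n} χ_D(f)) q^{-ns}`. -/
noncomputable def Lfun (D : Polynomial Fq) (s : ℂ) : ℂ :=
  ∑ n ∈ Finset.range D.natDegree,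
    (∑ᶠ f ∈ monicDeg Fq n, (jacobi D f : ℂ)) * (Fintype.card Fq : ℂ) ^ (-(n : ℂ) * s)

/-- The central value `L(1/2, χ_D)` as a real number. -/
noncomputable def LhalfR (D : Polynomial Fq) : ℝ :=
  ∑ n ∈ Finset.range D.natDegree,
    (∑ᶠ f ∈ monicDeg Fq n, (jacobi D f : ℝ)) * (Real.sqrt (Fintype.card Fq))⁻¹ ^ n

/-- `a_m = Π_{P | m} |P|/(|P|+1)` over monic irreducible divisors `P` of `m`. -/
noncomputable def am (m : Polynomial Fq) : ℝ :=
  ∏ᶠ (P : Polynomial Fq) (_ : P.Monic ∧ Irreducible P ∧ P ∣ m), pnorm P / (pnorm P + 1)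

/-- `d_k(m)`: the number of ordered `k`-tuples of monic polynomials with product `m`. -/
noncomputable def dfold (k : ℕ) (m : Polynomial Fq) : ℕ :=
  Nat.card {t : Fin k → Polynomial Fq // (∀ i, (t i).Monic) ∧ ∏ i, t i = m}

/-- Möbius function on `F_q[T]`. -/
noncomputable def moebiusP (f : Polynomial Fq) : ℤ :=
  if Squarefree f then (-1) ^ (UniqueFactorizationMonoid.factors f).card else 0

/-- The Dirichlet polynomial `A(D) = Σ_{n monic, deg n ≤ 4g/(15k)} χ_D(n)/√|n|`. -/
noncomputable def AD (k g : ℕ) (D : Polynomial Fq) : ℝ :=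
  ∑ᶠ n ∈ {n : Polynomial Fq | n.Monic ∧ n.natDegree ≤ 4 * g / (15 * k)},
    (jacobi D n : ℝ) / Real.sqrt (pnorm n)

/-- Polynomials of degree less than `n`. -/
noncomputable def polysLT (Fq : Type) [Field Fq] [Fintype Fq] (n : ℕ) : Finset (Polynomial Fq) :=
  Finset.univ.image fun a : Fin n → Fq => (((degreeLTEquiv Fq n).symm a : degreeLT Fq n) : Fq[X])

/-- Monic polynomials of degree `n`. -/
noncomputable def monics (Fq : Type) [Field Fq] [Fintype Fq] (n : ℕ) : Finset (Polynomial Fq) :=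
  (polysLT Fq n).image fun u => X ^ n + u

/-- Monic polynomials of degree at most `n`. -/
noncomputable def monicsLE (Fq : Type) [Field Fq] [Fintype Fq] (n : ℕ) :
    Finset (Polynomial Fq) :=
  (Finset.range (n + 1)).biUnion (monics Fq)

/-- Monic square-free polynomials of degree `n`. -/
noncomputable def sqfrees (Fq : Type) [Field Fq] [Fintype Fq] (n : ℕ) : Finset (Polynomial Fq) :=
  (monics Fq n).filter Squarefree

lemma mem_polysLT {n : ℕ} {p : Fq[X]} : p ∈ polysLT Fq n ↔ p.degree < n := by
  unfold polysLT
  rw [← mem_degreeLT]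
  constructor
  · intro h
    obtain ⟨a, -, rfl⟩ := Finset.mem_image.1 h
    exact ((degreeLTEquiv Fq n).symm a).2
  · intro h
    exact Finset.mem_image.2 ⟨degreeLTEquiv Fq n ⟨p, h⟩, Finset.mem_univ _, by simp⟩

lemma card_polysLT (n : ℕ) : (polysLT Fq n).card = Fintype.card Fq ^ n := by
  unfold polysLT
  rw [Finset.card_image_of_injective]
  · simp
  · exact Subtype.coe_injective.comp (degreeLTEquiv Fq n).symm.injective

lemma sum_monics {M : Type*} [AddCommMonoid M] (n : ℕ) (h : Fq[X] → M) :
    ∑ f ∈ monics Fq n, h f = ∑ u ∈ polysLT Fq n, h (X ^ n + u) := by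
  unfold monics
  rw [Finset.sum_image]
  intro x _ y _ hxy
  exact add_left_cancel hxy

lemma card_monics (n : ℕ) : (monics Fq n).card = Fintype.card Fq ^ n := by
  rw [← card_polysLT, Finset.card_eq_sum_ones, sum_monics, Finset.card_eq_sum_ones]

lemma mem_monics {n : ℕ} {f : Fq[X]} : f ∈ monics Fq n ↔ f.Monic ∧ f.natDegree = n := by
  unfold monics
  rw [Finset.mem_image]
  constructor
  · rintro ⟨u, hu, rfl⟩
    rw [mem_polysLT] at hu
    refine ⟨monic_X_pow_add hu, natDegree_eq_of_degree_eq_some ?_⟩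
    rw [degree_add_eq_left_of_degree_lt] <;> simp [hu]
  · rintro ⟨hf, rfl⟩
    refine ⟨f - X ^ f.natDegree, ?_, by ring⟩
    rw [mem_polysLT, ← degree_eq_natDegree hf.ne_zero]
    exact degree_sub_lt_left (by rw [degree_X_pow, degree_eq_natDegree hf.ne_zero]) hf.ne_zero
      (by simp [hf.leadingCoeff])

lemma mem_monicsLE {n : ℕ} {f : Fq[X]} : f ∈ monicsLE Fq n ↔ f.Monic ∧ f.natDegree ≤ n := by
  unfold monicsLE
  simp only [Finset.mem_biUnion, Finset.mem_range, mem_monics]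
  constructor
  · rintro ⟨a, ha, hf, rfl⟩
    exact ⟨hf, by omega⟩
  · rintro ⟨hf, h⟩
    exact ⟨_, by omega, hf, rfl⟩

lemma mem_sqfrees {n : ℕ} {f : Fq[X]} :
    f ∈ sqfrees Fq n ↔ (f.Monic ∧ f.natDegree = n) ∧ Squarefree f := by
  unfold sqfrees
  rw [Finset.mem_filter, mem_monics]

lemma sum_monicsLE {M : Type*} [AddCommMonoid M] (n : ℕ) (h : Fq[X] → M) :
    ∑ f ∈ monicsLE Fq n, h f = ∑ i ∈ Finset.range (n + 1), ∑ f ∈ monics Fq i, h f := by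
  unfold monicsLE
  rw [Finset.sum_biUnion]
  intro i _ j _ hij
  rw [Function.onFun, Finset.disjoint_left]
  intro f hf hf'
  rw [mem_monics] at hf hf'
  exact hij (hf.2.symm.trans hf'.2)

lemma sum_polysLT_succ {M : Type*} [AddCommMonoid M] (n : ℕ) (h : Fq[X] → M) :
    ∑ p ∈ polysLT Fq (n + 1), h p = ∑ c : Fq, ∑ u ∈ polysLT Fq n, h (C c * X ^ n + u) := by
  rw [← Finset.sum_product' Finset.univ (polysLT Fq n) fun c u => h (C c * X ^ n + u)]
  symm
  refine Finset.sum_bij (fun x _ => C x.1 * X ^ n + x.2) ?_ ?_ ?_ ?_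
  · rintro ⟨c, u⟩ hx
    simp only [Finset.mem_product, Finset.mem_univ, true_and, mem_polysLT] at hx ⊢
    refine lt_of_le_of_lt (degree_add_le _ _) (max_lt ?_ ?_)
    · refine lt_of_le_of_lt (degree_C_mul_X_pow_le n c) ?_
      exact_mod_cast Nat.lt_succ_self n
    · refine hx.trans ?_
      exact_mod_cast Nat.lt_succ_self n
  · rintro ⟨c, u⟩ hx ⟨c', u'⟩ hx' heq
    simp only [Finset.mem_product, Finset.mem_univ, true_and, mem_polysLT] at hx hx' heq
    have hc : c = c' := by
      have := congrArg (fun p => coeff p n) heq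
      simpa [coeff_eq_zero_of_degree_lt hx, coeff_eq_zero_of_degree_lt hx'] using this
    subst hc
    rw [add_left_cancel heq]
  · intro p hp
    rw [mem_polysLT] at hp
    refine ⟨(p.coeff n, p - C (p.coeff n) * X ^ n), ?_, by simp⟩
    simp only [Finset.mem_product, Finset.mem_univ, true_and, mem_polysLT]
    rw [degree_lt_iff_coeff_zero]
    intro m hm
    rcases hm.eq_or_lt with rfl | hm
    · simp
    · have : p.coeff m = 0 := by
        refine coeff_eq_zero_of_degree_lt (lt_of_lt_of_le hp ?_)
        exact_mod_cast hm
      simp [this, hm.ne']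
  · intros; rfl

lemma sum_monics_periodic {M : Type*} [AddCommMonoid M] {D : Fq[X]} (hD : D.Monic) {n : ℕ}
    (hn : D.natDegree ≤ n) (h : Fq[X] → M) (hper : ∀ V Z, h (V + D * Z) = h V) :
    ∑ f ∈ monics Fq n, h f =
      Fintype.card Fq ^ (n - D.natDegree) • ∑ W ∈ polysLT Fq D.natDegree, h W := by
  rw [← card_monics, ← Finset.sum_const, ← Finset.sum_product']
  symm
  refine Finset.sum_bij (fun x _ => x.2 + D * x.1) ?_ ?_ ?_ ?_
  · rintro ⟨Z, W⟩ hx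
    simp only [Finset.mem_product, mem_polysLT, mem_monics] at hx ⊢
    obtain ⟨⟨hZ, hZd⟩, hW⟩ := hx
    have hm : (D * Z).Monic := hD.mul hZ
    have hd : (D * Z).natDegree = n := by rw [hD.natDegree_mul hZ, hZd]; omega
    have hlt : W.degree < (D * Z).degree := by
      rw [degree_eq_natDegree hm.ne_zero, hd]
      exact lt_of_lt_of_le hW (by exact_mod_cast hn)
    refine ⟨hm.add_of_right hlt, ?_⟩
    rw [natDegree_add_eq_right_of_degree_lt hlt, hd]
  · rintro ⟨Z, W⟩ hx ⟨Z', W'⟩ hx' heq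
    simp only [Finset.mem_product, mem_polysLT, mem_monics] at hx hx' heq
    have h1 := div_modByMonic_unique (f := W + D * Z) Z W hD
      ⟨rfl, by rw [degree_eq_natDegree hD.ne_zero]; exact hx.2⟩
    have h2 := div_modByMonic_unique (f := W + D * Z) Z' W' hD
      ⟨heq.symm, by rw [degree_eq_natDegree hD.ne_zero]; exact hx'.2⟩
    exact Prod.ext (h1.1.symm.trans h2.1) (h1.2.symm.trans h2.2)
  · intro f hf
    rw [mem_monics] at hf
    refine ⟨(f /ₘ D, f %ₘ D), ?_, modByMonic_add_div f D⟩
    simp only [Finset.mem_product, mem_polysLT, mem_monics]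
    refine ⟨⟨?_, ?_⟩, ?_⟩
    · rw [Monic, leadingCoeff_divByMonic_of_monic hD]
      · exact hf.1
      · rw [degree_eq_natDegree hD.ne_zero, degree_eq_natDegree hf.1.ne_zero, hf.2]
        exact_mod_cast hn
    · rw [natDegree_divByMonic f hD, hf.2]
    · rw [← degree_eq_natDegree hD.ne_zero]
      exact degree_modByMonic_lt f hD
  · rintro ⟨Z, W⟩ hx
    exact (hper W Z).symm

lemma sum_polysLT_mul_unit {M : Type*} [AddCommMonoid M] {D a : Fq[X]} (hD : D.Monic)
    (ha : IsCoprime a D) (h : Fq[X] → M) (hper : ∀ V Z, h (V + D * Z) = h V) :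
    ∑ W ∈ polysLT Fq D.natDegree, h (a * W) = ∑ W ∈ polysLT Fq D.natDegree, h W := by
  have hmaps : ∀ W ∈ polysLT Fq D.natDegree, (a * W) %ₘ D ∈ polysLT Fq D.natDegree := by
    intro W _
    rw [mem_polysLT, ← degree_eq_natDegree hD.ne_zero]
    exact degree_modByMonic_lt _ hD
  have hinj : Set.InjOn (fun W => (a * W) %ₘ D) (polysLT Fq D.natDegree : Set Fq[X]) := by
    intro W hW W' hW' heq
    have hW := mem_polysLT.1 (Finset.mem_coe.1 hW)
    have hW' := mem_polysLT.1 (Finset.mem_coe.1 hW')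
    have h1 : D ∣ a * (W - W') := by
      rw [mul_sub, ← modByMonic_eq_zero_iff_dvd hD, sub_modByMonic]
      exact sub_eq_zero.2 heq
    have h2 : D ∣ W - W' := ha.symm.dvd_of_dvd_mul_left h1
    have h3 : W - W' = 0 := by
      refine eq_zero_of_dvd_of_degree_lt h2 ?_
      rw [degree_eq_natDegree hD.ne_zero]
      exact lt_of_le_of_lt (degree_sub_le _ _) (max_lt hW hW')
    exact sub_eq_zero.1 h3
  refine Finset.sum_bij (fun W _ => (a * W) %ₘ D) hmaps ?_ ?_ ?_
  · intro W hW W' hW' heq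
    exact hinj (Finset.mem_coe.2 hW) (Finset.mem_coe.2 hW') heq
  · intro W hW
    obtain ⟨V, hV, hVW⟩ := Finset.surj_on_of_inj_on_of_card_le (fun W _ => (a * W) %ₘ D) hmaps
      (fun x y hx hy hxy => hinj (Finset.mem_coe.2 hx) (Finset.mem_coe.2 hy) hxy) le_rfl W hW
    exact ⟨V, hV, hVW.symm⟩
  · intro W _
    conv_lhs => rw [← modByMonic_add_div (a * W) D]
    exact hper _ _

lemma sum_polysLT_crt {M : Type*} [AddCommMonoid M] {D E : Fq[X]} (hD : D.Monic) (hE : E.Monic)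
    (hDE : IsCoprime D E) (h : Fq[X] → M) :
    ∑ W ∈ polysLT Fq (D * E).natDegree, h W =
      ∑ U ∈ polysLT Fq D.natDegree, ∑ V ∈ polysLT Fq E.natDegree, h (E * U + D * V) := by
  have hdeg : (D * E).natDegree = D.natDegree + E.natDegree := hD.natDegree_mul hE
  have hinj : Set.InjOn (fun x : Fq[X] × Fq[X] => E * x.1 + D * x.2)
      (polysLT Fq D.natDegree ×ˢ polysLT Fq E.natDegree : Finset (Fq[X] × Fq[X])) := by
    rintro ⟨U, V⟩ hx ⟨U', V'⟩ hx' heq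
    simp only [Finset.coe_product, Set.mem_prod, Finset.mem_coe, mem_polysLT] at hx hx' heq
    have h1 : D ∣ E * (U - U') := ⟨V' - V, by linear_combination heq⟩
    have h3 : U - U' = 0 := by
      refine eq_zero_of_dvd_of_degree_lt (hDE.dvd_of_dvd_mul_left h1) ?_
      rw [degree_eq_natDegree hD.ne_zero]
      exact lt_of_le_of_lt (degree_sub_le _ _) (max_lt hx.1 hx'.1)
    have h4 : U = U' := sub_eq_zero.1 h3
    subst h4
    exact Prod.ext rfl (mul_left_cancel₀ hD.ne_zero (add_left_cancel heq))
  have key : (polysLT Fq D.natDegree ×ˢ polysLT Fq E.natDegree).image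
      (fun x : Fq[X] × Fq[X] => E * x.1 + D * x.2) = polysLT Fq (D * E).natDegree := by
    refine Finset.eq_of_subset_of_card_le ?_ ?_
    · intro f hf
      obtain ⟨⟨U, V⟩, hx, rfl⟩ := Finset.mem_image.1 hf
      simp only [Finset.mem_product, mem_polysLT] at hx ⊢
      rw [hdeg]
      have hDd := degree_eq_natDegree hD.ne_zero
      have hEd := degree_eq_natDegree hE.ne_zero
      refine lt_of_le_of_lt (degree_add_le _ _) (max_lt ?_ ?_)
      · by_cases hU : U = 0
        · simp only [hU, mul_zero, degree_zero]
          exact WithBot.bot_lt_coe _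
        · rw [degree_mul, hEd, degree_eq_natDegree hU] at *
          have := hx.1
          norm_cast at *
          omega
      · by_cases hV : V = 0
        · simp only [hV, mul_zero, degree_zero]
          exact WithBot.bot_lt_coe _
        · rw [degree_mul, hDd, degree_eq_natDegree hV] at *
          have := hx.2
          norm_cast at *
          omega
    · rw [Finset.card_image_of_injOn hinj, Finset.card_product, card_polysLT, card_polysLT,
        card_polysLT, hdeg, pow_add]
  rw [← key, Finset.sum_image hinj, Finset.sum_product]

lemma sum_polysLT_leadingCoeff {M : Type*} [AddCommMonoid M] (n : ℕ) (h : Fq[X] → M) :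
    ∑ p ∈ polysLT Fq n, h p =
      h 0 + ∑ j ∈ Finset.range n,
        ∑ c ∈ (Finset.univ : Finset Fq).erase 0, ∑ f ∈ monics Fq j, h (C c * f) := by
  induction n with
  | zero =>
    have : polysLT Fq 0 = {0} := by
      ext p
      rw [mem_polysLT, Finset.mem_singleton]
      simp
    simp [this]
  | succ n ih =>
    rw [sum_polysLT_succ, ← Finset.add_sum_erase _ _ (Finset.mem_univ 0), Finset.sum_range_succ,
      ← add_assoc, ← ih]
    congr 1
    · simp
    · refine Finset.sum_congr rfl fun c hc => ?_
      have hc0 : c ≠ 0 := (Finset.mem_erase.1 hc).1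
      have hu : IsCoprime (C c) ((X : Fq[X]) ^ n) :=
        (isCoprime_one_left.of_isCoprime_of_dvd_left (isUnit_C.2 hc0.isUnit).dvd)
      have := sum_polysLT_mul_unit (D := X ^ n) (a := C c) (monic_X_pow n) hu
        (fun W => h (C c * X ^ n + W %ₘ X ^ n)) (fun V Z => by
          congr 2
          rw [add_modByMonic, (modByMonic_eq_zero_iff_dvd (monic_X_pow n)).2 ⟨Z, rfl⟩, add_zero])
      rw [natDegree_X_pow] at this
      rw [sum_monics]
      have hmod : ∀ W ∈ polysLT Fq n, W %ₘ X ^ n = W := fun W hW => by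
        rw [modByMonic_eq_self_iff (monic_X_pow n), degree_X_pow]
        exact mem_polysLT.1 hW
      have hmod' : ∀ W ∈ polysLT Fq n, (C c * W) %ₘ X ^ n = C c * W := fun W hW => by
        rw [modByMonic_eq_self_iff (monic_X_pow n), degree_X_pow, degree_C_mul hc0]
        exact mem_polysLT.1 hW
      refine ((Finset.sum_congr rfl fun W hW => ?_).trans this.symm).trans
        (Finset.sum_congr rfl fun W hW => ?_)
      · rw [hmod W hW]
      · simp only [hmod' W hW, mul_add]

lemma sum_monics_filter_dvd {M : Type*} [AddCommMonoid M] {n : ℕ} {e : Fq[X]} (he : e.Monic)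
    (hn : e.natDegree ≤ n) (h : Fq[X] → M) :
    ∑ f ∈ (monics Fq n).filter (e ∣ ·), h f = ∑ f ∈ monics Fq (n - e.natDegree), h (e * f) := by
  symm
  refine Finset.sum_bij (fun f _ => e * f) ?_ ?_ ?_ ?_
  · intro f hf
    rw [mem_monics] at hf
    rw [Finset.mem_filter, mem_monics]
    refine ⟨⟨he.mul hf.1, ?_⟩, dvd_mul_right _ _⟩
    rw [he.natDegree_mul hf.1, hf.2]
    omega
  · intro f _ f' _ heq
    exact mul_left_cancel₀ he.ne_zero heq
  · intro f hf
    rw [Finset.mem_filter, mem_monics] at hf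
    obtain ⟨⟨hf, hd⟩, g, rfl⟩ := hf
    have hg : g.Monic := he.of_mul_monic_left hf
    refine ⟨g, ?_, rfl⟩
    rw [mem_monics]
    refine ⟨hg, ?_⟩
    rw [he.natDegree_mul hg] at hd
    omega
  · intros; rfl

lemma monics_filter_dvd_eq_empty {n : ℕ} {e : Fq[X]} (hn : n < e.natDegree) :
    (monics Fq n).filter (e ∣ ·) = ∅ := by
  refine Finset.filter_eq_empty_iff.2 fun f hf hef => ?_
  rw [mem_monics] at hf
  have := natDegree_le_of_dvd hef hf.1.ne_zero
  omega

lemma finite_adjoinRoot {P : Fq[X]} (hP : Irreducible P) : Finite (AdjoinRoot P) :=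
  have := (AdjoinRoot.powerBasis hP.ne_zero).finite
  Module.finite_of_finite Fq

/-- The residue field of an irreducible polynomial is a finite type. -/
noncomputable instance fintypeAdjoinRoot {P : Fq[X]} [hP : Fact (Irreducible P)] :
    Fintype (AdjoinRoot P) :=
  @Fintype.ofFinite _ (finite_adjoinRoot hP.out)

lemma quadCharP_eq_quadraticChar {P : Fq[X]} [Fact (Irreducible P)] (D : Fq[X]) :
    quadCharP D P = quadraticChar (AdjoinRoot P) (AdjoinRoot.mk P D) := by
  unfold quadCharP
  rw [quadraticChar_apply, quadraticCharFun]
  simp only [AdjoinRoot.mk_eq_zero]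
  split_ifs with h1 h2 h3 h3
  · rfl
  · rfl
  · exfalso
    obtain ⟨x, hx⟩ := h2
    refine h3 ⟨AdjoinRoot.mk P x, ?_⟩
    rw [← map_mul, eq_comm, AdjoinRoot.mk_eq_mk, ← sq]
    exact hx
  · exfalso
    obtain ⟨y, hy⟩ := h3
    obtain ⟨x, rfl⟩ := AdjoinRoot.mk_surjective y
    refine h2 ⟨x, ?_⟩
    rw [← map_mul, eq_comm, AdjoinRoot.mk_eq_mk, ← sq] at hy
    exact hy
  · rfl

lemma quadCharP_mul {P : Fq[X]} (hP : Irreducible P) (D E : Fq[X]) :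
    quadCharP (D * E) P = quadCharP D P * quadCharP E P := by
  have := Fact.mk hP
  simp only [quadCharP_eq_quadraticChar, map_mul]

lemma quadCharP_congr {P : Fq[X]} (hP : Irreducible P) {D E : Fq[X]} (h : P ∣ D - E) :
    quadCharP D P = quadCharP E P := by
  have := Fact.mk hP
  simp only [quadCharP_eq_quadraticChar, AdjoinRoot.mk_eq_mk.2 h]

lemma quadCharP_assoc {P Q : Fq[X]} (h : Associated P Q) (D : Fq[X]) :
    quadCharP D P = quadCharP D Q := by
  unfold quadCharP
  simp only [h.dvd_iff_dvd_left]

lemma quadCharP_eq_zero_iff {P D : Fq[X]} : quadCharP D P = 0 ↔ P ∣ D := by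
  unfold quadCharP
  split_ifs <;> simp_all

lemma quadCharP_one {P : Fq[X]} (hP : Irreducible P) : quadCharP 1 P = 1 := by
  have := Fact.mk hP
  simp only [quadCharP_eq_quadraticChar, map_one]

lemma exists_quadCharP_eq_neg_one (hq : ringChar Fq ≠ 2) {P : Fq[X]} (hP : Irreducible P) :
    ∃ a, quadCharP a P = -1 := by
  have := Fact.mk hP
  have hK : ringChar (AdjoinRoot P) ≠ 2 := by
    rwa [← Algebra.ringChar_eq Fq (AdjoinRoot P)]
  obtain ⟨y, hy⟩ := quadraticChar_exists_neg_one hK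
  obtain ⟨a, rfl⟩ := AdjoinRoot.mk_surjective y
  exact ⟨a, by rw [quadCharP_eq_quadraticChar, hy]⟩

lemma quadCharP_nonneg (hq : ringChar Fq = 2) {P : Fq[X]} (hP : Irreducible P) (D : Fq[X]) :
    0 ≤ quadCharP D P := by
  have := Fact.mk hP
  have hK : ringChar (AdjoinRoot P) = 2 := by
    rwa [← Algebra.ringChar_eq Fq (AdjoinRoot P)]
  rw [quadCharP_eq_quadraticChar]
  by_cases h : AdjoinRoot.mk P D = 0
  · rw [h, quadraticChar_zero]
  · rw [quadraticChar_eq_one_of_char_two hK h]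
    norm_num

lemma sum_polysLT_eq_sum_adjoinRoot {M : Type*} [AddCommMonoid M] {P : Fq[X]}
    [hP : Fact (Irreducible P)] (hPm : P.Monic) (h : AdjoinRoot P → M) :
    ∑ W ∈ polysLT Fq P.natDegree, h (AdjoinRoot.mk P W) = ∑ x, h x := by
  refine Finset.sum_bij (fun W _ => AdjoinRoot.mk P W) (fun _ _ => Finset.mem_univ _) ?_ ?_ ?_
  · intro W hW W' hW' heq
    rw [mem_polysLT] at hW hW'
    rw [AdjoinRoot.mk_eq_mk] at heq
    refine sub_eq_zero.1 (eq_zero_of_dvd_of_degree_lt heq ?_)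
    rw [degree_eq_natDegree hPm.ne_zero]
    exact lt_of_le_of_lt (degree_sub_le _ _) (max_lt hW hW')
  · intro y _
    obtain ⟨a, rfl⟩ := AdjoinRoot.mk_surjective y
    refine ⟨a %ₘ P, ?_, ?_⟩
    · rw [mem_polysLT, ← degree_eq_natDegree hPm.ne_zero]
      exact degree_modByMonic_lt _ hPm
    · rw [AdjoinRoot.mk_eq_mk]
      exact ⟨-(a /ₘ P), by linear_combination modByMonic_add_div a P⟩
  · intros; rfl

lemma sum_sq_polysLT_of_irreducible (hq : ringChar Fq ≠ 2) {P : Fq[X]} (hP : Irreducible P)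
    (hPm : P.Monic) (h : Fq[X] → ℂ) (hper : ∀ V Z, h (V + P * Z) = h V) :
    ∑ y ∈ polysLT Fq P.natDegree, h (y ^ 2) =
      ∑ W ∈ polysLT Fq P.natDegree, ((quadCharP W P : ℂ) + 1) * h W := by
  have := Fact.mk hP
  have hK : ringChar (AdjoinRoot P) ≠ 2 := by
    rwa [← Algebra.ringChar_eq Fq (AdjoinRoot P)]
  obtain ⟨k, hk⟩ : ∃ k : AdjoinRoot P → ℂ, ∀ W, h W = k (AdjoinRoot.mk P W) := by
    refine ⟨fun x => h (AdjoinRoot.mk_surjective x).choose, fun W => ?_⟩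
    have := (AdjoinRoot.mk_surjective (AdjoinRoot.mk P W)).choose_spec
    obtain ⟨Z, hZ⟩ := AdjoinRoot.mk_eq_mk.1 this
    rw [← hper W Z, ← hZ]
    congr 1
    ring
  simp only [hk, quadCharP_eq_quadraticChar, map_pow]
  rw [sum_polysLT_eq_sum_adjoinRoot hPm fun x => k (x ^ 2),
    sum_polysLT_eq_sum_adjoinRoot hPm fun x => ((quadraticChar (AdjoinRoot P) x : ℂ) + 1) * k x]
  rw [← Finset.sum_fiberwise (Finset.univ) (fun x : AdjoinRoot P => x ^ 2) fun x => k (x ^ 2)]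
  refine Finset.sum_congr rfl fun x _ => ?_
  rw [Finset.sum_congr rfl (g := fun _ => k x) fun y hy => by rw [(Finset.mem_filter.1 hy).2],
    Finset.sum_const, nsmul_eq_mul]
  congr 1
  have := quadraticChar_card_sqrts hK x
  rw [← Int.cast_one, ← Int.cast_add, ← this, Int.cast_natCast]
  congr 2
  ext y
  simp

lemma quadCharP_eq_norm (hq : ringChar Fq ≠ 2) {P : Fq[X]} [hP : Fact (Irreducible P)]
    (D : Fq[X]) :
    quadCharP D P = quadraticChar Fq (Algebra.norm Fq (AdjoinRoot.mk P D)) := by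
  have hK : ringChar (AdjoinRoot P) ≠ 2 := by
    rwa [← Algebra.ringChar_eq Fq (AdjoinRoot P)]
  have := (AdjoinRoot.powerBasis hP.out.ne_zero).finite
  rw [quadCharP_eq_quadraticChar]
  set x := AdjoinRoot.mk P D
  have hcard : Fintype.card (AdjoinRoot P) = Fintype.card Fq ^ Module.finrank Fq (AdjoinRoot P) :=
    Module.card_eq_pow_finrank
  have hodd : Fintype.card Fq % 2 = 1 := FiniteField.odd_card_of_char_ne_two hq
  have hodd' : Fintype.card (AdjoinRoot P) % 2 = 1 := FiniteField.odd_card_of_char_ne_two hK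
  have h1 : Fintype.card (AdjoinRoot P) / 2 =
      (∑ i ∈ Finset.range (Module.finrank Fq (AdjoinRoot P)), Fintype.card Fq ^ i) *
        (Fintype.card Fq / 2) := by
    have h3 := geom_sum_mul (x := (Fintype.card Fq : ℤ)) (Module.finrank Fq (AdjoinRoot P))
    obtain ⟨m, hm⟩ : ∃ m, Fintype.card Fq = 2 * m + 1 := ⟨Fintype.card Fq / 2, by omega⟩
    obtain ⟨m', hm'⟩ : ∃ m, Fintype.card (AdjoinRoot P) = 2 * m + 1 :=
      ⟨Fintype.card (AdjoinRoot P) / 2, by omega⟩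
    have h4 : Fintype.card Fq / 2 = m := by omega
    have h5 : Fintype.card (AdjoinRoot P) / 2 = m' := by omega
    rw [h4, h5]
    have h6 : ((Fintype.card Fq : ℤ)) ^ Module.finrank Fq (AdjoinRoot P) = 2 * m' + 1 := by
      rw [← Nat.cast_pow, ← hcard, hm']
      push_cast
      ring
    rw [h6] at h3
    have h7 : (Fintype.card Fq : ℤ) = 2 * m + 1 := by rw [hm]; push_cast; ring
    zify
    have : (Fintype.card Fq : ℤ) - 1 = 2 * m := by linarith
    rw [this] at h3
    linarith
  have key : ((quadraticChar (AdjoinRoot P) x : ℤ) : AdjoinRoot P) =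
      ((quadraticChar Fq (Algebra.norm Fq x) : ℤ) : AdjoinRoot P) := by
    rw [quadraticChar_eq_pow_of_char_ne_two' hK, h1, pow_mul]
    have h8 := quadraticChar_eq_pow_of_char_ne_two' hq (Algebra.norm Fq x)
    have h9 := congrArg (algebraMap Fq (AdjoinRoot P)) h8
    rw [map_intCast, map_pow, FiniteField.algebraMap_norm_eq_pow_sum] at h9
    rw [h9, Nat.card_eq_fintype_card]
  have hne : (2 : AdjoinRoot P) ≠ 0 := Ring.two_ne_zero hK
  have hne1 : (1 : AdjoinRoot P) ≠ -1 := by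
    intro h
    exact hne (by linear_combination h)
  have e1 := quadraticChar_isQuadratic (AdjoinRoot P) x
  have e2 := quadraticChar_isQuadratic Fq (Algebra.norm Fq x)
  rcases e1 with e1 | e1 | e1 <;> rcases e2 with e2 | e2 | e2 <;> rw [e1, e2] at key ⊢ <;>
    simp_all

lemma map_quadCharP_of_rel {s t : Multiset Fq[X]} (h : Multiset.Rel Associated s t) (D : Fq[X]) :
    s.map (quadCharP D) = t.map (quadCharP D) := by
  rw [← Multiset.rel_eq, Multiset.rel_map]
  exact h.mono fun a _ b _ hab => quadCharP_assoc hab D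

lemma jacobi_mul_right (D : Fq[X]) {f g : Fq[X]} (hf : f ≠ 0) (hg : g ≠ 0) :
    jacobi D (f * g) = jacobi D f * jacobi D g := by
  unfold jacobi
  rw [map_quadCharP_of_rel (UniqueFactorizationMonoid.factors_mul hf hg), Multiset.map_add,
    Multiset.prod_add]

@[simp]
lemma jacobi_one_right (D : Fq[X]) : jacobi D 1 = 1 := by
  unfold jacobi
  rw [UniqueFactorizationMonoid.factors_one, Multiset.map_zero, Multiset.prod_zero]

lemma jacobi_irreducible (D : Fq[X]) {P : Fq[X]} (hP : Irreducible P) :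
    jacobi D P = quadCharP D P := by
  unfold jacobi
  have : Multiset.Rel Associated (UniqueFactorizationMonoid.factors P) {P} := by
    refine UniqueFactorizationMonoid.factors_unique
      (fun x hx => UniqueFactorizationMonoid.irreducible_of_factor x hx) ?_ ?_
    · intro x hx
      rwa [Multiset.mem_singleton.1 hx]
    · rw [Multiset.prod_singleton]
      exact UniqueFactorizationMonoid.factors_prod hP.ne_zero
  rw [map_quadCharP_of_rel this, Multiset.map_singleton, Multiset.prod_singleton]

lemma monic_induction {motive : Fq[X] → Prop} (one : motive 1)
    (mul : ∀ P f : Fq[X], P.Monic → Irreducible P → f.Monic → motive f → motive (P * f))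
    (f : Fq[X]) (hf : f.Monic) : motive f := by
  obtain ⟨n, hn⟩ : ∃ n, f.natDegree = n := ⟨_, rfl⟩
  induction n using Nat.strong_induction_on generalizing f with
  | _ n ih =>
    by_cases hu : IsUnit f
    · rwa [hf.eq_one_of_isUnit hu]
    · obtain ⟨P, hPm, hP, g, rfl⟩ := exists_monic_irreducible_factor f hu
      have hg : g.Monic := hPm.of_mul_monic_left hf
      refine mul P g hPm hP hg (ih _ ?_ g hg rfl)
      rw [← hn, hPm.natDegree_mul hg]
      have := hP.natDegree_pos
      omega

lemma jacobi_mul_left (D E : Fq[X]) {f : Fq[X]} (hf : f.Monic) :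
    jacobi (D * E) f = jacobi D f * jacobi E f := by
  refine monic_induction (motive := fun f => jacobi (D * E) f = jacobi D f * jacobi E f)
    (by simp) ?_ f hf
  intro P f hPm hP hf ih
  simp only [jacobi_mul_right _ hP.ne_zero hf.ne_zero, jacobi_irreducible _ hP, ih,
    quadCharP_mul hP]
  ring

lemma jacobi_congr {D E : Fq[X]} {f : Fq[X]} (hf : f.Monic) (h : f ∣ D - E) :
    jacobi D f = jacobi E f := by
  refine monic_induction (motive := fun f => f ∣ D - E → jacobi D f = jacobi E f)
    (by simp) ?_ f hf h
  intro P f hPm hP hf ih h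
  simp only [jacobi_mul_right _ hP.ne_zero hf.ne_zero, jacobi_irreducible _ hP,
    ih (dvd_of_mul_left_dvd h), quadCharP_congr hP (dvd_of_mul_right_dvd h)]

lemma jacobi_periodic {f : Fq[X]} (hf : f.Monic) (V Z : Fq[X]) :
    jacobi (V + f * Z) f = jacobi V f :=
  jacobi_congr hf ⟨Z, by ring⟩

lemma jacobi_one_left {f : Fq[X]} (hf : f.Monic) : jacobi 1 f = 1 := by
  refine monic_induction (motive := fun f => jacobi 1 f = 1) (by simp) ?_ f hf
  intro P f hPm hP hf ih
  simp only [jacobi_mul_right _ hP.ne_zero hf.ne_zero, jacobi_irreducible _ hP, ih,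
    quadCharP_one hP, mul_one]

lemma jacobi_eq_zero_iff {D f : Fq[X]} (hf : f.Monic) : jacobi D f = 0 ↔ ¬IsCoprime D f := by
  refine monic_induction (motive := fun f => jacobi D f = 0 ↔ ¬IsCoprime D f)
    (by simp [isCoprime_one_right]) ?_ f hf
  intro P f hPm hP hf ih
  rw [jacobi_mul_right _ hP.ne_zero hf.ne_zero, mul_eq_zero, ih, jacobi_irreducible _ hP,
    quadCharP_eq_zero_iff, IsCoprime.mul_right_iff, isCoprime_comm (y := P), hP.coprime_iff_not_dvd]
  tauto

lemma quadCharP_cases (D P : Fq[X]) :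
    quadCharP D P = 0 ∨ quadCharP D P = 1 ∨ quadCharP D P = -1 := by
  unfold quadCharP
  split_ifs <;> simp

lemma jacobi_cases (D : Fq[X]) {f : Fq[X]} (hf : f.Monic) :
    jacobi D f = 0 ∨ jacobi D f = 1 ∨ jacobi D f = -1 := by
  refine monic_induction (motive := fun f => jacobi D f = 0 ∨ jacobi D f = 1 ∨ jacobi D f = -1)
    (by simp) ?_ f hf
  intro P f hPm hP hf ih
  rw [jacobi_mul_right _ hP.ne_zero hf.ne_zero, jacobi_irreducible _ hP]
  rcases ih with h | h | h <;> rcases quadCharP_cases D P with h' | h' | h' <;> simp [h, h']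

lemma abs_jacobi_le_one (D : Fq[X]) {f : Fq[X]} (hf : f.Monic) : |jacobi D f| ≤ 1 := by
  rcases jacobi_cases D hf with h | h | h <;> simp [h]

lemma jacobi_mul_self (D : Fq[X]) {f : Fq[X]} (hf : f.Monic) :
    jacobi D (f * f) = if IsCoprime D f then 1 else 0 := by
  rw [jacobi_mul_right _ hf.ne_zero hf.ne_zero]
  have := jacobi_eq_zero_iff (D := D) hf
  split_ifs with h
  · rcases jacobi_cases D hf with h' | h' | h' <;> simp_all
  · rw [this.2 h, mul_zero]

lemma jacobi_sq_left (D : Fq[X]) {f : Fq[X]} (hf : f.Monic) :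
    jacobi (D ^ 2) f = if IsCoprime D f then 1 else 0 := by
  rw [sq, jacobi_mul_left _ _ hf, ← jacobi_mul_right _ hf.ne_zero hf.ne_zero, jacobi_mul_self _ hf]

lemma jacobi_nonneg (hq : ringChar Fq = 2) (D : Fq[X]) {f : Fq[X]} (hf : f.Monic) :
    0 ≤ jacobi D f := by
  refine monic_induction (motive := fun f => 0 ≤ jacobi D f) (by simp) ?_ f hf
  intro P f hPm hP hf ih
  rw [jacobi_mul_right _ hP.ne_zero hf.ne_zero, jacobi_irreducible _ hP]
  exact mul_nonneg (quadCharP_nonneg hq hP D) ih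

lemma algebraMap_norm_mk {P : Fq[X]} [hP : Fact (Irreducible P)] (D : Fq[X]) :
    algebraMap Fq (AlgebraicClosure Fq) (Algebra.norm Fq (AdjoinRoot.mk P D)) =
      ((P.aroots (AlgebraicClosure Fq)).map fun α => aeval α D).prod := by
  have := (AdjoinRoot.powerBasis hP.out.ne_zero).finite
  have hne : P ≠ 0 := hP.out.ne_zero
  have hnd : (P.aroots (AlgebraicClosure Fq)).Nodup :=
    (nodup_aroots_iff_of_splits hne (IsAlgClosed.splits _)).2
      (PerfectField.separable_of_irreducible hP.out)
  rw [Algebra.norm_eq_prod_embeddings]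
  have h2 : ((P.aroots (AlgebraicClosure Fq)).map fun α => aeval α D).prod =
      ∏ α ∈ (P.aroots (AlgebraicClosure Fq)).toFinset, aeval α D := by
    rw [Finset.prod, Multiset.toFinset_val, Multiset.dedup_eq_self.2 hnd]
  rw [h2]
  refine Finset.prod_bij
    (fun σ _ => ((AdjoinRoot.equiv (AlgebraicClosure Fq) Fq P hne σ : _) : AlgebraicClosure Fq))
    ?_ ?_ ?_ ?_
  · intro σ _
    rw [Multiset.mem_toFinset]
    exact (AdjoinRoot.equiv (AlgebraicClosure Fq) Fq P hne σ).2
  · intro σ _ τ _ h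
    exact (AdjoinRoot.equiv (AlgebraicClosure Fq) Fq P hne).injective (Subtype.ext h)
  · intro α hα
    obtain ⟨σ, hσ⟩ := (AdjoinRoot.equiv (AlgebraicClosure Fq) Fq P hne).surjective
      ⟨α, Multiset.mem_toFinset.1 hα⟩
    exact ⟨σ, Finset.mem_univ _, by rw [hσ]⟩
  · intro σ _
    have h3 : ((AdjoinRoot.equiv (AlgebraicClosure Fq) Fq P hne σ : _) : AlgebraicClosure Fq) =
        σ (AdjoinRoot.root P) := rfl
    rw [h3, ← AdjoinRoot.aeval_eq, aeval_algHom_apply]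

lemma norm_mk_reciprocity {P Q : Fq[X]} [hP : Fact (Irreducible P)] [hQ : Fact (Irreducible Q)]
    (hPm : P.Monic) (hQm : Q.Monic) :
    Algebra.norm Fq (AdjoinRoot.mk P Q) =
      (-1) ^ (P.natDegree * Q.natDegree) * Algebra.norm Fq (AdjoinRoot.mk Q P) := by
  have hinj := FaithfulSMul.algebraMap_injective Fq (AlgebraicClosure Fq)
  apply hinj
  rw [map_mul, map_pow, map_neg, map_one, algebraMap_norm_mk, algebraMap_norm_mk]
  have hc : ∀ R : Fq[X], (R.aroots (AlgebraicClosure Fq)).card = R.natDegree := by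
    intro R
    rw [← (IsAlgClosed.splits (R.map (algebraMap Fq (AlgebraicClosure Fq)))).natDegree_eq_card_roots,
      natDegree_map]
  simp only [(IsAlgClosed.splits _).aeval_eq_prod_aroots_of_monic hPm,
    (IsAlgClosed.splits _).aeval_eq_prod_aroots_of_monic hQm]
  rw [Multiset.prod_map_prod_map, ← hc P, ← hc Q]
  generalize P.aroots (AlgebraicClosure Fq) = s
  generalize Q.aroots (AlgebraicClosure Fq) = t
  have h1 : ∀ b, (s.map fun a => a - b).prod = (-1) ^ s.card * (s.map fun a => b - a).prod := by
    intro b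
    rw [← Multiset.card_map (fun a => b - a) s, ← Multiset.prod_map_neg, Multiset.map_map]
    simp
  simp only [h1, Multiset.prod_map_mul, Multiset.map_const', Multiset.prod_replicate, ← pow_mul]

lemma quadCharP_reciprocity (hq : ringChar Fq ≠ 2) {P Q : Fq[X]} (hP : Irreducible P)
    (hQ : Irreducible Q) (hPm : P.Monic) (hQm : Q.Monic) :
    quadCharP Q P = quadraticChar Fq (-1) ^ (P.natDegree * Q.natDegree) * quadCharP P Q := by
  have := Fact.mk hP
  have := Fact.mk hQ
  rw [quadCharP_eq_norm hq, quadCharP_eq_norm hq, norm_mk_reciprocity hPm hQm, map_mul, map_pow]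

lemma jacobi_reciprocity (hq : ringChar Fq ≠ 2) {D f : Fq[X]} (hD : D.Monic) (hf : f.Monic) :
    jacobi D f = quadraticChar Fq (-1) ^ (f.natDegree * D.natDegree) * jacobi f D := by
  refine monic_induction (motive := fun f =>
    jacobi D f = quadraticChar Fq (-1) ^ (f.natDegree * D.natDegree) * jacobi f D)
    (by simp [jacobi_one_left hD]) ?_ f hf
  intro P f hPm hP hf ih
  have key : jacobi D P = quadraticChar Fq (-1) ^ (P.natDegree * D.natDegree) * jacobi P D := by
    refine monic_induction (motive := fun D =>
      jacobi D P = quadraticChar Fq (-1) ^ (P.natDegree * D.natDegree) * jacobi P D)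
      (by simp [jacobi_one_left hPm]) ?_ D hD
    intro Q D hQm hQ hD ih
    rw [jacobi_mul_right _ hQ.ne_zero hD.ne_zero, jacobi_mul_left _ _ hPm, ih,
      jacobi_irreducible _ hP, jacobi_irreducible _ hQ, quadCharP_reciprocity hq hP hQ hPm hQm,
      hQm.natDegree_mul hD]
    ring
  rw [jacobi_mul_right _ hP.ne_zero hf.ne_zero, jacobi_mul_left _ _ hD, ih, key,
    hPm.natDegree_mul hf]
  ring

lemma quadCharP_C (hq : ringChar Fq ≠ 2) {P : Fq[X]} (hP : Irreducible P) (c : Fq) :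
    quadCharP (C c) P = quadraticChar Fq c ^ P.natDegree := by
  have := Fact.mk hP
  rw [quadCharP_eq_norm hq, AdjoinRoot.mk_C, ← AdjoinRoot.algebraMap_eq,
    Algebra.norm_algebraMap, map_pow,
    (AdjoinRoot.powerBasis hP.ne_zero).finrank, AdjoinRoot.powerBasis_dim]

lemma jacobi_C (hq : ringChar Fq ≠ 2) {f : Fq[X]} (hf : f.Monic) (c : Fq) :
    jacobi (C c) f = quadraticChar Fq c ^ f.natDegree := by
  refine monic_induction (motive := fun f => jacobi (C c) f = quadraticChar Fq c ^ f.natDegree)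
    (by simp) ?_ f hf
  intro P f hPm hP hf ih
  rw [jacobi_mul_right _ hP.ne_zero hf.ne_zero, jacobi_irreducible _ hP, ih, quadCharP_C hq hP,
    hPm.natDegree_mul hf, pow_add]

lemma exists_jacobi_eq_neg_one (hq : ringChar Fq ≠ 2) {P E : Fq[X]} (hP : Irreducible P)
    (hPE : ¬P ∣ E) : ∃ a, jacobi a P = -1 ∧ E ∣ a - 1 := by
  obtain ⟨b, hb⟩ := exists_quadCharP_eq_neg_one hq hP
  obtain ⟨u, v, huv⟩ := (hP.coprime_iff_not_dvd).2 hPE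
  refine ⟨1 + (b - 1) * v * E, ?_, ⟨(b - 1) * v, by ring⟩⟩
  rw [jacobi_irreducible _ hP, ← hb]
  exact quadCharP_congr hP ⟨(1 - b) * u, by linear_combination (b - 1) * huv⟩

lemma exists_eq_odd_pow_mul {l : Fq[X]} (hl : l.Monic) (hsq : ¬IsSquare l) :
    ∃ (P E : Fq[X]) (j : ℕ), P.Monic ∧ Irreducible P ∧ E.Monic ∧ ¬P ∣ E ∧
      l = P ^ (2 * j + 1) * E := by
  obtain ⟨n, hn⟩ : ∃ n, l.natDegree = n := ⟨_, rfl⟩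
  induction n using Nat.strong_induction_on generalizing l with
  | _ n ih =>
    have hu : ¬IsUnit l := fun hu => hsq (by rw [hl.eq_one_of_isUnit hu]; exact IsSquare.one)
    obtain ⟨P, hPm, hP, m, rfl⟩ := exists_monic_irreducible_factor l hu
    have hm : m.Monic := hPm.of_mul_monic_left hl
    by_cases hPm' : P ∣ m
    · obtain ⟨m', rfl⟩ := hPm'
      have hm' : m'.Monic := hPm.of_mul_monic_left hm
      have hsq' : ¬IsSquare m' := by
        rintro ⟨r, rfl⟩
        exact hsq ⟨P * r, by ring⟩
      obtain ⟨Q, E, j, hQm, hQ, hE, hQE, rfl⟩ := ih _ (by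
        rw [← hn, hPm.natDegree_mul hm, hPm.natDegree_mul hm']
        have := hP.natDegree_pos
        omega) hm' hsq' rfl
      by_cases hQP : Q = P
      · subst hQP
        exact ⟨Q, E, j + 1, hQm, hQ, hE, hQE, by ring⟩
      · refine ⟨Q, P * (P * E), j, hQm, hQ, hPm.mul (hPm.mul hE), ?_, by ring⟩
        intro h
        have hQP' : ¬Q ∣ P := fun h' =>
          hQP (eq_of_monic_of_associated hQm hPm (hQ.associated_of_dvd hP h'))
        rcases hQ.prime.dvd_or_dvd h with h | h
        · exact hQP' h
        · rcases hQ.prime.dvd_or_dvd h with h | h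
          · exact hQP' h
          · exact hQE h
    · exact ⟨P, m, 0, hPm, hP, hm, hPm', by ring⟩

lemma jacobi_pow_right (D : Fq[X]) {f : Fq[X]} (hf : f ≠ 0) (n : ℕ) :
    jacobi D (f ^ n) = jacobi D f ^ n := by
  induction n with
  | zero => simp
  | succ n ih => rw [pow_succ, jacobi_mul_right _ (pow_ne_zero _ hf) hf, ih, pow_succ]

lemma exists_jacobi_eq_neg_one_of_not_isSquare (hq : ringChar Fq ≠ 2) {l : Fq[X]} (hl : l.Monic)
    (hsq : ¬IsSquare l) : ∃ a, jacobi a l = -1 := by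
  obtain ⟨P, E, j, hPm, hP, hE, hPE, rfl⟩ := exists_eq_odd_pow_mul hl hsq
  obtain ⟨a, ha, haE⟩ := exists_jacobi_eq_neg_one hq hP hPE
  refine ⟨a, ?_⟩
  rw [jacobi_mul_right _ (pow_ne_zero _ hP.ne_zero) hE.ne_zero, jacobi_pow_right _ hP.ne_zero, ha,
    jacobi_congr hE haE, jacobi_one_left hE, mul_one]
  exact Odd.neg_one_pow ⟨j, rfl⟩

/-- The additive character of `Fq[X] ⧸ D` induced by `ψ`: evaluate `ψ` at the coefficient of
degree `deg D - 1` of the residue modulo `D`. -/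
noncomputable def residueChar (ψ : AddChar Fq ℂ) (D V : Fq[X]) : ℂ :=
  ψ ((V %ₘ D).coeff (D.natDegree - 1))

lemma residueChar_zero (ψ : AddChar Fq ℂ) (D : Fq[X]) : residueChar ψ D 0 = 1 := by
  simp [residueChar]

lemma residueChar_add (ψ : AddChar Fq ℂ) (D V W : Fq[X]) :
    residueChar ψ D (V + W) = residueChar ψ D V * residueChar ψ D W := by
  unfold residueChar
  rw [add_modByMonic, coeff_add, AddChar.map_add_eq_mul]

lemma residueChar_self_mul (ψ : AddChar Fq ℂ) {D : Fq[X]} (hD : D.Monic) (Z : Fq[X]) :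
    residueChar ψ D (D * Z) = 1 := by
  unfold residueChar
  rw [(modByMonic_eq_zero_iff_dvd hD).2 (dvd_mul_right D Z), coeff_zero, AddChar.map_zero_eq_one]

lemma residueChar_periodic (ψ : AddChar Fq ℂ) {D : Fq[X]} (hD : D.Monic) (V Z : Fq[X]) :
    residueChar ψ D (V + D * Z) = residueChar ψ D V := by
  rw [residueChar_add, residueChar_self_mul ψ hD, mul_one]

lemma residueChar_of_degree_lt (ψ : AddChar Fq ℂ) {D V : Fq[X]} (hD : D.Monic)
    (hV : V.degree < D.natDegree) : residueChar ψ D V = ψ (V.coeff (D.natDegree - 1)) := by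
  unfold residueChar
  rw [(modByMonic_eq_self_iff hD).2 (by rwa [degree_eq_natDegree hD.ne_zero])]

lemma residueChar_mul_left (ψ : AddChar Fq ℂ) {D E : Fq[X]} (hD : D.Monic) (hE : E.Monic)
    (Z : Fq[X]) : residueChar ψ (D * E) (E * Z) = residueChar ψ D Z := by
  have hmod : (E * Z) %ₘ (D * E) = E * (Z %ₘ D) := by
    refine (div_modByMonic_unique (Z /ₘ D) _ (hD.mul hE) ⟨?_, ?_⟩).2
    · linear_combination E * modByMonic_add_div Z D
    · rw [mul_comm D E, degree_mul, degree_mul]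
      have h1 := degree_modByMonic_lt Z hD
      rw [degree_eq_natDegree hE.ne_zero]
      exact WithBot.add_lt_add_left (by simp) h1
  unfold residueChar
  rw [hmod]
  rcases Nat.eq_zero_or_pos D.natDegree with h0 | h0
  · have h1 : D = 1 := hD.natDegree_eq_zero.1 h0
    simp [h1]
  · have h1 : (Z %ₘ D).natDegree ≤ D.natDegree - 1 := by
      by_cases hz : Z %ₘ D = 0
      · simp [hz]
      · have := natDegree_lt_natDegree hz (degree_modByMonic_lt Z hD)
        omega
    have h2 : (D * E).natDegree - 1 = E.natDegree + (D.natDegree - 1) := by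
      rw [hD.natDegree_mul hE]
      omega
    rw [h2, coeff_mul_add_eq_of_natDegree_le le_rfl h1, hE.coeff_natDegree, one_mul]

lemma exists_addChar_ne_one {ψ : AddChar Fq ℂ} (hψ : ψ ≠ 1) {a : Fq} (ha : a ≠ 0) :
    ∃ c, ψ (c * a) ≠ 1 := by
  obtain ⟨b, hb⟩ := AddChar.ne_one_iff.1 hψ
  exact ⟨b / a, by rwa [div_mul_cancel₀ _ ha]⟩

lemma sum_polysLT_add {M : Type*} [AddCommMonoid M] {n : ℕ} {v : Fq[X]} (hv : v ∈ polysLT Fq n)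
    (h : Fq[X] → M) : ∑ u ∈ polysLT Fq n, h (u + v) = ∑ u ∈ polysLT Fq n, h u := by
  rw [mem_polysLT] at hv
  refine Finset.sum_nbij' (· + v) (· - v) ?_ ?_ ?_ ?_ ?_
  · intro u hu
    rw [mem_polysLT] at hu ⊢
    exact (degree_add_le _ _).trans_lt (max_lt hu hv)
  · intro u hu
    rw [mem_polysLT] at hu ⊢
    exact (degree_sub_le _ _).trans_lt (max_lt hu hv)
  all_goals simp

lemma sum_residueChar_mul (ψ : AddChar Fq ℂ) (hψ : ψ ≠ 1) {D : Fq[X]} (hD : D.Monic) {n : ℕ}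
    (hn : n < D.natDegree) {W : Fq[X]} (hW : W ∈ polysLT Fq D.natDegree) :
    ∑ u ∈ polysLT Fq n, residueChar ψ D (u * W) =
      if W ∈ polysLT Fq (D.natDegree - n) then (Fintype.card Fq : ℂ) ^ n else 0 := by
  rw [mem_polysLT] at hW
  by_cases h0 : W = 0
  · subst h0
    simp [residueChar_zero, card_polysLT, mem_polysLT]
  have hWd : W.natDegree < D.natDegree := (natDegree_lt_iff_degree_lt h0).2 hW
  have hmem : W ∈ polysLT Fq (D.natDegree - n) ↔ W.natDegree < D.natDegree - n := by
    rw [mem_polysLT, natDegree_lt_iff_degree_lt h0]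
  split_ifs with h
  · rw [hmem] at h
    rw [Finset.sum_congr rfl (g := fun _ => 1), Finset.sum_const, card_polysLT]
    · simp
    intro u hu
    rw [mem_polysLT] at hu
    by_cases hu0 : u = 0
    · simp [hu0, residueChar_zero]
    have hu' := (natDegree_lt_iff_degree_lt hu0).2 hu
    have hd : (u * W).natDegree < D.natDegree - 1 := by
      rw [natDegree_mul hu0 h0]
      omega
    rw [residueChar_of_degree_lt ψ hD, coeff_eq_zero_of_natDegree_lt hd,
      AddChar.map_zero_eq_one]
    rw [← natDegree_lt_iff_degree_lt (mul_ne_zero hu0 h0)]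
    omega
  · rw [hmem, not_lt] at h
    obtain ⟨c, hc⟩ := exists_addChar_ne_one hψ (leadingCoeff_ne_zero.2 h0)
    set v : Fq[X] := C c * X ^ (D.natDegree - 1 - W.natDegree) with hv
    have hvmem : v ∈ polysLT Fq n := by
      rw [mem_polysLT]
      refine (degree_C_mul_X_pow_le _ _).trans_lt ?_
      exact_mod_cast (by omega : D.natDegree - 1 - W.natDegree < n)
    have hvW : residueChar ψ D (v * W) = ψ (c * W.leadingCoeff) := by
      rw [residueChar_of_degree_lt ψ hD]
      · rw [hv, mul_assoc, coeff_C_mul, mul_comm (X ^ _) W,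
          (by omega : D.natDegree - 1 = W.natDegree + (D.natDegree - 1 - W.natDegree)),
          Nat.add_sub_cancel_left, coeff_mul_X_pow]
        rfl
      · rw [degree_mul]
        refine (add_le_add (degree_C_mul_X_pow_le _ _) degree_le_natDegree).trans_lt ?_
        exact_mod_cast (by omega :
          (D.natDegree - 1 - W.natDegree) + W.natDegree < D.natDegree)
    have h1 := sum_polysLT_add hvmem fun u => residueChar ψ D (u * W)
    simp only [add_mul, residueChar_add, ← Finset.sum_mul] at h1
    rw [hvW] at h1
    by_contra hne
    exact hc (mul_left_cancel₀ hne (by rw [h1, mul_one]))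

lemma sum_monics_residueChar_mul (ψ : AddChar Fq ℂ) (hψ : ψ ≠ 1) {D : Fq[X]} (hD : D.Monic) {n : ℕ}
    (hn : n < D.natDegree) {W : Fq[X]} (hW : W ∈ polysLT Fq D.natDegree) :
    ∑ V ∈ monics Fq n, residueChar ψ D (V * W) =
      if W ∈ polysLT Fq (D.natDegree - n) then
        (Fintype.card Fq : ℂ) ^ n * ψ (W.coeff (D.natDegree - 1 - n)) else 0 := by
  rw [sum_monics]
  simp only [add_mul, residueChar_add]
  rw [← Finset.mul_sum, sum_residueChar_mul ψ hψ hD hn hW]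
  split_ifs with h
  · rw [mul_comm, residueChar_of_degree_lt ψ hD]
    · congr 2
      conv_lhs => rw [(by omega : D.natDegree - 1 = (D.natDegree - 1 - n) + n)]
      rw [mul_comm, coeff_mul_X_pow]
    · rw [mem_polysLT] at h
      by_cases h0 : W = 0
      · simp [h0]
      rw [← natDegree_lt_iff_degree_lt h0] at h
      rw [← natDegree_lt_iff_degree_lt (mul_ne_zero (pow_ne_zero _ X_ne_zero) h0),
        natDegree_mul (pow_ne_zero _ X_ne_zero) h0, natDegree_X_pow]
      omega
  · rw [mul_zero]

/-- The Gauss sum of the Jacobi symbol modulo `D`. -/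
noncomputable def jacobiGauss (ψ : AddChar Fq ℂ) (D : Fq[X]) : ℂ :=
  ∑ W ∈ polysLT Fq D.natDegree, (jacobi W D : ℂ) * residueChar ψ D W

lemma isCoprime_of_jacobi_ne_zero {a f : Fq[X]} (hf : f.Monic) (h : jacobi a f ≠ 0) :
    IsCoprime a f := by
  by_contra h'
  exact h ((jacobi_eq_zero_iff hf).2 h')

lemma sum_jacobi_residueChar (hq : ringChar Fq ≠ 2) (ψ : AddChar Fq ℂ) {D : Fq[X]} (hD : D.Monic)
    (hsq : Squarefree D) (V : Fq[X]) :
    ∑ W ∈ polysLT Fq D.natDegree, (jacobi W D : ℂ) * residueChar ψ D (V * W) =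
      (jacobi V D : ℂ) * jacobiGauss ψ D := by
  by_cases hV : IsCoprime V D
  · have h1 := sum_polysLT_mul_unit hD hV (fun W => (jacobi W D : ℂ) * residueChar ψ D W) (by
      intro V Z
      rw [jacobi_periodic hD, residueChar_periodic ψ hD])
    unfold jacobiGauss
    rw [← h1]
    simp only [jacobi_mul_left _ _ hD, Int.cast_mul, mul_assoc]
    rw [← Finset.mul_sum, ← mul_assoc]
    have h2 : (jacobi V D : ℂ) * jacobi V D = 1 := by
      have h3 := jacobi_mul_self V hD
      rw [jacobi_mul_right _ hD.ne_zero hD.ne_zero, if_pos hV] at h3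
      exact_mod_cast h3
    rw [h2, one_mul]
  · rw [(jacobi_eq_zero_iff hD).2 hV, Int.cast_zero, zero_mul]
    have hD0 : ¬IsUnit (EuclideanDomain.gcd V D) := by
      rwa [EuclideanDomain.gcd_isUnit_iff]
    obtain ⟨P, hPm, hP, hPdvd⟩ := exists_monic_irreducible_factor _ hD0
    have hPV : P ∣ V := hPdvd.trans (EuclideanDomain.gcd_dvd_left _ _)
    obtain ⟨E, rfl⟩ := hPdvd.trans (EuclideanDomain.gcd_dvd_right _ _)
    have hE : E.Monic := hPm.of_mul_monic_left hD
    have hPE : ¬P ∣ E := by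
      rintro ⟨E', rfl⟩
      exact hP.not_isUnit (hsq P ⟨E', by ring⟩)
    obtain ⟨a, ha, haE⟩ := exists_jacobi_eq_neg_one hq hP hPE
    have haD : jacobi a (P * E) = -1 := by
      rw [jacobi_mul_right _ hP.ne_zero hE.ne_zero, ha, jacobi_congr hE haE, jacobi_one_left hE,
        mul_one]
    have h1 := sum_polysLT_mul_unit hD
      (isCoprime_of_jacobi_ne_zero hD (a := a) (by rw [haD]; norm_num))
      (fun W => (jacobi W (P * E) : ℂ) * residueChar ψ (P * E) (V * W)) (by
        intro V' Z
        rw [jacobi_periodic hD, mul_add, mul_left_comm, residueChar_periodic ψ hD])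
    obtain ⟨V', rfl⟩ := hPV
    obtain ⟨b, hb⟩ := haE
    have h2 : ∀ W, residueChar ψ (P * E) (P * V' * (a * W)) =
        residueChar ψ (P * E) (P * V' * W) := by
      intro W
      rw [← residueChar_periodic ψ hD (P * V' * W) (V' * W * b)]
      congr 1
      linear_combination P * V' * W * hb
    simp only [jacobi_mul_left _ _ hD, h2, haD] at h1 ⊢
    simp only [Int.cast_neg, neg_mul, one_mul, Finset.sum_neg_distrib]
      at h1 ⊢
    linear_combination (-1 / 2 : ℂ) * h1

lemma sum_sq_residueChar_mul {ψ : AddChar Fq ℂ} {D E : Fq[X]} (hD : D.Monic) (hE : E.Monic)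
    (hDE : IsCoprime D E) (V : Fq[X]) :
    ∑ y ∈ polysLT Fq (D * E).natDegree, residueChar ψ (D * E) (V * y ^ 2) =
      (∑ y ∈ polysLT Fq D.natDegree, residueChar ψ D (V * E * y ^ 2)) *
        ∑ y ∈ polysLT Fq E.natDegree, residueChar ψ E (V * D * y ^ 2) := by
  rw [sum_polysLT_crt hD hE hDE, Finset.sum_mul_sum]
  refine Finset.sum_congr rfl fun U _ => Finset.sum_congr rfl fun W _ => ?_
  have h1 : V * (E * U + D * W) ^ 2 =
      E * (V * E * U ^ 2) + D * (V * D * W ^ 2) + D * E * (2 * V * U * W) := by ring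
  rw [h1, residueChar_periodic ψ (hD.mul hE), residueChar_add, residueChar_mul_left ψ hD hE,
    mul_comm D E, residueChar_mul_left ψ hE hD]

lemma jacobiGauss_mul (ψ : AddChar Fq ℂ) {D E : Fq[X]} (hD : D.Monic) (hE : E.Monic)
    (hDE : IsCoprime D E) :
    jacobiGauss ψ (D * E) =
      jacobi E D * jacobi D E * (jacobiGauss ψ D * jacobiGauss ψ E) := by
  unfold jacobiGauss
  rw [sum_polysLT_crt hD hE hDE, Finset.sum_mul_sum, Finset.mul_sum]
  refine Finset.sum_congr rfl fun U _ => ?_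
  rw [Finset.mul_sum]
  refine Finset.sum_congr rfl fun W _ => ?_
  have h1 : residueChar ψ (D * E) (E * U + D * W) = residueChar ψ D U * residueChar ψ E W := by
    rw [residueChar_add, residueChar_mul_left ψ hD hE, mul_comm D E,
      residueChar_mul_left ψ hE hD]
  rw [h1, jacobi_mul_right _ hD.ne_zero hE.ne_zero, jacobi_periodic hD, add_comm (E * U),
    jacobi_periodic hE, jacobi_mul_left _ _ hD, jacobi_mul_left _ _ hE]
  push_cast
  ring

lemma sum_residueChar_eq_zero {ψ : AddChar Fq ℂ} (hψ : ψ ≠ 1) {D : Fq[X]} (hD : D.Monic)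
    (hpos : 0 < D.natDegree) : ∑ W ∈ polysLT Fq D.natDegree, residueChar ψ D W = 0 := by
  obtain ⟨c, hc⟩ := exists_addChar_ne_one hψ one_ne_zero
  have hdeg : (C c * X ^ (D.natDegree - 1) : Fq[X]).degree < D.natDegree := by
    refine (degree_C_mul_X_pow_le _ _).trans_lt ?_
    exact_mod_cast (by omega : D.natDegree - 1 < D.natDegree)
  have h1 := sum_polysLT_add (mem_polysLT.2 hdeg) (residueChar ψ D)
  simp only [residueChar_add, ← Finset.sum_mul] at h1
  rw [residueChar_of_degree_lt ψ hD hdeg, coeff_C_mul_X_pow, if_pos rfl] at h1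
  rw [mul_one] at hc
  by_contra hne
  exact hc (mul_left_cancel₀ hne (by rw [h1, mul_one]))

lemma sum_sq_residueChar (hq : ringChar Fq ≠ 2) {ψ : AddChar Fq ℂ} (hψ : ψ ≠ 1) {D : Fq[X]}
    (hD : D.Monic) (hsq : Squarefree D) {V : Fq[X]} (hV : IsCoprime V D) :
    ∑ y ∈ polysLT Fq D.natDegree, residueChar ψ D (V * y ^ 2) =
      jacobi V D * jacobiGauss ψ D := by
  refine monic_induction (motive := fun D => Squarefree D → ∀ V, IsCoprime V D →
    ∑ y ∈ polysLT Fq D.natDegree, residueChar ψ D (V * y ^ 2) =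
      jacobi V D * jacobiGauss ψ D) ?_ ?_ D hD hsq V hV
  · intro _ V _
    simp [residueChar, jacobiGauss]
  · intro P D hPm hP hD ih hsq V hV
    have hPD : IsCoprime P D := (hP.coprime_iff_not_dvd).2 (by
      rintro ⟨E', rfl⟩
      exact hP.not_isUnit (hsq P ⟨E', by ring⟩))
    obtain ⟨hVP, hVD⟩ := IsCoprime.mul_right_iff.1 hV
    have hbase : ∀ V, IsCoprime V P → ∑ y ∈ polysLT Fq P.natDegree, residueChar ψ P (V * y ^ 2) =
        jacobi V P * jacobiGauss ψ P := by
      intro V hV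
      rw [sum_sq_polysLT_of_irreducible hq hP hPm (fun W => residueChar ψ P (V * W)) (by
        intro W Z
        rw [mul_add, mul_left_comm, residueChar_periodic ψ hPm])]
      simp only [add_mul, one_mul, Finset.sum_add_distrib]
      rw [sum_polysLT_mul_unit hPm hV _ (residueChar_periodic ψ hPm),
        sum_residueChar_eq_zero hψ hPm hP.natDegree_pos, add_zero,
        ← sum_jacobi_residueChar hq ψ hPm hP.squarefree]
      simp only [jacobi_irreducible _ hP]
    rw [sum_sq_residueChar_mul hPm hD hPD, hbase _ (hVP.mul_left hPD.symm),
      ih (hsq.of_mul_right) _ (hVD.mul_left hPD), jacobiGauss_mul ψ hPm hD hPD,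
      jacobi_mul_left _ _ hPm, jacobi_mul_left _ _ hD, jacobi_mul_right _ hP.ne_zero hD.ne_zero]
    push_cast
    ring

lemma sum_addChar_sq (hq : ringChar Fq ≠ 2) {ψ : AddChar Fq ℂ} (hψ : ψ ≠ 1) :
    ∑ c : Fq, ψ (c ^ 2) = ∑ c : Fq, (quadraticChar Fq c : ℂ) * ψ c := by
  rw [← Finset.sum_fiberwise (Finset.univ) (fun x : Fq => x ^ 2) fun x => ψ (x ^ 2)]
  have h0 := AddChar.sum_eq_zero_of_ne_one hψ
  rw [← add_zero (∑ c : Fq, (quadraticChar Fq c : ℂ) * ψ c), ← h0, ← Finset.sum_add_distrib]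
  refine Finset.sum_congr rfl fun x _ => ?_
  rw [Finset.sum_congr rfl (g := fun _ => ψ x) fun y hy => by rw [(Finset.mem_filter.1 hy).2],
    Finset.sum_const, nsmul_eq_mul, ← add_one_mul]
  congr 1
  have := quadraticChar_card_sqrts hq x
  rw [← Int.cast_one, ← Int.cast_add, ← this, Int.cast_natCast]
  congr 2
  ext y
  simp

lemma jacobiGauss_eq (hq : ringChar Fq ≠ 2) {ψ : AddChar Fq ℂ} (hψ : ψ ≠ 1) {D : Fq[X]}
    (hD : D.Monic) (hsq : Squarefree D) {g : ℕ} (hg : D.natDegree = 2 * g + 1) :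
    jacobiGauss ψ D =
      (Fintype.card Fq : ℂ) ^ g * ∑ c : Fq, (quadraticChar Fq c : ℂ) * ψ c := by
  have h1 := sum_sq_residueChar hq hψ hD hsq (V := 1) isCoprime_one_left
  rw [jacobi_one_left hD, Int.cast_one, one_mul] at h1
  simp only [one_mul] at h1
  have h2ne : (2 : Fq) ≠ 0 := Ring.two_ne_zero hq
  have hqne : (Fintype.card Fq : ℂ) ^ g ≠ 0 :=
    pow_ne_zero _ (by exact_mod_cast Fintype.card_ne_zero)
  have hsqsmall : ∀ u ∈ polysLT Fq g, residueChar ψ D (u ^ 2) = 1 := by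
    intro u hu
    rw [mem_polysLT] at hu
    by_cases hu0 : u = 0
    · simp [hu0, residueChar_zero]
    rw [← natDegree_lt_iff_degree_lt hu0] at hu
    have h3 : (u ^ 2).natDegree < 2 * g := by
      rw [natDegree_pow]
      omega
    rw [residueChar_of_degree_lt ψ hD, hg, Nat.add_sub_cancel, coeff_eq_zero_of_natDegree_lt h3,
      AddChar.map_zero_eq_one]
    rw [← natDegree_lt_iff_degree_lt (pow_ne_zero _ hu0)]
    omega
  have havg : (Fintype.card Fq : ℂ) ^ g * jacobiGauss ψ D =
      ∑ u ∈ polysLT Fq g, ∑ y ∈ polysLT Fq D.natDegree, residueChar ψ D ((y + u) ^ 2) := by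
    rw [Finset.sum_congr rfl (g := fun _ => jacobiGauss ψ D), Finset.sum_const, card_polysLT,
      nsmul_eq_mul, Nat.cast_pow]
    intro u hu
    rw [← h1, sum_polysLT_add (n := D.natDegree) (v := u) ?_ fun y => residueChar ψ D (y ^ 2)]
    rw [mem_polysLT] at hu ⊢
    exact hu.trans_le (by exact_mod_cast (by omega : g ≤ D.natDegree))
  have hsub : polysLT Fq (g + 1) ⊆ polysLT Fq D.natDegree := by
    intro y hy
    rw [mem_polysLT] at hy ⊢
    exact hy.trans_le (by exact_mod_cast (by omega : g + 1 ≤ D.natDegree))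
  have hrw : ∀ y ∈ polysLT Fq D.natDegree, ∑ u ∈ polysLT Fq g, residueChar ψ D ((y + u) ^ 2) =
      if y ∈ polysLT Fq (g + 1) then residueChar ψ D (y ^ 2) * (Fintype.card Fq : ℂ) ^ g
      else 0 := by
    intro y hy
    have h2y : ∀ m, C 2 * y ∈ polysLT Fq m ↔ y ∈ polysLT Fq m := by
      intro m
      rw [mem_polysLT, mem_polysLT, degree_C_mul h2ne]
    have h4 := sum_residueChar_mul ψ hψ hD (n := g) (by omega) ((h2y _).2 hy)
    rw [hg, (by omega : 2 * g + 1 - g = g + 1)] at h4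
    simp only [h2y] at h4
    rw [Finset.sum_congr rfl (g := fun u => residueChar ψ D (y ^ 2) *
      residueChar ψ D (u * (C 2 * y))), ← Finset.mul_sum, h4, mul_ite, mul_zero]
    intro u hu
    rw [(by rw [C_ofNat]; ring : (y + u) ^ 2 = y ^ 2 + u * (C 2 * y) + u ^ 2), residueChar_add,
      residueChar_add, hsqsmall u hu, mul_one]
  rw [Finset.sum_comm, Finset.sum_congr rfl hrw, ← Finset.sum_filter,
    Finset.filter_mem_eq_inter, Finset.inter_eq_right.2 hsub, ← Finset.sum_mul, mul_comm,
    mul_left_inj' hqne, sum_polysLT_succ] at havg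
  rw [havg, ← sum_addChar_sq hq hψ, Finset.mul_sum]
  refine Finset.sum_congr rfl fun c _ => ?_
  rw [Finset.sum_congr rfl (g := fun _ => ψ (c ^ 2)), Finset.sum_const, card_polysLT,
    nsmul_eq_mul, Nat.cast_pow]
  intro u hu
  have hu' := hu
  rw [mem_polysLT] at hu'
  have hd : (C c * X ^ g + u).natDegree ≤ g := by
    refine natDegree_le_of_degree_le ((degree_add_le _ _).trans (max_le ?_ hu'.le))
    exact degree_C_mul_X_pow_le _ _
  have hcoeff : ((C c * X ^ g + u) ^ 2).coeff (2 * g) = c ^ 2 := by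
    rw [sq, two_mul, coeff_mul_add_eq_of_natDegree_le hd hd, coeff_add, coeff_C_mul_X_pow, if_pos rfl,
      coeff_eq_zero_of_degree_lt hu', add_zero, sq]
  rw [residueChar_of_degree_lt ψ hD, hg, Nat.add_sub_cancel, hcoeff]
  refine degree_le_natDegree.trans_lt ?_
  have := natDegree_pow_le (p := C c * X ^ g + u) (n := 2)
  exact_mod_cast (by omega : ((C c * X ^ g + u) ^ 2).natDegree < D.natDegree)

/-- The coefficients of the `L`-function of `χ_D`. -/
noncomputable def charSum (D : Fq[X]) (n : ℕ) : ℤ := ∑ f ∈ monics Fq n, jacobi D f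

lemma sum_jacobi_left_functional_equation (hq : ringChar Fq ≠ 2) {D : Fq[X]} (hD : D.Monic)
    (hsq : Squarefree D) {g n : ℕ} (hg : D.natDegree = 2 * g + 1) (hn : n ≤ 2 * g) :
    (Fintype.card Fq : ℂ) ^ g * ∑ f ∈ monics Fq n, (jacobi f D : ℂ) =
      (Fintype.card Fq : ℂ) ^ n * ∑ f ∈ monics Fq (2 * g - n), (jacobi f D : ℂ) := by
  obtain ⟨ψ, hψ⟩ : ∃ ψ : AddChar Fq ℂ, ψ ≠ 1 ∧ ψ.IsPrimitive := by
    refine ⟨AddChar.FiniteField.primitiveChar_to_Complex Fq, ?_,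
      AddChar.FiniteField.primitiveChar_to_Complex_isPrimitive Fq⟩
    have h := AddChar.FiniteField.primitiveChar_to_Complex_isPrimitive Fq
    have := h one_ne_zero
    rwa [AddChar.mulShift_one] at this
  obtain ⟨hψ, hprim⟩ := hψ
  set τ : ℂ := ∑ c : Fq, (quadraticChar Fq c : ℂ) * ψ c with hτ
  have hτ0 : τ ≠ 0 := by
    have hχ : (quadraticChar Fq).ringHomComp (Int.castRingHom ℂ) ≠ 1 := by
      rw [MulChar.ringHomComp_ne_one_iff (RingHom.injective_int _)]
      exact quadraticChar_ne_one hq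
    have := gaussSum_ne_zero_of_nontrivial
      (by exact_mod_cast Fintype.card_ne_zero) hχ hprim
    exact this
  have hG := jacobiGauss_eq hq hψ hD hsq hg
  have key : jacobiGauss ψ D * ∑ f ∈ monics Fq n, (jacobi f D : ℂ) =
      (Fintype.card Fq : ℂ) ^ n * (τ * ∑ f ∈ monics Fq (2 * g - n), (jacobi f D : ℂ)) := by
    rw [mul_comm, Finset.sum_mul]
    simp only [← sum_jacobi_residueChar hq ψ hD hsq]
    rw [Finset.sum_comm]
    simp only [← Finset.mul_sum]
    rw [Finset.sum_congr rfl fun W hW => by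
      rw [sum_monics_residueChar_mul ψ hψ hD (by omega) hW, mul_ite, mul_zero]]
    have hsub : polysLT Fq (D.natDegree - n) ⊆ polysLT Fq D.natDegree := by
      intro y hy
      rw [mem_polysLT] at hy ⊢
      exact hy.trans_le (by exact_mod_cast (by omega : D.natDegree - n ≤ D.natDegree))
    rw [← Finset.sum_filter, Finset.filter_mem_eq_inter, Finset.inter_eq_right.2 hsub,
      sum_polysLT_leadingCoeff]
    have hJ0 : jacobi 0 D = 0 := by
      rw [jacobi_eq_zero_iff hD, isCoprime_zero_left]
      intro hu
      rw [hD.eq_one_of_isUnit hu] at hg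
      simp at hg
    rw [hJ0, Int.cast_zero, zero_mul, zero_add, hg, (by omega : 2 * g + 1 - n = 2 * g - n + 1),
      Finset.sum_range_succ, Finset.sum_eq_zero, zero_add, hτ, Finset.sum_mul_sum, Finset.mul_sum]
    · rw [← Finset.add_sum_erase _ _ (Finset.mem_univ (0 : Fq)), quadraticChar_zero]
      simp only [Int.cast_zero, zero_mul, Finset.sum_const_zero, mul_zero, zero_add]
      refine Finset.sum_congr rfl fun c hc => ?_
      rw [Finset.mul_sum]
      refine Finset.sum_congr rfl fun f hf => ?_
      have hf' := mem_monics.1 hf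
      rw [jacobi_mul_left _ _ hD, jacobi_C hq hD, hg, pow_succ, pow_mul, coeff_C_mul,
        quadraticChar_sq_one (Finset.ne_of_mem_erase hc), one_pow, one_mul, Nat.add_sub_cancel,
        ← hf'.2, hf'.1.coeff_natDegree, mul_one]
      push_cast
      ring
    · intro j hj
      rw [Finset.mem_range] at hj
      rw [Finset.sum_comm]
      refine Finset.sum_eq_zero fun f hf => ?_
      have hf' := mem_monics.1 hf
      have h3 : ∑ c : Fq, quadraticChar Fq c = 0 := quadraticChar_sum_zero hq
      rw [← Finset.add_sum_erase _ _ (Finset.mem_univ (0 : Fq)), quadraticChar_zero,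
        zero_add] at h3
      have h4 : ∑ c ∈ Finset.univ.erase (0 : Fq), (quadraticChar Fq c : ℂ) = 0 := by
        exact_mod_cast h3
      rw [← zero_mul ((jacobi f D : ℂ) * (Fintype.card Fq : ℂ) ^ n), ← h4, Finset.sum_mul]
      refine Finset.sum_congr rfl fun c hc => ?_
      rw [jacobi_mul_left _ _ hD, jacobi_C hq hD, hg, pow_succ, pow_mul, coeff_C_mul,
        quadraticChar_sq_one (Finset.ne_of_mem_erase hc), one_pow, one_mul, Nat.add_sub_cancel,
        coeff_eq_zero_of_natDegree_lt (by omega), mul_zero, AddChar.map_zero_eq_one]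
      push_cast
      ring
  rw [hG] at key
  apply mul_left_cancel₀ hτ0
  linear_combination key

lemma charSum_eq (hq : ringChar Fq ≠ 2) {D : Fq[X]} (hD : D.Monic) (n : ℕ) :
    charSum D n =
      quadraticChar Fq (-1) ^ (n * D.natDegree) * ∑ f ∈ monics Fq n, jacobi f D := by
  unfold charSum
  rw [Finset.mul_sum]
  refine Finset.sum_congr rfl fun f hf => ?_
  have hf' := mem_monics.1 hf
  rw [jacobi_reciprocity hq hD hf'.1, hf'.2]

lemma charSum_functional_equation (hq : ringChar Fq ≠ 2) {D : Fq[X]} (hD : D.Monic)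
    (hsq : Squarefree D) {g n : ℕ} (hg : D.natDegree = 2 * g + 1) (hn : n ≤ 2 * g) :
    (Fintype.card Fq : ℤ) ^ g * charSum D n = (Fintype.card Fq : ℤ) ^ n * charSum D (2 * g - n) := by
  have h1 := sum_jacobi_left_functional_equation hq hD hsq hg hn
  have h2 : (Fintype.card Fq : ℤ) ^ g * ∑ f ∈ monics Fq n, jacobi f D =
      (Fintype.card Fq : ℤ) ^ n * ∑ f ∈ monics Fq (2 * g - n), jacobi f D := by
    exact_mod_cast h1
  have h3 : quadraticChar Fq (-1) ^ ((2 * g - n) * D.natDegree) =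
      quadraticChar Fq (-1) ^ (n * D.natDegree) := by
    have h4 : quadraticChar Fq (-1) ^ 2 = 1 := quadraticChar_sq_one (by simp)
    have h5 : quadraticChar Fq (-1) ^ ((2 * g - n) * D.natDegree) *
        quadraticChar Fq (-1) ^ (n * D.natDegree) = 1 := by
      rw [← pow_add, ← add_mul, Nat.sub_add_cancel hn, mul_assoc, pow_mul, h4, one_pow]
    have h6 : quadraticChar Fq (-1) ^ (n * D.natDegree) *
        quadraticChar Fq (-1) ^ (n * D.natDegree) = 1 := by
      rw [← pow_add, ← two_mul, pow_mul, h4, one_pow]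
    linear_combination quadraticChar Fq (-1) ^ (n * D.natDegree) * h5 -
      quadraticChar Fq (-1) ^ ((2 * g - n) * D.natDegree) * h6
  rw [charSum_eq hq hD, charSum_eq hq hD, h3]
  linear_combination quadraticChar Fq (-1) ^ (n * D.natDegree) * h2

lemma sum_jacobi_left_eq_zero (hq : ringChar Fq ≠ 2) {l : Fq[X]} (hl : l.Monic)
    (hsq : ¬IsSquare l) : ∑ W ∈ polysLT Fq l.natDegree, jacobi W l = 0 := by
  obtain ⟨a, ha⟩ := exists_jacobi_eq_neg_one_of_not_isSquare hq hl hsq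
  have h1 := sum_polysLT_mul_unit hl
    (isCoprime_of_jacobi_ne_zero hl (a := a) (by rw [ha]; norm_num))
    (fun W => jacobi W l) (jacobi_periodic hl)
  simp only [jacobi_mul_left _ _ hl, ha, neg_mul, one_mul, Finset.sum_neg_distrib] at h1
  omega

lemma sum_monics_jacobi_left_eq_zero (hq : ringChar Fq ≠ 2) {l : Fq[X]} (hl : l.Monic)
    (hsq : ¬IsSquare l) {n : ℕ} (hn : l.natDegree ≤ n) : ∑ f ∈ monics Fq n, jacobi f l = 0 := by
  rw [sum_monics_periodic hl hn _ (jacobi_periodic hl), sum_jacobi_left_eq_zero hq hl hsq,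
    smul_zero]

lemma abs_charSum_le_card (D : Fq[X]) (n : ℕ) : |charSum D n| ≤ (Fintype.card Fq : ℤ) ^ n := by
  unfold charSum
  refine (Finset.abs_sum_le_sum_abs _ _).trans ?_
  refine (Finset.sum_le_card_nsmul _ _ 1 fun f hf =>
    abs_jacobi_le_one D (mem_monics.1 hf).1).trans ?_
  rw [card_monics]
  simp

lemma charSum_eq_zero (hq : ringChar Fq ≠ 2) {D : Fq[X]} (hD : D.Monic) {g n : ℕ}
    (hg : D.natDegree = 2 * g + 1) (hn : 2 * g < n) : charSum D n = 0 := by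
  rw [charSum_eq hq hD, sum_monics_jacobi_left_eq_zero hq hD ?_ (by omega), mul_zero]
  rintro ⟨r, rfl⟩
  have hr : r ≠ 0 := left_ne_zero_of_mul hD.ne_zero
  rw [natDegree_mul hr hr] at hg
  omega

lemma abs_charSum_le (hq : ringChar Fq ≠ 2) {D : Fq[X]} (hD : D.Monic) (hsq : Squarefree D) {g : ℕ}
    (hg : D.natDegree = 2 * g + 1) (n : ℕ) : |charSum D n| ≤ (Fintype.card Fq : ℤ) ^ g := by
  have hq1 : (1 : ℤ) ≤ Fintype.card Fq := by exact_mod_cast Fintype.card_pos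
  rcases le_or_gt n g with h | h
  · exact (abs_charSum_le_card D n).trans (pow_le_pow_right₀ hq1 h)
  rcases le_or_gt n (2 * g) with h' | h'
  · have h1 := charSum_functional_equation hq hD hsq hg h'
    have hpos : (0 : ℤ) < (Fintype.card Fq : ℤ) ^ g := by positivity
    refine le_of_mul_le_mul_left ?_ hpos
    calc (Fintype.card Fq : ℤ) ^ g * |charSum D n|
        = |(Fintype.card Fq : ℤ) ^ g * charSum D n| := by rw [abs_mul, abs_of_pos hpos]
      _ = (Fintype.card Fq : ℤ) ^ n * |charSum D (2 * g - n)| := by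
        rw [h1, abs_mul, abs_of_nonneg (by positivity)]
      _ ≤ (Fintype.card Fq : ℤ) ^ n * (Fintype.card Fq : ℤ) ^ (2 * g - n) :=
        mul_le_mul_of_nonneg_left (abs_charSum_le_card _ _) (by positivity)
      _ = (Fintype.card Fq : ℤ) ^ g * (Fintype.card Fq : ℤ) ^ g := by
        rw [← pow_add, ← pow_add]
        congr 1
        omega
  · rw [charSum_eq_zero hq hD hg h', abs_zero]
    positivity

lemma dvd_of_sq_dvd_sq_mul {A C D : Fq[X]} (hA : A.Monic) (hD : Squarefree D)
    (h : A ^ 2 ∣ C ^ 2 * D) : A ∣ C := by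
  refine monic_induction (motive := fun A => ∀ C : Fq[X], A ^ 2 ∣ C ^ 2 * D → A ∣ C)
    (fun _ _ => one_dvd _) ?_ A hA C h
  intro P A hPm hP hA ih C h
  have hPC : P ∣ C := by
    by_contra hPC
    have h1 : IsCoprime (P ^ 2) (C ^ 2) := ((hP.coprime_iff_not_dvd).2 hPC).pow
    have h2 : P ^ 2 ∣ D := h1.dvd_of_dvd_mul_left ((pow_dvd_pow_of_dvd (dvd_mul_right P A) 2).trans h)
    exact hP.not_isUnit (hD P (by rwa [← sq]))
  obtain ⟨C', rfl⟩ := hPC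
  refine mul_dvd_mul_left P (ih C' ?_)
  rw [mul_pow, mul_pow, mul_assoc] at h
  exact (mul_dvd_mul_iff_left (pow_ne_zero 2 hP.ne_zero)).1 h

lemma exists_eq_sq_mul_squarefree {D : Fq[X]} (hD : D.Monic) :
    ∃ C E : Fq[X], C.Monic ∧ E.Monic ∧ Squarefree E ∧ D = C ^ 2 * E := by
  refine monic_induction (motive := fun D => ∃ C E : Fq[X], C.Monic ∧ E.Monic ∧ Squarefree E ∧
    D = C ^ 2 * E) ⟨1, 1, monic_one, monic_one, squarefree_one, by ring⟩ ?_ D hD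
  rintro P D hPm hP hD ⟨C, E, hC, hE, hsq, rfl⟩
  by_cases hPE : P ∣ E
  · obtain ⟨E', rfl⟩ := hPE
    exact ⟨P * C, E', hPm.mul hC, hPm.of_mul_monic_left hE, hsq.of_mul_right, by ring⟩
  · refine ⟨C, P * E, hC, hPm.mul hE, ?_, by ring⟩
    rw [squarefree_mul_iff]
    exact ⟨((hP.coprime_iff_not_dvd).2 hPE).isRelPrime, hP.squarefree, hsq⟩

lemma eq_of_monic_of_dvd_dvd {A B : Fq[X]} (hA : A.Monic) (hB : B.Monic) (h : A ∣ B)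
    (h' : B ∣ A) : A = B :=
  eq_of_monic_of_associated hA hB (associated_of_dvd_dvd h h')

lemma sum_monics_eq_sum_sq_mul_sqfrees {M : Type*} [AddCommMonoid M] (N : ℕ) (F : Fq[X] → M) :
    ∑ D ∈ monics Fq N, F D = ∑ c ∈ Finset.range (N / 2 + 1), ∑ C ∈ monics Fq c,
      ∑ E ∈ sqfrees Fq (N - 2 * c), F (C ^ 2 * E) := by
  simp only [← Finset.sum_product']
  rw [Finset.sum_sigma']
  symm
  refine Finset.sum_bij (fun x _ => x.2.1 ^ 2 * x.2.2) ?_ ?_ ?_ ?_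
  · rintro ⟨c, C, E⟩ hx
    simp only [Finset.mem_sigma, Finset.mem_range, Finset.mem_product, mem_monics,
      mem_sqfrees] at hx ⊢
    obtain ⟨hc, ⟨hC, hCd⟩, ⟨hE, hEd⟩, hsq⟩ := hx
    refine ⟨(hC.pow 2).mul hE, ?_⟩
    rw [(hC.pow 2).natDegree_mul hE, hC.natDegree_pow, hCd, hEd]
    omega
  · rintro ⟨c, C, E⟩ hx ⟨c', C', E'⟩ hx' heq
    simp only [Finset.mem_sigma, Finset.mem_range, Finset.mem_product, mem_monics,
      mem_sqfrees] at hx hx' heq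
    obtain ⟨hc, ⟨hC, hCd⟩, ⟨hE, hEd⟩, hsq⟩ := hx
    obtain ⟨hc', ⟨hC', hCd'⟩, ⟨hE', hEd'⟩, hsq'⟩ := hx'
    have h1 : C = C' := eq_of_monic_of_dvd_dvd hC hC'
      (dvd_of_sq_dvd_sq_mul hC hsq' (heq ▸ dvd_mul_right _ _))
      (dvd_of_sq_dvd_sq_mul hC' hsq (heq ▸ dvd_mul_right _ _))
    subst h1
    have h2 : E = E' := mul_left_cancel₀ (pow_ne_zero 2 hC.ne_zero) heq
    subst h2
    subst hCd
    subst hCd'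
    rfl
  · intro D hD
    rw [mem_monics] at hD
    obtain ⟨C, E, hC, hE, hsq, rfl⟩ := exists_eq_sq_mul_squarefree hD.1
    have h1 := hD.2
    rw [(hC.pow 2).natDegree_mul hE, hC.natDegree_pow] at h1
    refine ⟨⟨C.natDegree, C, E⟩, ?_, rfl⟩
    simp only [Finset.mem_sigma, Finset.mem_range, Finset.mem_product, mem_monics, mem_sqfrees]
    exact ⟨by omega, ⟨hC, trivial⟩, ⟨hE, by omega⟩, hsq⟩
  · intros
    rfl

/-- Monic divisors of a polynomial. -/
noncomputable def monicDivisors (f : Fq[X]) : Finset Fq[X] :=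
  (monicsLE Fq f.natDegree).filter (· ∣ f)

lemma mem_monicDivisors {f d : Fq[X]} (hf : f.Monic) : d ∈ monicDivisors f ↔ d.Monic ∧ d ∣ f := by
  unfold monicDivisors
  rw [Finset.mem_filter, mem_monicsLE]
  exact ⟨fun h => ⟨h.1.1, h.2⟩, fun h => ⟨⟨h.1, natDegree_le_of_dvd h.2 hf.ne_zero⟩, h.2⟩⟩

lemma one_mem_monicDivisors {f : Fq[X]} (hf : f.Monic) : 1 ∈ monicDivisors f :=
  (mem_monicDivisors hf).2 ⟨monic_one, one_dvd _⟩

lemma moebiusP_one : moebiusP (1 : Fq[X]) = 1 := by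
  simp [moebiusP, UniqueFactorizationMonoid.factors_one]

lemma abs_moebiusP_le (f : Fq[X]) : |moebiusP f| ≤ 1 := by
  unfold moebiusP
  split_ifs <;> simp

lemma squarefree_irreducible_mul_iff {P A : Fq[X]} (hP : Irreducible P) :
    Squarefree (P * A) ↔ ¬P ∣ A ∧ Squarefree A := by
  rw [squarefree_mul_iff]
  constructor
  · rintro ⟨h1, -, h2⟩
    refine ⟨fun h => hP.not_isUnit (h1 dvd_rfl h), h2⟩
  · rintro ⟨h1, h2⟩
    exact ⟨((hP.coprime_iff_not_dvd).2 h1).isRelPrime, hP.squarefree, h2⟩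

lemma moebiusP_irreducible_mul {P A : Fq[X]} (hP : Irreducible P) (hA : A.Monic) (hPA : ¬P ∣ A) :
    moebiusP (P * A) = -moebiusP A := by
  unfold moebiusP
  simp only [squarefree_irreducible_mul_iff hP, hPA, not_false_eq_true, true_and]
  have h1 : (UniqueFactorizationMonoid.factors P).card = 1 := by
    have : Multiset.Rel Associated (UniqueFactorizationMonoid.factors P) {P} := by
      refine UniqueFactorizationMonoid.factors_unique
        (fun x hx => UniqueFactorizationMonoid.irreducible_of_factor x hx) ?_ ?_
      · intro x hx
        rwa [Multiset.mem_singleton.1 hx]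
      · rw [Multiset.prod_singleton]
        exact UniqueFactorizationMonoid.factors_prod hP.ne_zero
    rw [Multiset.card_eq_card_of_rel this, Multiset.card_singleton]
  have h2 := Multiset.card_eq_card_of_rel
    (UniqueFactorizationMonoid.factors_mul hP.ne_zero hA.ne_zero)
  rw [h2, Multiset.card_add, h1]
  split_ifs
  · ring
  · simp

lemma moebiusP_irreducible_mul_of_dvd {P A : Fq[X]} (hP : Irreducible P) (hPA : P ∣ A) :
    moebiusP (P * A) = 0 := by
  unfold moebiusP
  rw [if_neg]
  rw [squarefree_irreducible_mul_iff hP]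
  tauto

lemma sum_moebiusP_monicDivisors {f : Fq[X]} (hf : f.Monic) :
    ∑ A ∈ monicDivisors f, moebiusP A = if f = 1 then 1 else 0 := by
  split_ifs with h
  · subst h
    have : monicDivisors (1 : Fq[X]) = {1} := by
      ext A
      rw [mem_monicDivisors monic_one, Finset.mem_singleton]
      constructor
      · rintro ⟨h1, h2⟩
        exact h1.eq_one_of_isUnit (isUnit_of_dvd_one h2)
      · rintro rfl
        exact ⟨monic_one, dvd_rfl⟩
    rw [this, Finset.sum_singleton, moebiusP_one]
  · obtain ⟨P, hPm, hP, hPf⟩ := exists_monic_irreducible_factor f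
      fun hu => h (hf.eq_one_of_isUnit hu)
    rw [← Finset.sum_filter_add_sum_filter_not _ (P ∣ ·)]
    have h1 : ∑ A ∈ (monicDivisors f).filter (P ∣ ·), moebiusP A =
        ∑ A ∈ (monicDivisors f).filter (¬P ∣ ·), moebiusP (P * A) := by
      symm
      refine Finset.sum_bij_ne_zero (fun A _ _ => P * A) ?_ ?_ ?_ ?_
      · intro A hA _
        rw [Finset.mem_filter, mem_monicDivisors hf] at hA ⊢
        exact ⟨⟨hPm.mul hA.1.1, ((hP.coprime_iff_not_dvd).2 hA.2).mul_dvd hPf hA.1.2⟩,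
          dvd_mul_right _ _⟩
      · intro A _ _ B _ _ h
        exact mul_left_cancel₀ hP.ne_zero h
      · intro A hA hne
        rw [Finset.mem_filter, mem_monicDivisors hf] at hA
        obtain ⟨⟨hAm, hAf⟩, B, rfl⟩ := hA
        have hPB : ¬P ∣ B := fun h => hne (moebiusP_irreducible_mul_of_dvd hP h)
        refine ⟨B, ?_, hne, rfl⟩
        rw [Finset.mem_filter, mem_monicDivisors hf]
        exact ⟨⟨hPm.of_mul_monic_left hAm, (dvd_mul_left _ _).trans hAf⟩, hPB⟩
      · intros
        rfl
    rw [h1, ← Finset.sum_add_distrib]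
    refine Finset.sum_eq_zero fun A hA => ?_
    rw [Finset.mem_filter, mem_monicDivisors hf] at hA
    rw [moebiusP_irreducible_mul hP hA.1.1 hA.2, neg_add_cancel]

/-- The part of the Möbius divisor sum over divisors of degree larger than `a`. -/
noncomputable def moebiusTail (a : ℕ) (C : Fq[X]) : ℤ :=
  ∑ A ∈ (monicDivisors C).filter (a < ·.natDegree), moebiusP A

lemma moebiusTail_eq_zero {a : ℕ} {C : Fq[X]} (hC : C.Monic) (h : C.natDegree ≤ a) :
    moebiusTail a C = 0 := by
  unfold moebiusTail
  rw [Finset.filter_eq_empty_iff.2, Finset.sum_empty]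
  intro A hA
  have := natDegree_le_of_dvd ((mem_monicDivisors hC).1 hA).2 hC.ne_zero
  omega

lemma abs_moebiusTail_le (a : ℕ) (C : Fq[X]) : |moebiusTail a C| ≤ (monicDivisors C).card := by
  unfold moebiusTail
  refine (Finset.abs_sum_le_sum_abs _ _).trans ?_
  refine (Finset.sum_le_card_nsmul _ _ 1 fun f _ => abs_moebiusP_le f).trans ?_
  rw [nsmul_eq_mul, mul_one]
  exact_mod_cast Finset.card_filter_le _ _

lemma sum_sqfrees_eq {N a : ℕ} (ha : 2 * a ≤ N) (F : Fq[X] → ℤ) :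
    ∑ D ∈ sqfrees Fq N, F D =
      ∑ A ∈ monicsLE Fq a, moebiusP A * ∑ B ∈ monics Fq (N - 2 * A.natDegree), F (A ^ 2 * B) +
      ∑ c ∈ Finset.range (N / 2 + 1), ∑ C ∈ monics Fq c,
        moebiusTail a C * ∑ E ∈ sqfrees Fq (N - 2 * c), F (C ^ 2 * E) := by
  set S : Fq[X] → ℤ := fun C => ∑ E ∈ sqfrees Fq (N - 2 * C.natDegree), F (C ^ 2 * E) with hS
  have h1 : ∑ D ∈ sqfrees Fq N, F D =
      ∑ c ∈ Finset.range (N / 2 + 1), ∑ C ∈ monics Fq c,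
        (∑ A ∈ monicDivisors C, moebiusP A) * S C := by
    symm
    rw [Finset.sum_range_succ', Finset.sum_eq_zero, zero_add]
    · have : monics Fq 0 = {1} := by
        ext f
        rw [mem_monics, Finset.mem_singleton]
        constructor
        · rintro ⟨h, h'⟩
          exact h.natDegree_eq_zero.1 h'
        · rintro rfl
          exact ⟨monic_one, natDegree_one⟩
      rw [this, Finset.sum_singleton, sum_moebiusP_monicDivisors monic_one, if_pos rfl, one_mul]
      simp [hS]
    · intro c _
      refine Finset.sum_eq_zero fun C hC => ?_
      rw [mem_monics] at hC
      rw [sum_moebiusP_monicDivisors hC.1, if_neg, zero_mul]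
      rintro rfl
      simp at hC
  have h2 : ∀ C : Fq[X], ∑ A ∈ monicDivisors C, moebiusP A =
      ∑ A ∈ (monicDivisors C).filter (·.natDegree ≤ a), moebiusP A + moebiusTail a C := by
    intro C
    unfold moebiusTail
    rw [← Finset.sum_filter_add_sum_filter_not _ (·.natDegree ≤ a)]
    simp only [not_le]
  have h3 : ∀ c, ∑ C ∈ monics Fq c, (∑ A ∈ monicDivisors C, moebiusP A) * S C =
      ∑ C ∈ monics Fq c, (∑ A ∈ (monicDivisors C).filter (·.natDegree ≤ a), moebiusP A) * S C +
      ∑ C ∈ monics Fq c, moebiusTail a C * ∑ E ∈ sqfrees Fq (N - 2 * c), F (C ^ 2 * E) := by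
    intro c
    rw [← Finset.sum_add_distrib]
    refine Finset.sum_congr rfl fun C hC => ?_
    rw [h2, add_mul]
    simp only [hS, (mem_monics.1 hC).2]
  rw [h1]
  simp only [h3]
  rw [Finset.sum_add_distrib, add_left_inj]
  have h4 : ∀ c, ∑ C ∈ monics Fq c,
      (∑ A ∈ (monicDivisors C).filter (·.natDegree ≤ a), moebiusP A) * S C =
      ∑ A ∈ monicsLE Fq a, moebiusP A * ∑ C ∈ (monics Fq c).filter (A ∣ ·), S C := by
    intro c
    simp only [Finset.mul_sum, Finset.sum_mul]
    rw [Finset.sum_comm' (t' := monicsLE Fq a) (s' := fun A => (monics Fq c).filter (A ∣ ·))]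
    intro C A
    rw [Finset.mem_filter, Finset.mem_filter, mem_monicsLE]
    constructor
    · rintro ⟨hC, hA, hAa⟩
      have hA' := (mem_monicDivisors (mem_monics.1 hC).1).1 hA
      exact ⟨⟨hC, hA'.2⟩, hA'.1, hAa⟩
    · rintro ⟨⟨hC, hA⟩, hAm, hAa⟩
      exact ⟨hC, (mem_monicDivisors (mem_monics.1 hC).1).2 ⟨hAm, hA⟩, hAa⟩
  simp only [h4]
  rw [Finset.sum_comm]
  refine Finset.sum_congr rfl fun A hA => ?_
  rw [mem_monicsLE] at hA
  rw [← Finset.mul_sum]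
  congr 1
  rw [sum_monics_eq_sum_sq_mul_sqfrees]
  have hsplit : N / 2 + 1 = A.natDegree + ((N - 2 * A.natDegree) / 2 + 1) := by omega
  rw [hsplit, Finset.sum_range_add, Finset.sum_eq_zero, zero_add]
  · refine Finset.sum_congr rfl fun c hc => ?_
    rw [sum_monics_filter_dvd hA.1 (by omega), Nat.add_sub_cancel_left]
    refine Finset.sum_congr rfl fun C hC => ?_
    simp only [hS]
    rw [hA.1.natDegree_mul (mem_monics.1 hC).1, (mem_monics.1 hC).2]
    rw [(by omega : N - 2 * (A.natDegree + c) = N - 2 * A.natDegree - 2 * c)]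
    refine Finset.sum_congr rfl fun E _ => ?_
    congr 1
    ring
  · intro c hc
    rw [Finset.mem_range] at hc
    rw [monics_filter_dvd_eq_empty hc, Finset.sum_empty]

lemma card_sqfrees {N : ℕ} (hN : 2 ≤ N) :
    (sqfrees Fq N).card + Fintype.card Fq ^ (N - 1) = Fintype.card Fq ^ N := by
  have key : ∀ M, (Fintype.card Fq ^ M : ℕ) = ∑ c ∈ Finset.range (M / 2 + 1),
      Fintype.card Fq ^ c * (sqfrees Fq (M - 2 * c)).card := by
    intro M
    have h := sum_monics_eq_sum_sq_mul_sqfrees (Fq := Fq) M fun _ => (1 : ℕ)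
    simpa [card_monics] using h
  have h1 := key N
  have h2 := key (N - 2)
  rw [Finset.sum_range_succ', (by omega : N / 2 = (N - 2) / 2 + 1)] at h1
  have h3 : ∑ c ∈ Finset.range ((N - 2) / 2 + 1),
      Fintype.card Fq ^ (c + 1) * (sqfrees Fq (N - 2 * (c + 1))).card =
      Fintype.card Fq * Fintype.card Fq ^ (N - 2) := by
    rw [h2, Finset.mul_sum]
    refine Finset.sum_congr rfl fun c _ => ?_
    rw [(by omega : N - 2 * (c + 1) = N - 2 - 2 * c)]
    ring
  rw [h3, ← pow_succ', (by omega : N - 2 + 1 = N - 1)] at h1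
  simp only [pow_zero, one_mul, mul_zero, Nat.sub_zero] at h1
  omega

lemma card_sqfrees_ge {N : ℕ} (hN : 2 ≤ N) :
    (Fintype.card Fq : ℝ) ^ N ≤ 2 * (sqfrees Fq N).card := by
  have h := card_sqfrees (Fq := Fq) hN
  have hq : 2 ≤ Fintype.card Fq := Fintype.one_lt_card
  have h2 : 2 * Fintype.card Fq ^ (N - 1) ≤ Fintype.card Fq ^ N := by
    conv_rhs => rw [(by omega : N = N - 1 + 1), pow_succ']
    exact Nat.mul_le_mul_right _ hq
  have h3 : Fintype.card Fq ^ N ≤ 2 * (sqfrees Fq N).card := by omega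
  exact_mod_cast h3

/-- The square root of the cardinality of the base field. -/
noncomputable def sqrtCard (Fq : Type) [Fintype Fq] : ℝ := Real.sqrt (Fintype.card Fq)

lemma sqrtCard_sq : sqrtCard Fq ^ 2 = Fintype.card Fq :=
  Real.sq_sqrt (Nat.cast_nonneg _)

lemma one_lt_sqrtCard : 1 < sqrtCard Fq := by
  unfold sqrtCard
  rw [Real.lt_sqrt zero_le_one]
  have : 1 < Fintype.card Fq := Fintype.one_lt_card
  exact_mod_cast (by omega : 1 ^ 2 < Fintype.card Fq)

lemma sqrtCard_pos : 0 < sqrtCard Fq := zero_lt_one.trans one_lt_sqrtCard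

lemma card_pow_eq (n : ℕ) : (Fintype.card Fq : ℝ) ^ n = sqrtCard Fq ^ (2 * n) := by
  rw [pow_mul, sqrtCard_sq]

lemma card_monicDivisors_mul_ge {P C : Fq[X]} (hP : Irreducible P) (hPm : P.Monic)
    (hC : C.Monic) (hPC : ¬P ∣ C) :
    2 * (monicDivisors C).card ≤ (monicDivisors (P * C)).card := by
  have hinj : Function.Injective fun d : Fq[X] => P * d := fun a b h =>
    mul_left_cancel₀ hP.ne_zero h
  have hdisj : Disjoint (monicDivisors C) ((monicDivisors C).image fun d => P * d) := by
    rw [Finset.disjoint_left]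
    intro d hd hd'
    obtain ⟨e, -, rfl⟩ := Finset.mem_image.1 hd'
    exact hPC ((dvd_mul_right P e).trans ((mem_monicDivisors hC).1 hd).2)
  rw [two_mul]
  nth_rewrite 2 [← Finset.card_image_of_injective _ hinj]
  rw [← Finset.card_union_of_disjoint hdisj]
  refine Finset.card_le_card ?_
  intro d hd
  rw [mem_monicDivisors (hPm.mul hC)]
  rcases Finset.mem_union.1 hd with hd | hd
  · rw [mem_monicDivisors hC] at hd
    exact ⟨hd.1, hd.2.mul_left P⟩
  · obtain ⟨e, he, rfl⟩ := Finset.mem_image.1 hd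
    rw [mem_monicDivisors hC] at he
    exact ⟨hPm.mul he.1, mul_dvd_mul_left P he.2⟩

lemma monicDivisors_mono {C E : Fq[X]} (hC : C.Monic) (hE : E.Monic) (h : C ∣ E) :
    (monicDivisors C).card ≤ (monicDivisors E).card := by
  refine Finset.card_le_card fun d hd => ?_
  rw [mem_monicDivisors hC] at hd
  rw [mem_monicDivisors hE]
  exact ⟨hd.1, hd.2.trans h⟩

lemma abs_sum_coprime_jacobi_le (hq : ringChar Fq ≠ 2) {D : Fq[X]} (hD : D.Monic)
    (hsq : Squarefree D) {g : ℕ} (hg : D.natDegree = 2 * g + 1) {C : Fq[X]} (hC : C.Monic)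
    (n : ℕ) :
    |∑ f ∈ (monics Fq n).filter (IsCoprime · C), jacobi D f| ≤
      (monicDivisors C).card * (Fintype.card Fq : ℤ) ^ g := by
  refine monic_induction (motive := fun C => ∀ n,
    |∑ f ∈ (monics Fq n).filter (IsCoprime · C), jacobi D f| ≤
      (monicDivisors C).card * (Fintype.card Fq : ℤ) ^ g) ?_ ?_ C hC n
  · intro n
    rw [Finset.filter_true_of_mem fun f _ => isCoprime_one_right]
    refine (abs_charSum_le hq hD hsq hg n).trans ?_
    refine le_mul_of_one_le_left (by positivity) ?_
    exact_mod_cast Finset.card_pos.2 ⟨1, one_mem_monicDivisors monic_one⟩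
  · intro P C hPm hP hC ih n
    by_cases hPC : P ∣ C
    · have h1 : (monics Fq n).filter (IsCoprime · (P * C)) =
          (monics Fq n).filter (IsCoprime · C) := by
        refine Finset.filter_congr fun f _ => ?_
        rw [IsCoprime.mul_right_iff]
        exact ⟨fun h => h.2, fun h => ⟨h.of_isCoprime_of_dvd_right hPC, h⟩⟩
      rw [h1]
      refine (ih n).trans (mul_le_mul_of_nonneg_right ?_ (by positivity))
      exact_mod_cast monicDivisors_mono hC (hPm.mul hC) (dvd_mul_left C P)
    · have h1 : ∑ f ∈ (monics Fq n).filter (IsCoprime · (P * C)), jacobi D f =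
          ∑ f ∈ (monics Fq n).filter (IsCoprime · C), jacobi D f -
          ∑ f ∈ ((monics Fq n).filter (P ∣ ·)).filter (IsCoprime · C), jacobi D f := by
        rw [eq_sub_iff_add_eq, ← Finset.sum_filter_add_sum_filter_not
          ((monics Fq n).filter (IsCoprime · C)) (¬P ∣ ·)]
        congr 1
        · refine Finset.sum_congr ?_ fun _ _ => rfl
          ext f
          simp only [Finset.mem_filter, IsCoprime.mul_right_iff, isCoprime_comm (y := P),
            hP.coprime_iff_not_dvd]
          tauto
        · refine Finset.sum_congr ?_ fun _ _ => rfl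
          ext f
          simp only [Finset.mem_filter]
          tauto
      have h2 : |∑ f ∈ ((monics Fq n).filter (P ∣ ·)).filter (IsCoprime · C), jacobi D f| ≤
          (monicDivisors C).card * (Fintype.card Fq : ℤ) ^ g := by
        rcases le_or_gt P.natDegree n with hPn | hPn
        · rw [Finset.sum_filter, sum_monics_filter_dvd hPm hPn]
          have h3 : ∀ f ∈ monics Fq (n - P.natDegree),
              (if IsCoprime (P * f) C then jacobi D (P * f) else 0) =
                jacobi D P * if IsCoprime f C then jacobi D f else 0 := by
            intro f hf
            rw [IsCoprime.mul_left_iff, jacobi_mul_right _ hP.ne_zero (mem_monics.1 hf).1.ne_zero,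
              mul_ite, mul_zero]
            simp only [(hP.coprime_iff_not_dvd).2 hPC, true_and]
          rw [Finset.sum_congr rfl h3, ← Finset.mul_sum, ← Finset.sum_filter, abs_mul]
          exact (mul_le_of_le_one_left (abs_nonneg _) (abs_jacobi_le_one D hPm)).trans (ih _)
        · rw [monics_filter_dvd_eq_empty hPn]
          simp only [Finset.filter_empty, Finset.sum_empty, abs_zero]
          positivity
      rw [h1]
      refine (abs_sub _ _).trans ((add_le_add (ih n) h2).trans ?_)
      rw [← two_mul, ← mul_assoc]
      refine mul_le_mul_of_nonneg_right ?_ (by positivity)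
      exact_mod_cast card_monicDivisors_mul_ge hP hPm hC hPC

lemma sum_card_monicDivisors (c : ℕ) :
    ∑ C ∈ monics Fq c, (monicDivisors C).card = (c + 1) * Fintype.card Fq ^ c := by
  have h1 : ∑ C ∈ monics Fq c, (monicDivisors C).card =
      ∑ A ∈ monicsLE Fq c, ((monics Fq c).filter (A ∣ ·)).card := by
    simp only [Finset.card_eq_sum_ones]
    refine Finset.sum_comm' fun C A => ?_
    rw [Finset.mem_filter, mem_monicsLE, mem_monics]
    constructor
    · rintro ⟨hC, hA⟩
      rw [mem_monicDivisors hC.1] at hA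
      exact ⟨⟨hC, hA.2⟩, hA.1, hC.2 ▸ natDegree_le_of_dvd hA.2 hC.1.ne_zero⟩
    · rintro ⟨⟨hC, hA⟩, hAm, -⟩
      exact ⟨hC, (mem_monicDivisors hC.1).2 ⟨hAm, hA⟩⟩
  rw [h1, sum_monicsLE, Finset.sum_congr rfl (g := fun _ => Fintype.card Fq ^ c),
    Finset.sum_const, Finset.card_range, smul_eq_mul]
  intro i hi
  rw [Finset.mem_range] at hi
  rw [Finset.sum_congr rfl (g := fun _ => Fintype.card Fq ^ (c - i)), Finset.sum_const, card_monics,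
    smul_eq_mul, ← pow_add, (by omega : i + (c - i) = c)]
  intro A hA
  rw [mem_monics] at hA
  rw [Finset.card_eq_sum_ones, sum_monics_filter_dvd hA.1 (by omega), ← Finset.card_eq_sum_ones,
    card_monics, hA.2]

lemma card_monicsLE_le (m : ℕ) : (monicsLE Fq m).card ≤ 2 * Fintype.card Fq ^ m := by
  rw [Finset.card_eq_sum_ones, sum_monicsLE]
  simp only [← Finset.card_eq_sum_ones, card_monics]
  have hq : 2 ≤ Fintype.card Fq := Fintype.one_lt_card
  induction m with
  | zero => simp
  | succ m ih =>
    rw [Finset.sum_range_succ]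
    have : 2 * Fintype.card Fq ^ m ≤ Fintype.card Fq ^ (m + 1) := by
      rw [pow_succ']
      exact Nat.mul_le_mul_right _ hq
    omega

lemma card_monicDivisors_le {C : Fq[X]} (hC : C.Monic) :
    ((monicDivisors C).card : ℝ) ≤ 4 * sqrtCard Fq ^ C.natDegree := by
  set m := C.natDegree / 2 with hm
  have h1 : (monicDivisors C).card ≤ 2 * (monicsLE Fq m).card := by
    rw [← Finset.card_filter_add_card_filter_not (s := monicDivisors C) (·.natDegree ≤ m), two_mul]
    refine add_le_add (Finset.card_le_card fun d hd => ?_) ?_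
    · rw [Finset.mem_filter, mem_monicDivisors hC] at hd
      exact mem_monicsLE.2 ⟨hd.1.1, hd.2⟩
    · refine Finset.card_le_card_of_injOn (fun d => C / d) ?_ ?_
      · intro d hd
        rw [Finset.mem_coe, Finset.mem_filter, mem_monicDivisors hC] at hd
        obtain ⟨⟨hdm, e, rfl⟩, hdeg⟩ := hd
        have he := hdm.of_mul_monic_left hC
        simp only [Finset.mem_coe]
        rw [mul_div_cancel_left₀ _ hdm.ne_zero, mem_monicsLE]
        rw [hdm.natDegree_mul he] at hm
        exact ⟨he, by omega⟩
      · intro d hd d' hd' heq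
        simp only [Finset.mem_coe, Finset.mem_filter, mem_monicDivisors hC] at hd hd' heq
        have e1 := EuclideanDomain.mul_div_cancel' hd.1.1.ne_zero hd.1.2
        have e2 := EuclideanDomain.mul_div_cancel' hd'.1.1.ne_zero hd'.1.2
        rw [← heq] at e2
        have hne : C / d ≠ 0 := by
          intro h0
          rw [h0, mul_zero] at e1
          exact hC.ne_zero e1.symm
        exact mul_right_cancel₀ hne (e1.trans e2.symm)
  have h2 := h1.trans (Nat.mul_le_mul_left 2 (card_monicsLE_le m))
  have h3 : ((monicDivisors C).card : ℝ) ≤ 2 * (2 * (Fintype.card Fq : ℝ) ^ m) := by exact_mod_cast h2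
  refine h3.trans ?_
  rw [card_pow_eq]
  have := pow_le_pow_right₀ (one_lt_sqrtCard (Fq := Fq)).le (by omega : 2 * m ≤ C.natDegree)
  linarith

lemma exists_monic_mul_self {f : Fq[X]} (hf : f.Monic) (h : IsSquare f) :
    ∃ r : Fq[X], r.Monic ∧ f = r * r := by
  obtain ⟨r, rfl⟩ := h
  have hr : r ≠ 0 := left_ne_zero_of_mul hf.ne_zero
  have hlc : r.leadingCoeff * r.leadingCoeff = 1 := by
    rw [← leadingCoeff_mul]
    exact hf
  have hlc0 := leadingCoeff_ne_zero.2 hr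
  refine ⟨C r.leadingCoeff * r, ?_, ?_⟩
  · rw [Monic, leadingCoeff_mul, leadingCoeff_C, hlc]
  · rw [mul_mul_mul_comm, ← C_mul, hlc, C_1, one_mul]

lemma card_filter_isSquare_mul_le {m : Fq[X]} (hm : m.Monic) (n : ℕ) :
    (((monics Fq n).filter fun f => IsSquare (f * m)).card : ℝ) ≤
      sqrtCard Fq ^ (n + m.natDegree) := by
  have h1 : ((monics Fq n).filter fun f => IsSquare (f * m)).card ≤
      (monics Fq ((n + m.natDegree) / 2)).card := by
    have hex : ∀ f ∈ (monics Fq n).filter fun f => IsSquare (f * m),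
        ∃ r : Fq[X], r.Monic ∧ f * m = r * r := by
      intro f hf
      rw [Finset.mem_filter, mem_monics] at hf
      exact exists_monic_mul_self (hf.1.1.mul hm) hf.2
    choose! r hr using hex
    refine Finset.card_le_card_of_injOn r ?_ ?_
    · intro f hf
      have hf' := Finset.mem_filter.1 hf
      rw [mem_monics] at hf'
      obtain ⟨h2, h3⟩ := hr f hf
      rw [Finset.mem_coe, mem_monics]
      refine ⟨h2, ?_⟩
      have := congrArg natDegree h3
      rw [hf'.1.1.natDegree_mul hm, h2.natDegree_mul h2, hf'.1.2] at this
      omega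
    · intro f hf f' hf' heq
      have h2 := (hr f hf).2
      rw [heq, ← (hr f' hf').2] at h2
      exact mul_right_cancel₀ hm.ne_zero h2
  rw [card_monics] at h1
  have h2 : (((monics Fq n).filter fun f => IsSquare (f * m)).card : ℝ) ≤
      (Fintype.card Fq : ℝ) ^ ((n + m.natDegree) / 2) := by exact_mod_cast h1
  refine h2.trans ?_
  rw [card_pow_eq]
  exact pow_le_pow_right₀ one_lt_sqrtCard.le (by omega)

lemma card_sqfrees_le (n : ℕ) : (sqfrees Fq n).card ≤ Fintype.card Fq ^ n := by
  rw [← card_monics]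
  exact Finset.card_le_card fun D hD => mem_monics.2 (mem_sqfrees.1 hD).1

lemma sum_sqfrees_jacobi_left (hq : ringChar Fq ≠ 2) {l : Fq[X]} (hl : l.Monic)
    (hsq : ¬IsSquare l) {N a : ℕ} (h : l.natDegree + 2 * a ≤ N) :
    ∑ D ∈ sqfrees Fq N, jacobi D l = ∑ c ∈ Finset.range (N / 2 + 1), ∑ C ∈ monics Fq c,
      moebiusTail a C * ∑ E ∈ sqfrees Fq (N - 2 * c), jacobi (C ^ 2 * E) l := by
  rw [sum_sqfrees_eq (by omega : 2 * a ≤ N), Finset.sum_eq_zero, zero_add]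
  intro A hA
  rw [mem_monicsLE] at hA
  simp only [jacobi_mul_left _ _ hl]
  rw [← Finset.mul_sum, sum_monics_jacobi_left_eq_zero hq hl hsq (by omega), mul_zero, mul_zero]

lemma abs_sum_not_isSquare_jacobi_le (hq : ringChar Fq ≠ 2) {E C m : Fq[X]} (hE : E.Monic)
    (hsq : Squarefree E) {g : ℕ} (hg : E.natDegree = 2 * g + 1) (hC : C.Monic) (hm : m.Monic)
    (n : ℕ) :
    |((∑ f ∈ (monics Fq n).filter (fun f => ¬IsSquare (f * m)), jacobi (C ^ 2 * E) (f * m) : ℤ)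
      : ℝ)| ≤
      (monicDivisors C).card * sqrtCard Fq ^ (2 * g) + sqrtCard Fq ^ (n + m.natDegree) := by
  have h1 := Finset.sum_filter_add_sum_filter_not (monics Fq n) (fun f => IsSquare (f * m))
    fun f => jacobi (C ^ 2 * E) (f * m)
  rw [eq_sub_iff_add_eq'.2 h1, Int.cast_sub]
  refine (abs_sub _ _).trans (add_le_add ?_ ?_)
  · have h2 : ∑ f ∈ monics Fq n, jacobi (C ^ 2 * E) (f * m) =
        jacobi (C ^ 2 * E) m * ∑ f ∈ (monics Fq n).filter (IsCoprime · C), jacobi E f := by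
      rw [Finset.sum_filter, Finset.mul_sum]
      refine Finset.sum_congr rfl fun f hf => ?_
      have hf' := (mem_monics.1 hf).1
      rw [jacobi_mul_right _ hf'.ne_zero hm.ne_zero, jacobi_mul_left _ _ hf', jacobi_sq_left _ hf',
        isCoprime_comm, ite_mul, one_mul, zero_mul, mul_comm]
    have h3 : |∑ f ∈ monics Fq n, jacobi (C ^ 2 * E) (f * m)| ≤
        (monicDivisors C).card * (Fintype.card Fq : ℤ) ^ g := by
      rw [h2, abs_mul]
      exact (mul_le_of_le_one_left (abs_nonneg _) (abs_jacobi_le_one _ hm)).trans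
        (abs_sum_coprime_jacobi_le hq hE hsq hg hC n)
    rw [← card_pow_eq]
    exact_mod_cast h3
  · refine le_trans ?_ (card_filter_isSquare_mul_le hm n)
    have h4 : |∑ f ∈ (monics Fq n).filter (fun f => IsSquare (f * m)), jacobi (C ^ 2 * E) (f * m)|
        ≤ (((monics Fq n).filter fun f => IsSquare (f * m)).card : ℤ) := by
      refine (Finset.abs_sum_le_sum_abs _ _).trans ?_
      rw [Finset.card_eq_sum_ones, Nat.cast_sum]
      refine Finset.sum_le_sum fun f hf => ?_
      have hf' := mem_monics.1 (Finset.mem_filter.1 hf).1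
      exact_mod_cast abs_jacobi_le_one _ (hf'.1.mul hm)
    exact_mod_cast h4

lemma abs_sum_not_isSquare_sqfrees_le (hq : ringChar Fq ≠ 2) {m : Fq[X]} (hm : m.Monic)
    {g n a B : ℕ} (h : n + m.natDegree + 2 * a ≤ 2 * g + 1)
    (h1 : 2 * (2 * g + 1) + 2 * g ≤ B + 3 * (a + 1))
    (h2 : 2 * (2 * g + 1) + n + m.natDegree ≤ B + 2 * (a + 1)) :
    |((∑ f ∈ (monics Fq n).filter (fun f => ¬IsSquare (f * m)),
      ∑ D ∈ sqfrees Fq (2 * g + 1), jacobi D (f * m) : ℤ) : ℝ)| ≤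
      5 * ((g : ℝ) + 1) ^ 2 * sqrtCard Fq ^ B := by
  set T : Finset Fq[X] := (monics Fq n).filter (fun f => ¬IsSquare (f * m)) with hT
  set Q := sqrtCard Fq with hQ
  have hQ0 : 0 < Q := sqrtCard_pos
  have hQ1 : 1 ≤ Q := one_lt_sqrtCard.le
  have e1 : ∑ f ∈ T, ∑ D ∈ sqfrees Fq (2 * g + 1), jacobi D (f * m) =
      ∑ c ∈ Finset.range (g + 1), ∑ C ∈ monics Fq c, moebiusTail a C *
        ∑ E ∈ sqfrees Fq (2 * g + 1 - 2 * c), ∑ f ∈ T, jacobi (C ^ 2 * E) (f * m) := by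
    have : ∀ f ∈ T, ∑ D ∈ sqfrees Fq (2 * g + 1), jacobi D (f * m) =
        ∑ c ∈ Finset.range (g + 1), ∑ C ∈ monics Fq c,
      moebiusTail a C * ∑ E ∈ sqfrees Fq (2 * g + 1 - 2 * c), jacobi (C ^ 2 * E) (f * m) := by
      intro f hf
      rw [hT, Finset.mem_filter, mem_monics] at hf
      rw [sum_sqfrees_jacobi_left hq (hf.1.1.mul hm) hf.2 (a := a)
        (by rw [hf.1.1.natDegree_mul hm]; omega), (by omega : (2 * g + 1) / 2 = g)]
    rw [Finset.sum_congr rfl this, Finset.sum_comm]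
    refine Finset.sum_congr rfl fun c _ => ?_
    rw [Finset.sum_comm]
    refine Finset.sum_congr rfl fun C _ => ?_
    rw [← Finset.mul_sum, Finset.sum_comm]
  have key : ∀ c ∈ Finset.range (g + 1), ∀ C ∈ monics Fq c,
      |((moebiusTail a C *
        ∑ E ∈ sqfrees Fq (2 * g + 1 - 2 * c), ∑ f ∈ T, jacobi (C ^ 2 * E) (f * m) : ℤ) : ℝ)| *
        Q ^ (2 * c) ≤ (monicDivisors C).card * (5 * Q ^ B) := by
    intro c hc C hC
    rw [Finset.mem_range] at hc
    rw [mem_monics] at hC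
    rcases le_or_gt c a with hca | hca
    · rw [moebiusTail_eq_zero hC.1 (by omega), zero_mul, Int.cast_zero, abs_zero, zero_mul]
      positivity
    rw [Int.cast_mul, abs_mul, mul_assoc]
    refine mul_le_mul ?_ ?_ (by positivity) (by positivity)
    · exact_mod_cast abs_moebiusTail_le a C
    rw [Int.cast_sum]
    have b1 : |∑ E ∈ sqfrees Fq (2 * g + 1 - 2 * c),
        ((∑ f ∈ T, jacobi (C ^ 2 * E) (f * m) : ℤ) : ℝ)| ≤
        Q ^ (2 * (2 * g + 1 - 2 * c)) * (4 * Q ^ c * Q ^ (2 * (g - c)) + Q ^ (n + m.natDegree)) := by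
      refine (Finset.abs_sum_le_sum_abs _ _).trans ?_
      refine (Finset.sum_le_card_nsmul _ _
        (4 * Q ^ c * Q ^ (2 * (g - c)) + Q ^ (n + m.natDegree)) fun E hE => ?_).trans ?_
      · rw [mem_sqfrees] at hE
        refine (abs_sum_not_isSquare_jacobi_le hq (g := g - c) hE.1.1 hE.2 (by omega) hC.1 hm
          n).trans ?_
        gcongr
        rw [← hC.2]
        exact card_monicDivisors_le hC.1
      · rw [nsmul_eq_mul, ← card_pow_eq (2 * g + 1 - 2 * c)]
        gcongr
        exact_mod_cast card_sqfrees_le _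
    refine (mul_le_mul_of_nonneg_right b1 (by positivity)).trans ?_
    have b2 : Q ^ (2 * (2 * g + 1 - 2 * c)) *
        (4 * Q ^ c * Q ^ (2 * (g - c)) + Q ^ (n + m.natDegree)) * Q ^ (2 * c) =
        4 * Q ^ (2 * (2 * g + 1 - 2 * c) + c + 2 * (g - c) + 2 * c) +
        Q ^ (2 * (2 * g + 1 - 2 * c) + (n + m.natDegree) + 2 * c) := by
      simp only [pow_add]
      ring
    rw [b2]
    have b3 := pow_le_pow_right₀ hQ1
      (by omega : 2 * (2 * g + 1 - 2 * c) + c + 2 * (g - c) + 2 * c ≤ B)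
    have b4 := pow_le_pow_right₀ hQ1
      (by omega : 2 * (2 * g + 1 - 2 * c) + (n + m.natDegree) + 2 * c ≤ B)
    linarith
  have key2 : ∀ c ∈ Finset.range (g + 1),
      |((∑ C ∈ monics Fq c, moebiusTail a C *
        ∑ E ∈ sqfrees Fq (2 * g + 1 - 2 * c), ∑ f ∈ T, jacobi (C ^ 2 * E) (f * m) : ℤ) : ℝ)| ≤
      (g + 1) * (5 * Q ^ B) := by
    intro c hc
    have hQc : 0 < Q ^ (2 * c) := by positivity
    refine le_of_mul_le_mul_right ?_ hQc
    rw [Int.cast_sum]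
    refine (mul_le_mul_of_nonneg_right (Finset.abs_sum_le_sum_abs _ _) hQc.le).trans ?_
    rw [Finset.sum_mul]
    refine (Finset.sum_le_sum (key c hc)).trans ?_
    rw [← Finset.sum_mul]
    have : ∑ C ∈ monics Fq c, ((monicDivisors C).card : ℝ) = (c + 1) * Q ^ (2 * c) := by
      rw [← card_pow_eq]
      exact_mod_cast sum_card_monicDivisors (Fq := Fq) c
    rw [this]
    have hcg : (c : ℝ) ≤ g := by exact_mod_cast Nat.lt_succ_iff.1 (Finset.mem_range.1 hc)
    have : ((c : ℝ) + 1) * (Q ^ (2 * c) * (5 * Q ^ B)) ≤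
        ((g : ℝ) + 1) * (Q ^ (2 * c) * (5 * Q ^ B)) := by gcongr
    linarith
  rw [e1, Int.cast_sum]
  refine (Finset.abs_sum_le_sum_abs _ _).trans ((Finset.sum_le_card_nsmul _ _ _ key2).trans ?_)
  rw [Finset.card_range, nsmul_eq_mul]
  push_cast
  apply le_of_eq
  ring

/-- The weight `|f|^{-1/2}` of a nonzero polynomial. -/
noncomputable def wt (f : Fq[X]) : ℝ := (sqrtCard Fq)⁻¹ ^ f.natDegree

lemma wt_pos (f : Fq[X]) : 0 < wt f := pow_pos (inv_pos.2 sqrtCard_pos) _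

lemma wt_mul {f g : Fq[X]} (hf : f.Monic) (hg : g.Monic) : wt (f * g) = wt f * wt g := by
  rw [wt, hf.natDegree_mul hg, pow_add]
  rfl

lemma wt_prod {ι : Type*} (s : Finset ι) (t : ι → Fq[X]) (ht : ∀ i ∈ s, (t i).Monic) :
    wt (∏ i ∈ s, t i) = ∏ i ∈ s, wt (t i) := by
  simp only [wt]
  rw [natDegree_prod_of_monic _ _ ht, Finset.prod_pow_eq_pow_sum]

lemma jacobi_prod_right (D : Fq[X]) {ι : Type*} (s : Finset ι) (t : ι → Fq[X])
    (ht : ∀ i ∈ s, (t i).Monic) : jacobi D (∏ i ∈ s, t i) = ∏ i ∈ s, jacobi D (t i) := by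
  induction s using Finset.induction_on with
  | empty => simp [jacobi_one_right]
  | insert a s ha ih =>
    rw [Finset.prod_insert ha, Finset.prod_insert ha, jacobi_mul_right _
      (ht a (Finset.mem_insert_self a s)).ne_zero
      (monic_prod_of_monic _ _ fun i hi => ht i (Finset.mem_insert_of_mem hi)).ne_zero,
      ih fun i hi => ht i (Finset.mem_insert_of_mem hi)]

/-- The truncation of the central value to polynomials of degree at most `y`. -/
noncomputable def trunc (D : Fq[X]) (y : ℕ) : ℝ :=
  ∑ f ∈ monicsLE Fq y, wt f * (jacobi D f : ℝ)

lemma trunc_eq (D : Fq[X]) (y : ℕ) :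
    trunc D y = ∑ n ∈ Finset.range (y + 1), (charSum D n : ℝ) * (sqrtCard Fq)⁻¹ ^ n := by
  rw [trunc, sum_monicsLE]
  refine Finset.sum_congr rfl fun n _ => ?_
  rw [charSum, Int.cast_sum, Finset.sum_mul]
  refine Finset.sum_congr rfl fun f hf => ?_
  rw [wt, (mem_monics.1 hf).2, mul_comm]

lemma LhalfR_eq (D : Fq[X]) : LhalfR D =
    ∑ n ∈ Finset.range D.natDegree, (charSum D n : ℝ) * (sqrtCard Fq)⁻¹ ^ n := by
  refine Finset.sum_congr rfl fun n _ => ?_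
  have : monicDeg Fq n = ↑(monics Fq n) := by
    ext f
    rw [Finset.mem_coe, mem_monics]
    rfl
  rw [this, finsum_mem_coe_finset, charSum, Int.cast_sum]
  rfl

/-- The approximate functional equation at the central point, which is exact here. -/
lemma LhalfR_eq_trunc_add_trunc (hq : ringChar Fq ≠ 2) {D : Fq[X]} (hD : D.Monic)
    (hsq : Squarefree D) {g : ℕ} (hg : D.natDegree = 2 * g + 1) (hg0 : 0 < g) :
    LhalfR D = trunc D g + trunc D (g - 1) := by
  rw [LhalfR_eq, trunc_eq, trunc_eq, hg, (by omega : 2 * g + 1 = (g + 1) + g),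
    Finset.sum_range_add, (by omega : g - 1 + 1 = g)]
  congr 1
  rw [← Finset.sum_range_reflect]
  refine Finset.sum_congr rfl fun m hm => ?_
  rw [Finset.mem_range] at hm
  have h1 := charSum_functional_equation hq hD hsq hg (by omega : m ≤ 2 * g)
  have h2 : sqrtCard Fq ^ (2 * g) * (charSum D m : ℝ) =
      sqrtCard Fq ^ (2 * m) * (charSum D (2 * g - m) : ℝ) := by
    rw [← card_pow_eq, ← card_pow_eq]
    exact_mod_cast h1
  rw [(by omega : g + 1 + (g - 1 - m) = 2 * g - m)]
  have hQ : sqrtCard Fq ≠ 0 := sqrtCard_pos.ne'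
  rw [inv_pow, inv_pow, ← div_eq_mul_inv, ← div_eq_mul_inv, div_eq_div_iff (by positivity)
    (by positivity)]
  refine mul_left_cancel₀ (pow_ne_zero m hQ) ?_
  have e : sqrtCard Fq ^ (2 * g) = sqrtCard Fq ^ m * sqrtCard Fq ^ (2 * g - m) := by
    rw [← pow_add, (by omega : m + (2 * g - m) = 2 * g)]
  rw [e, two_mul m, pow_add] at h2
  linear_combination -h2

/-- Tuples of monic polynomials of degree at most `x`. -/
noncomputable def monicTuples (Fq : Type) [Field Fq] [Fintype Fq] (j x : ℕ) :
    Finset (Fin j → Fq[X]) :=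
  Fintype.piFinset fun _ => monicsLE Fq x

lemma mem_monicTuples {j x : ℕ} {t : Fin j → Fq[X]} :
    t ∈ monicTuples Fq j x ↔ ∀ i, (t i).Monic ∧ (t i).natDegree ≤ x := by
  simp [monicTuples, mem_monicsLE]

lemma monic_prod_of_mem_monicTuples {j x : ℕ} {t : Fin j → Fq[X]} (ht : t ∈ monicTuples Fq j x) :
    (∏ i, t i).Monic :=
  monic_prod_of_monic _ _ fun i _ => (mem_monicTuples.1 ht i).1

lemma natDegree_prod_le_of_mem_monicTuples {j x : ℕ} {t : Fin j → Fq[X]}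
    (ht : t ∈ monicTuples Fq j x) : (∏ i, t i).natDegree ≤ j * x := by
  rw [natDegree_prod_of_monic _ _ fun i _ => (mem_monicTuples.1 ht i).1]
  refine (Finset.sum_le_card_nsmul _ _ x fun i _ => (mem_monicTuples.1 ht i).2).trans ?_
  simp

lemma trunc_pow_eq (D : Fq[X]) (j x : ℕ) : trunc D x ^ j =
    ∑ t ∈ monicTuples Fq j x, wt (∏ i, t i) * (jacobi D (∏ i, t i) : ℝ) := by
  have : trunc D x ^ j = ∏ _i : Fin j, trunc D x := by simp
  rw [this, monicTuples]
  simp only [trunc]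
  rw [Finset.prod_univ_sum]
  refine Finset.sum_congr rfl fun t ht => ?_
  have ht' : ∀ i ∈ Finset.univ, (t i).Monic := fun i _ => (mem_monicTuples.1 ht i).1
  rw [Finset.prod_mul_distrib, wt_prod _ _ ht', jacobi_prod_right _ _ _ ht', Int.cast_prod]

lemma sum_wt_monicTuples_le (j x : ℕ) : ∑ t ∈ monicTuples Fq j x, wt (∏ i, t i) ≤
    (((x : ℝ) + 1) * sqrtCard Fq ^ x) ^ j := by
  have h1 : ∑ t ∈ monicTuples Fq j x, wt (∏ i, t i) = (∑ f ∈ monicsLE Fq x, wt f) ^ j := by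
    have : (∑ f ∈ monicsLE Fq x, wt f) ^ j = ∏ _i : Fin j, ∑ f ∈ monicsLE Fq x, wt f := by simp
    rw [this, Finset.prod_univ_sum]
    exact Finset.sum_congr rfl fun t ht => wt_prod _ _ fun i _ => (mem_monicTuples.1 ht i).1
  rw [h1]
  refine pow_le_pow_left₀ (Finset.sum_nonneg fun f _ => (wt_pos f).le) ?_ j
  rw [sum_monicsLE]
  refine (Finset.sum_le_card_nsmul _ _ (sqrtCard Fq ^ x) fun n hn => ?_).trans ?_
  · rw [Finset.sum_congr rfl (g := fun _ => (sqrtCard Fq)⁻¹ ^ n) fun f hf => by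
      rw [wt, (mem_monics.1 hf).2], Finset.sum_const, card_monics, nsmul_eq_mul, Nat.cast_pow,
      card_pow_eq, two_mul, pow_add, mul_assoc, ← mul_pow, mul_inv_cancel₀ sqrtCard_pos.ne',
      one_pow, mul_one]
    exact pow_le_pow_right₀ one_lt_sqrtCard.le (Nat.lt_succ_iff.1 (Finset.mem_range.1 hn))
  · rw [Finset.card_range, nsmul_eq_mul]
    push_cast
    exact le_rfl

/-- The contribution to `trunc D y * trunc D x ^ j` of tuples with a square product. -/
noncomputable def squarePart (D : Fq[X]) (j x y : ℕ) : ℝ :=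
  ∑ t ∈ monicTuples Fq j x, ∑ f ∈ (monicsLE Fq y).filter (fun f => IsSquare (f * ∏ i, t i)),
    wt f * wt (∏ i, t i) * (jacobi D (f * ∏ i, t i) : ℝ)

lemma trunc_mul_trunc_pow_eq (D : Fq[X]) (j x y : ℕ) :
    trunc D y * trunc D x ^ j = squarePart D j x y +
      ∑ t ∈ monicTuples Fq j x, ∑ f ∈ (monicsLE Fq y).filter (fun f => ¬IsSquare (f * ∏ i, t i)),
        wt f * wt (∏ i, t i) * (jacobi D (f * ∏ i, t i) : ℝ) := by
  rw [squarePart, ← Finset.sum_add_distrib, mul_comm, trunc_pow_eq, Finset.sum_mul]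
  refine Finset.sum_congr rfl fun t ht => ?_
  rw [Finset.sum_filter_add_sum_filter_not, trunc, Finset.mul_sum]
  refine Finset.sum_congr rfl fun f hf => ?_
  rw [jacobi_mul_right _ (mem_monicsLE.1 hf).1.ne_zero (monic_prod_of_mem_monicTuples ht).ne_zero]
  push_cast
  ring

lemma jacobi_nonneg_of_isSquare (D : Fq[X]) {f : Fq[X]} (hf : f.Monic) (h : IsSquare f) :
    0 ≤ jacobi D f := by
  obtain ⟨r, hr, rfl⟩ := exists_monic_mul_self hf h
  rw [jacobi_mul_self D hr]
  split_ifs <;> norm_num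

lemma squarePart_mono (D : Fq[X]) (j x : ℕ) {y z : ℕ} (h : y ≤ z) :
    squarePart D j x y ≤ squarePart D j x z := by
  refine Finset.sum_le_sum fun t ht => Finset.sum_le_sum_of_subset_of_nonneg ?_ ?_
  · refine Finset.filter_subset_filter _ fun f hf => ?_
    rw [mem_monicsLE] at hf ⊢
    exact ⟨hf.1, hf.2.trans h⟩
  · intro f hf _
    rw [Finset.mem_filter, mem_monicsLE] at hf
    refine mul_nonneg (mul_nonneg (wt_pos _).le (wt_pos _).le) ?_
    exact_mod_cast jacobi_nonneg_of_isSquare D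
      (hf.1.1.mul (monic_prod_of_mem_monicTuples ht)) hf.2

lemma squarePart_self_eq (D : Fq[X]) (j x : ℕ) : squarePart D j x x =
    ∑ t ∈ (monicTuples Fq (j + 1) x).filter (fun t => IsSquare (∏ i, t i)),
      wt (∏ i, t i) * (jacobi D (∏ i, t i) : ℝ) := by
  rw [squarePart, Finset.sum_sigma']
  refine Finset.sum_bij' (fun p _ => Fin.cons p.2 p.1) (fun t _ => ⟨Fin.tail t, t 0⟩) ?_ ?_ ?_ ?_ ?_
  · rintro ⟨t, f⟩ h
    rw [Finset.mem_sigma, Finset.mem_filter, mem_monicTuples, mem_monicsLE] at h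
    rw [Finset.mem_filter, mem_monicTuples, Fin.forall_fin_succ, Fin.prod_univ_succ]
    simp only [Fin.cons_zero, Fin.cons_succ]
    exact ⟨⟨h.2.1, h.1⟩, h.2.2⟩
  · intro t h
    rw [Finset.mem_filter, mem_monicTuples, Fin.forall_fin_succ, Fin.prod_univ_succ] at h
    rw [Finset.mem_sigma, Finset.mem_filter, mem_monicTuples, mem_monicsLE]
    exact ⟨h.1.2, h.1.1, h.2⟩
  · rintro ⟨t, f⟩ _
    simp
  · intro t _
    simp
  · rintro ⟨t, f⟩ h
    rw [Finset.mem_sigma, Finset.mem_filter, mem_monicsLE] at h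
    rw [Fin.prod_univ_succ]
    simp only [Fin.cons_zero, Fin.cons_succ]
    rw [wt_mul h.2.1.1 (monic_prod_of_mem_monicTuples h.1)]

lemma abs_sum_trunc_sub_squarePart_le (hq : ringChar Fq ≠ 2) {g j x y : ℕ} (hy : y ≤ g)
    (hx : 8 * (j * x) ≤ g) :
    |∑ D ∈ sqfrees Fq (2 * g + 1), trunc D y * trunc D x ^ j -
      ∑ D ∈ sqfrees Fq (2 * g + 1), squarePart D j x y| ≤
      5 * ((g : ℝ) + 1) ^ (j + 3) * sqrtCard Fq ^ (4 * g - g / 8) := by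
  set Q := sqrtCard Fq with hQ
  have hQ0 : 0 < Q := sqrtCard_pos
  have hQ1 : 1 ≤ Q := one_lt_sqrtCard.le
  have e1 : ∑ D ∈ sqfrees Fq (2 * g + 1), trunc D y * trunc D x ^ j -
      ∑ D ∈ sqfrees Fq (2 * g + 1), squarePart D j x y =
      ∑ t ∈ monicTuples Fq j x, wt (∏ i, t i) * ∑ n ∈ Finset.range (y + 1), Q⁻¹ ^ n *
        ((∑ f ∈ (monics Fq n).filter (fun f => ¬IsSquare (f * ∏ i, t i)),
          ∑ D ∈ sqfrees Fq (2 * g + 1), jacobi D (f * ∏ i, t i) : ℤ) : ℝ) := by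
    rw [← Finset.sum_sub_distrib]
    simp only [trunc_mul_trunc_pow_eq, add_sub_cancel_left]
    rw [Finset.sum_comm]
    refine Finset.sum_congr rfl fun t ht => ?_
    rw [Finset.sum_comm, Finset.sum_filter, sum_monicsLE, Finset.mul_sum]
    refine Finset.sum_congr rfl fun n hn => ?_
    rw [← Finset.sum_filter, Int.cast_sum, Finset.mul_sum, Finset.mul_sum]
    refine Finset.sum_congr rfl fun f hf => ?_
    rw [Finset.mem_filter, mem_monics] at hf
    rw [Int.cast_sum, Finset.mul_sum, Finset.mul_sum]
    refine Finset.sum_congr rfl fun D _ => ?_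
    rw [wt, hf.1.2]
    ring
  have key : ∀ t ∈ monicTuples Fq j x, |∑ n ∈ Finset.range (y + 1), Q⁻¹ ^ n *
        ((∑ f ∈ (monics Fq n).filter (fun f => ¬IsSquare (f * ∏ i, t i)),
          ∑ D ∈ sqfrees Fq (2 * g + 1), jacobi D (f * ∏ i, t i) : ℤ) : ℝ)| ≤
        5 * ((g : ℝ) + 1) ^ 3 * Q ^ (4 * g - g / 4) := by
    intro t ht
    have hm := monic_prod_of_mem_monicTuples ht
    have hdeg := natDegree_prod_le_of_mem_monicTuples ht
    refine (Finset.abs_sum_le_sum_abs _ _).trans ((Finset.sum_le_card_nsmul _ _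
      (5 * ((g : ℝ) + 1) ^ 2 * Q ^ (4 * g - g / 4)) fun n hn => ?_).trans ?_)
    · rw [Finset.mem_range] at hn
      rw [abs_mul, abs_of_pos (by positivity : 0 < Q⁻¹ ^ n), inv_pow, inv_mul_le_iff₀ (by positivity)]
      refine (abs_sum_not_isSquare_sqfrees_le hq hm
        (a := (2 * g + 1 - n - (∏ i, t i).natDegree) / 2) (B := 4 * g - g / 4 + n)
        (by omega) (by omega) (by omega)).trans ?_
      rw [pow_add]
      apply le_of_eq
      ring
    · rw [Finset.card_range, nsmul_eq_mul]
      have : ((y + 1 : ℕ) : ℝ) ≤ g + 1 := by exact_mod_cast Nat.succ_le_succ hy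
      calc ((y + 1 : ℕ) : ℝ) * (5 * ((g : ℝ) + 1) ^ 2 * Q ^ (4 * g - g / 4))
          ≤ ((g : ℝ) + 1) * (5 * ((g : ℝ) + 1) ^ 2 * Q ^ (4 * g - g / 4)) := by gcongr
        _ = _ := by ring
  rw [e1]
  refine (Finset.abs_sum_le_sum_abs _ _).trans ?_
  have : ∀ t ∈ monicTuples Fq j x, |wt (∏ i, t i) * ∑ n ∈ Finset.range (y + 1), Q⁻¹ ^ n *
        ((∑ f ∈ (monics Fq n).filter (fun f => ¬IsSquare (f * ∏ i, t i)),
          ∑ D ∈ sqfrees Fq (2 * g + 1), jacobi D (f * ∏ i, t i) : ℤ) : ℝ)| ≤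
        wt (∏ i, t i) * (5 * ((g : ℝ) + 1) ^ 3 * Q ^ (4 * g - g / 4)) := by
    intro t ht
    rw [abs_mul, abs_of_pos (wt_pos _)]
    exact mul_le_mul_of_nonneg_left (key t ht) (wt_pos _).le
  refine (Finset.sum_le_sum this).trans ?_
  rw [← Finset.sum_mul]
  refine (mul_le_mul_of_nonneg_right (sum_wt_monicTuples_le j x) (by positivity)).trans ?_
  rw [mul_pow, ← pow_mul]
  have h1 : ((x : ℝ) + 1) ^ j ≤ ((g : ℝ) + 1) ^ j := by
    rcases Nat.eq_zero_or_pos j with rfl | hj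
    · simp
    · have : x ≤ g := by nlinarith
      gcongr
  have h2 : Q ^ (x * j) * Q ^ (4 * g - g / 4) ≤ Q ^ (4 * g - g / 8) := by
    rw [← pow_add]
    refine pow_le_pow_right₀ hQ1 ?_
    rw [mul_comm x j]
    omega
  calc ((x : ℝ) + 1) ^ j * Q ^ (x * j) * (5 * ((g : ℝ) + 1) ^ 3 * Q ^ (4 * g - g / 4))
      = 5 * ((x : ℝ) + 1) ^ j * ((g : ℝ) + 1) ^ 3 * (Q ^ (x * j) * Q ^ (4 * g - g / 4)) := by ring
    _ ≤ 5 * ((g : ℝ) + 1) ^ j * ((g : ℝ) + 1) ^ 3 * Q ^ (4 * g - g / 8) := by gcongr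
    _ = _ := by ring

/-- Unordered pairs of elements of `Fin k`, repetitions allowed. -/
abbrev PairIndex (k : ℕ) : Type := {p : Fin k × Fin k // p.1 ≤ p.2}

lemma card_pairIndex (k : ℕ) : Fintype.card (PairIndex k) = k * (k + 1) / 2 := by
  rw [← Fintype.card_congr (Sym2.sortEquiv (α := Fin k)), Sym2.card, Fintype.card_fin,
    Nat.choose_two_right, Nat.add_sub_cancel, mul_comm]

/-- The tuple with square product attached to a family indexed by unordered pairs. -/
noncomputable def assemble {k : ℕ} (s : PairIndex k → Fq[X]) (i : Fin k) : Fq[X] :=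
  (∏ p with p.1.1 = i, s p) * ∏ p with p.1.2 = i, s p

lemma prod_assemble {k : ℕ} (s : PairIndex k → Fq[X]) :
    ∏ i, assemble s i = (∏ p, s p) * ∏ p, s p := by
  simp only [assemble]
  rw [Finset.prod_mul_distrib, Finset.prod_fiberwise, Finset.prod_fiberwise]

lemma assemble_mul {k : ℕ} (s s' : PairIndex k → Fq[X]) (i : Fin k) :
    assemble (s * s') i = assemble s i * assemble s' i := by
  simp only [assemble, Pi.mul_apply, Finset.prod_mul_distrib]
  ring

lemma assemble_mulSingle {k : ℕ} (p : PairIndex k) (P : Fq[X]) (i : Fin k) :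
    assemble (Pi.mulSingle p P) i = (if p.1.1 = i then P else 1) * if p.1.2 = i then P else 1 := by
  simp only [assemble, Pi.mulSingle_apply, Finset.prod_ite_eq', Finset.mem_filter,
    Finset.mem_univ, true_and]

lemma monic_assemble {k : ℕ} {s : PairIndex k → Fq[X]} (hs : ∀ p, (s p).Monic) (i : Fin k) :
    (assemble s i).Monic :=
  (monic_prod_of_monic _ _ fun p _ => hs p).mul (monic_prod_of_monic _ _ fun p _ => hs p)

lemma exists_eq_assemble_mulSingle_mul {k : ℕ} {t : Fin k → Fq[X]} (ht : ∀ i, (t i).Monic)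
    {P : Fq[X]} (hPm : P.Monic) (hP : Irreducible P) (h : P * P ∣ ∏ i, t i) :
    ∃ p : PairIndex k, ∃ t' : Fin k → Fq[X], (∀ i, (t' i).Monic) ∧
      ∀ i, t i = assemble (Pi.mulSingle p P) i * t' i := by
  have key : ∀ i j, i < j → P ∣ t i → P ∣ t j → ∃ p : PairIndex k, ∃ t' : Fin k → Fq[X],
      (∀ i, (t' i).Monic) ∧ ∀ i, t i = assemble (Pi.mulSingle p P) i * t' i := by
    rintro i j hij ⟨u, hu⟩ ⟨v, hv⟩
    have hum : u.Monic := hPm.of_mul_monic_left (hu ▸ ht i)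
    have hvm : v.Monic := hPm.of_mul_monic_left (hv ▸ ht j)
    refine ⟨⟨(i, j), hij.le⟩, fun l => if l = i then u else if l = j then v else t l, ?_, ?_⟩
    · intro l
      dsimp only
      split_ifs
      · exact hum
      · exact hvm
      · exact ht l
    · intro l
      rw [assemble_mulSingle]
      by_cases hli : l = i
      · subst hli
        simp [hij.ne', hu]
      · by_cases hlj : l = j
        · subst hlj
          simp [hij.ne', hij.ne, hv]
        · simp [hli, hlj, Ne.symm hli, Ne.symm hlj]
  obtain ⟨i, -, u, hu⟩ := (hP.prime.dvd_finsetProd_iff _).1 ((dvd_mul_right P P).trans h)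
  have hum : u.Monic := hPm.of_mul_monic_left (hu ▸ ht i)
  rw [← Finset.mul_prod_erase _ _ (Finset.mem_univ i), hu, mul_assoc,
    mul_dvd_mul_iff_left hP.ne_zero] at h
  rcases hP.prime.dvd_or_dvd h with ⟨v, hv⟩ | h
  · have hvm : v.Monic := hPm.of_mul_monic_left (hv ▸ hum)
    refine ⟨⟨(i, i), le_rfl⟩, fun l => if l = i then v else t l, ?_, ?_⟩
    · intro l
      dsimp only
      split_ifs
      · exact hvm
      · exact ht l
    · intro l
      rw [assemble_mulSingle]
      by_cases hli : l = i
      · subst hli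
        simp [hu, hv, mul_assoc]
      · simp [hli, Ne.symm hli]
  · obtain ⟨j, hj, hPj⟩ := (hP.prime.dvd_finsetProd_iff _).1 h
    rcases lt_or_gt_of_ne (Finset.ne_of_mem_erase hj) with hlt | hlt
    · exact key j i hlt hPj ⟨u, hu⟩
    · exact key i j hlt ⟨u, hu⟩ hPj

lemma exists_eq_assemble {k : ℕ} {t : Fin k → Fq[X]} (ht : ∀ i, (t i).Monic)
    (hsq : IsSquare (∏ i, t i)) :
    ∃ s : PairIndex k → Fq[X], (∀ p, (s p).Monic) ∧ ∀ i, t i = assemble s i := by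
  obtain ⟨r, hr, hrt⟩ := exists_monic_mul_self (monic_prod_of_monic _ _ fun i _ => ht i) hsq
  refine monic_induction (motive := fun r => ∀ t : Fin k → Fq[X], (∀ i, (t i).Monic) →
    ∏ i, t i = r * r → ∃ s : PairIndex k → Fq[X], (∀ p, (s p).Monic) ∧ ∀ i, t i = assemble s i)
    ?_ ?_ r hr t ht hrt
  · intro t ht h
    refine ⟨fun _ => 1, fun _ => monic_one, fun i => ?_⟩
    have h1 : IsUnit (t i) := isUnit_of_dvd_one <| by
      rw [← one_mul (1 : Fq[X]), ← h]
      exact Finset.dvd_prod_of_mem _ (Finset.mem_univ i)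
    simp [assemble, (ht i).eq_one_of_isUnit h1]
  · intro P r hPm hP _ ih t ht h
    obtain ⟨p, t', ht', htt'⟩ := exists_eq_assemble_mulSingle_mul ht hPm hP
      ⟨r * r, by rw [h]; ring⟩
    have h2 : ∏ i, t' i = r * r := by
      have h3 : ∏ i, t i = P * P * ∏ i, t' i := by
        rw [Finset.prod_congr rfl fun i _ => htt' i, Finset.prod_mul_distrib, prod_assemble,
          Finset.prod_pi_mulSingle']
        simp
      refine mul_left_cancel₀ (mul_ne_zero hP.ne_zero hP.ne_zero) ?_
      rw [← h3, h]
      ring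
    obtain ⟨s, hs, hts⟩ := ih t' ht' h2
    refine ⟨Pi.mulSingle p P * s, fun p' => ?_, fun i => ?_⟩
    · rw [Pi.mul_apply, Pi.mulSingle_apply]
      refine Monic.mul ?_ (hs p')
      split_ifs
      · exact hPm
      · exact monic_one
    · rw [htt' i, hts i, assemble_mul]

lemma sum_wt_sq_monics (n : ℕ) : ∑ f ∈ monics Fq n, wt f ^ 2 = 1 := by
  rw [Finset.sum_congr rfl (g := fun _ => ((sqrtCard Fq)⁻¹ ^ n) ^ 2) fun f hf => by
    rw [wt, (mem_monics.1 hf).2], Finset.sum_const, card_monics, nsmul_eq_mul, Nat.cast_pow,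
    card_pow_eq, ← pow_mul, mul_comm 2 n, ← mul_pow, mul_inv_cancel₀ sqrtCard_pos.ne', one_pow]

lemma sum_wt_sq_monicsLE (m : ℕ) : ∑ f ∈ monicsLE Fq m, wt f ^ 2 = m + 1 := by
  rw [sum_monicsLE, Finset.sum_congr rfl fun n _ => sum_wt_sq_monics n]
  simp

lemma wt_prod_assemble {k : ℕ} {s : PairIndex k → Fq[X]} (hs : ∀ p, (s p).Monic) :
    wt (∏ i, assemble s i) = ∏ p, wt (s p) ^ 2 := by
  have h := monic_prod_of_monic Finset.univ s fun p _ => hs p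
  rw [prod_assemble, wt_mul h h, wt_prod _ _ fun p _ => hs p, ← sq, Finset.prod_pow]

lemma sum_wt_isSquare_le (k x : ℕ) :
    ∑ t ∈ (monicTuples Fq k x).filter (fun t => IsSquare (∏ i, t i)), wt (∏ i, t i) ≤
      ((k : ℝ) * x + 1) ^ (k * (k + 1) / 2) := by
  have hex : ∀ t ∈ (monicTuples Fq k x).filter (fun t => IsSquare (∏ i, t i)),
      ∃ s : PairIndex k → Fq[X], (∀ p, (s p).Monic) ∧ ∀ i, t i = assemble s i := by
    intro t ht
    rw [Finset.mem_filter, mem_monicTuples] at ht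
    exact exists_eq_assemble (fun i => (ht.1 i).1) ht.2
  choose! σ hσ using hex
  have h1 : ∑ t ∈ (monicTuples Fq k x).filter (fun t => IsSquare (∏ i, t i)), wt (∏ i, t i) =
      ∑ s ∈ ((monicTuples Fq k x).filter (fun t => IsSquare (∏ i, t i))).image σ,
        ∏ p, wt (s p) ^ 2 := by
    rw [Finset.sum_image]
    · refine Finset.sum_congr rfl fun t ht => ?_
      rw [← wt_prod_assemble (hσ t ht).1]
      exact congrArg wt (Finset.prod_congr rfl fun i _ => (hσ t ht).2 i)
    · intro t ht t' ht' heq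
      funext i
      rw [(hσ t ht).2 i, (hσ t' ht').2 i, heq]
  rw [h1]
  refine (Finset.sum_le_sum_of_subset_of_nonneg (t := Fintype.piFinset fun _ => monicsLE Fq (k * x))
    ?_ fun s _ _ => by positivity).trans ?_
  · intro s hs
    obtain ⟨t, ht, rfl⟩ := Finset.mem_image.1 hs
    rw [Fintype.mem_piFinset]
    intro p
    rw [mem_monicsLE]
    obtain ⟨h2, h3⟩ := hσ t ht
    refine ⟨h2 p, ?_⟩
    have h4 := natDegree_prod_le_of_mem_monicTuples (Finset.mem_filter.1 ht).1
    rw [Finset.prod_congr rfl fun i _ => h3 i, prod_assemble] at h4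
    refine le_trans (natDegree_le_of_dvd ?_ ?_) h4
    · exact (Finset.dvd_prod_of_mem _ (Finset.mem_univ p)).mul_right _
    · have h := monic_prod_of_monic Finset.univ (σ t) fun p _ => h2 p
      exact (h.mul h).ne_zero
  · rw [← Finset.prod_univ_sum (fun _ : PairIndex k => monicsLE Fq (k * x)) fun _ f => wt f ^ 2,
      Finset.prod_const, sum_wt_sq_monicsLE, Finset.card_univ,
      card_pairIndex]
    push_cast
    exact le_rfl

lemma squarePart_self_le (D : Fq[X]) (j x : ℕ) :
    squarePart D j x x ≤ (((j + 1 : ℕ) : ℝ) * x + 1) ^ ((j + 1) * (j + 1 + 1) / 2) := by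
  rw [squarePart_self_eq]
  refine le_trans (Finset.sum_le_sum fun t ht => ?_) (sum_wt_isSquare_le (Fq := Fq) (j + 1) x)
  refine mul_le_of_le_one_right (wt_pos _).le ?_
  have := abs_jacobi_le_one D (monic_prod_of_mem_monicTuples (Finset.mem_filter.1 ht).1)
  exact_mod_cast (le_abs_self _).trans this

lemma dvd_of_dvd_mul_of_dvd_mul {R : Type*} [CommRing R] {d a x y : R} (hxy : IsCoprime x y)
    (hx : d ∣ a * x) (hy : d ∣ a * y) : d ∣ a := by
  obtain ⟨u, v, huv⟩ := hxy
  have : a = u * (a * x) + v * (a * y) := by linear_combination -a * huv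
  rw [this]
  exact dvd_add (hx.mul_left u) (hy.mul_left v)

lemma mul_prod_filter_ne {k : ℕ} (s : PairIndex k → Fq[X]) (p : PairIndex k)
    (c : PairIndex k → Prop) [DecidablePred c] (hp : c p) :
    s p * ∏ q with c q ∧ q ≠ p, s q = ∏ q with c q, s q := by
  rw [← Finset.mul_prod_erase _ _ (Finset.mem_filter.2 ⟨Finset.mem_univ p, hp⟩)]
  congr 1
  refine Finset.prod_congr ?_ fun _ _ => rfl
  ext q
  simp [and_comm]

lemma dvd_of_assemble_eq_of_lt {k : ℕ} {s s' : PairIndex k → Fq[X]}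
    (hc : Pairwise fun p q => IsCoprime (s' p) (s' q)) (h : assemble s = assemble s')
    {p : PairIndex k} (hp : p.1.1 < p.1.2) : s p ∣ s' p := by
  have h1 := congrFun h p.1.1
  have h2 := congrFun h p.1.2
  have d1 : s p ∣ assemble s p.1.1 :=
    dvd_mul_of_dvd_left (Finset.dvd_prod_of_mem s (by simp)) _
  have d2 : s p ∣ assemble s p.1.2 :=
    dvd_mul_of_dvd_right (Finset.dvd_prod_of_mem s (by simp)) _
  rw [h1, assemble, ← mul_prod_filter_ne s' p (fun q => q.1.1 = p.1.1) rfl, mul_assoc] at d1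
  rw [h2, assemble, ← mul_prod_filter_ne s' p (fun q => q.1.2 = p.1.2) rfl, mul_left_comm] at d2
  refine dvd_of_dvd_mul_of_dvd_mul ?_ d1 d2
  have hc' : ∀ A B : Finset (PairIndex k), (∀ q ∈ A, q ∉ B) →
      IsCoprime (∏ q ∈ A, s' q) (∏ q ∈ B, s' q) := fun A B hAB =>
    IsCoprime.prod_left fun q hq => IsCoprime.prod_right fun q' hq' =>
      hc fun hqq => hAB q hq (hqq ▸ hq')
  refine IsCoprime.mul_left (IsCoprime.mul_right ?_ ?_) (IsCoprime.mul_right ?_ ?_) <;>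
    refine hc' _ _ fun q hq hq' => ?_ <;>
    simp only [Finset.mem_filter, Finset.mem_univ, true_and] at hq hq'
  · exact absurd (hq.1.symm.trans hq') hp.ne
  · exact hq.2 (Subtype.ext (Prod.ext hq.1 hq'.1))
  · have hle := q.2
    rw [hq, hq'] at hle
    exact absurd hle (not_le.2 hp)
  · exact absurd (hq.symm.trans hq'.1) hp.ne

lemma assemble_injOn {k : ℕ} {s s' : PairIndex k → Fq[X]} (hs : ∀ p, (s p).Monic)
    (hs' : ∀ p, (s' p).Monic) (hc : Pairwise fun p q => IsCoprime (s p) (s q))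
    (hc' : Pairwise fun p q => IsCoprime (s' p) (s' q)) (h : assemble s = assemble s') :
    s = s' := by
  have hlt : ∀ p : PairIndex k, p.1.1 < p.1.2 → s p = s' p := fun p hp =>
    eq_of_monic_of_dvd_dvd (hs p) (hs' p) (dvd_of_assemble_eq_of_lt hc' h hp)
      (dvd_of_assemble_eq_of_lt hc h.symm hp)
  funext p
  rcases p.2.lt_or_eq with hp | hp
  · exact hlt p hp
  have h1 := congrFun h p.1.1
  rw [assemble, assemble, ← mul_prod_filter_ne s p (fun q => q.1.1 = p.1.1) rfl,
    ← mul_prod_filter_ne s p (fun q => q.1.2 = p.1.1) hp.symm,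
    ← mul_prod_filter_ne s' p (fun q => q.1.1 = p.1.1) rfl,
    ← mul_prod_filter_ne s' p (fun q => q.1.2 = p.1.1) hp.symm] at h1
  have e1 : ∏ q with q.1.1 = p.1.1 ∧ q ≠ p, s q = ∏ q with q.1.1 = p.1.1 ∧ q ≠ p, s' q := by
    refine Finset.prod_congr rfl fun q hq => hlt q ?_
    simp only [Finset.mem_filter, Finset.mem_univ, true_and] at hq
    refine q.2.lt_of_ne fun h2 => hq.2 (Subtype.ext (Prod.ext hq.1 ?_))
    rw [← h2, hq.1, hp]
  have e2 : ∏ q with q.1.2 = p.1.1 ∧ q ≠ p, s q = ∏ q with q.1.2 = p.1.1 ∧ q ≠ p, s' q := by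
    refine Finset.prod_congr rfl fun q hq => hlt q ?_
    simp only [Finset.mem_filter, Finset.mem_univ, true_and] at hq
    refine q.2.lt_of_ne fun h2 => hq.2 (Subtype.ext (Prod.ext ?_ ?_))
    · rw [h2, hq.1]
    · rw [hq.1, hp]
  rw [e1, e2] at h1
  have hne : (∏ q with q.1.1 = p.1.1 ∧ q ≠ p, s' q) * ∏ q with q.1.2 = p.1.1 ∧ q ≠ p, s' q ≠ 0 :=
    mul_ne_zero (monic_prod_of_monic _ _ fun q _ => hs' q).ne_zero
      (monic_prod_of_monic _ _ fun q _ => hs' q).ne_zero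
  have h2 : s p ^ 2 = s' p ^ 2 := mul_right_cancel₀ hne (by linear_combination h1)
  exact eq_of_monic_of_dvd_dvd (hs p) (hs' p)
    ((UniqueFactorizationMonoid.pow_dvd_pow_iff_dvd two_ne_zero).1 h2.dvd) ((UniqueFactorizationMonoid.pow_dvd_pow_iff_dvd two_ne_zero).1 h2.symm.dvd)

lemma sum_biUnion_le {ι β : Type*} [DecidableEq β] (A : Finset ι) (t : ι → Finset β) {f : β → ℝ}
    (hf : ∀ x, 0 ≤ f x) : ∑ x ∈ A.biUnion t, f x ≤ ∑ i ∈ A, ∑ x ∈ t i, f x := by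
  induction A using Finset.induction_on with
  | empty => simp
  | insert a A ha ih =>
    rw [Finset.biUnion_insert, Finset.sum_insert ha]
    have h1 := Finset.sum_union_inter (s₁ := t a) (s₂ := A.biUnion t) (f := f)
    have h2 : 0 ≤ ∑ x ∈ t a ∩ A.biUnion t, f x := Finset.sum_nonneg fun x _ => hf x
    linarith

/-- A union bound for the weight of tuples having two entries with a common divisor in `E`. -/
lemma sum_piFinset_exists_common_dvd_le {α : Type*} [Fintype α] (S : α → Finset Fq[X])
    (w : α → Fq[X] → ℝ) (hw : ∀ a f, 0 ≤ w a f) (E : Finset Fq[X])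
    (hE : ∀ a, ∀ e ∈ E, ∑ f ∈ (S a).filter (e ∣ ·), w a f ≤ (∑ f ∈ S a, w a f) * (2 * wt e ^ 2)) :
    ∑ s ∈ (Fintype.piFinset S).filter
      (fun s => ∃ a b, a ≠ b ∧ ∃ e ∈ E, e ∣ s a ∧ e ∣ s b), ∏ a, w a (s a) ≤
      (Fintype.card α : ℝ) ^ 2 * (4 * ∑ e ∈ E, wt e ^ 4) * ∏ a, ∑ f ∈ S a, w a f := by
  have hpos : ∀ s : α → Fq[X], 0 ≤ ∏ a, w a (s a) := fun s =>
    Finset.prod_nonneg fun a _ => hw a _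
  have hpair : ∀ a b, a ≠ b → ∀ e ∈ E,
      ∑ s ∈ (Fintype.piFinset S).filter (fun s => e ∣ s a ∧ e ∣ s b), ∏ c, w c (s c) ≤
        (4 * wt e ^ 4) * ∏ a, ∑ f ∈ S a, w a f := by
    intro a b hab e he
    have h1 : (Fintype.piFinset S).filter (fun s => e ∣ s a ∧ e ∣ s b) =
        Fintype.piFinset fun c => if c = a ∨ c = b then (S c).filter (e ∣ ·) else S c := by
      ext s
      rw [Finset.mem_filter, Fintype.mem_piFinset, Fintype.mem_piFinset]
      constructor
      · rintro ⟨hs, ha, hb⟩ c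
        split_ifs with hc
        · rcases hc with rfl | rfl
          · exact Finset.mem_filter.2 ⟨hs c, ha⟩
          · exact Finset.mem_filter.2 ⟨hs c, hb⟩
        · exact hs c
      · intro hs
        refine ⟨fun c => ?_, ?_, ?_⟩
        · have := hs c
          split_ifs at this
          · exact (Finset.mem_filter.1 this).1
          · exact this
        · have := hs a
          rw [if_pos (Or.inl rfl)] at this
          exact (Finset.mem_filter.1 this).2
        · have := hs b
          rw [if_pos (Or.inr rfl)] at this
          exact (Finset.mem_filter.1 this).2
    rw [h1, ← Finset.prod_univ_sum
      (fun c => if c = a ∨ c = b then (S c).filter (e ∣ ·) else S c) w]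
    have h2 : ∏ c, (if c = a ∨ c = b then 2 * wt e ^ 2 else 1) = 4 * wt e ^ 4 := by
      rw [Finset.prod_ite, Finset.prod_const_one, mul_one, Finset.prod_const]
      have : (Finset.univ.filter fun c => c = a ∨ c = b) = {a, b} := by
        ext c
        simp
      rw [this, Finset.card_pair hab]
      ring
    rw [← h2, ← Finset.prod_mul_distrib]
    refine Finset.prod_le_prod (fun c _ => Finset.sum_nonneg fun f _ => hw c f) fun c _ => ?_
    split_ifs
    · rw [mul_comm]
      exact hE c e he
    · rw [one_mul]
  have hcover : (Fintype.piFinset S).filter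
      (fun s => ∃ a b, a ≠ b ∧ ∃ e ∈ E, e ∣ s a ∧ e ∣ s b) ⊆
      ((Finset.univ ×ˢ Finset.univ).filter fun p : α × α => p.1 ≠ p.2).biUnion fun p =>
        E.biUnion fun e => (Fintype.piFinset S).filter (fun s => e ∣ s p.1 ∧ e ∣ s p.2) := by
    intro s hs
    obtain ⟨hs, a, b, hab, e, he, hea, heb⟩ := Finset.mem_filter.1 hs
    refine Finset.mem_biUnion.2 ⟨(a, b), by simpa using hab, Finset.mem_biUnion.2 ⟨e, he, ?_⟩⟩
    exact Finset.mem_filter.2 ⟨hs, hea, heb⟩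
  refine (Finset.sum_le_sum_of_subset_of_nonneg hcover fun s _ _ => hpos s).trans ?_
  refine (sum_biUnion_le _ _ hpos).trans ?_
  refine (Finset.sum_le_card_nsmul _ _ ((4 * ∑ e ∈ E, wt e ^ 4) * ∏ a, ∑ f ∈ S a, w a f)
    fun p hp => ?_).trans ?_
  · refine (sum_biUnion_le _ _ hpos).trans ?_
    rw [Finset.mul_sum, Finset.sum_mul]
    exact Finset.sum_le_sum fun e he => hpair p.1 p.2 (Finset.mem_filter.1 hp).2 e he
  · have hcard : ((Finset.univ ×ˢ Finset.univ).filter fun p : α × α => p.1 ≠ p.2).card ≤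
        Fintype.card α ^ 2 := by
      refine (Finset.card_filter_le _ _).trans ?_
      rw [Finset.card_product, Finset.card_univ, sq]
    have h1 : 0 ≤ ∏ a, ∑ f ∈ S a, w a f :=
      Finset.prod_nonneg fun a _ => Finset.sum_nonneg fun f _ => hw a f
    have h2 : 0 ≤ ∑ e ∈ E, wt e ^ 4 := Finset.sum_nonneg fun e _ => (pow_pos (wt_pos e) 4).le
    rw [nsmul_eq_mul, mul_assoc (_ ^ 2)]
    refine mul_le_mul_of_nonneg_right ?_ (by positivity)
    exact_mod_cast hcard

/-- The product of all monic polynomials of positive degree at most `y`. -/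
noncomputable def smallProd (Fq : Type) [Field Fq] [Fintype Fq] (y : ℕ) : Fq[X] :=
  ∏ f ∈ (monicsLE Fq y).filter (fun f => 0 < f.natDegree), f

lemma monic_smallProd (y : ℕ) : (smallProd Fq y).Monic :=
  monic_prod_of_monic _ _ fun _ hf => (mem_monicsLE.1 (Finset.mem_filter.1 hf).1).1

lemma dvd_smallProd {f : Fq[X]} (hf : f.Monic) (h0 : 0 < f.natDegree) {y : ℕ}
    (hy : f.natDegree ≤ y) : f ∣ smallProd Fq y :=
  Finset.dvd_prod_of_mem _ (Finset.mem_filter.2 ⟨mem_monicsLE.2 ⟨hf, hy⟩, h0⟩)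

lemma natDegree_smallProd_pos {y : ℕ} (hy : 0 < y) : 0 < (smallProd Fq y).natDegree := by
  have h : (X : Fq[X]) ∣ smallProd Fq y :=
    dvd_smallProd monic_X (by simp) (by rw [natDegree_X]; exact hy)
  have := natDegree_le_of_dvd h (monic_smallProd y).ne_zero
  rw [natDegree_X] at this
  omega

lemma monic_one_add_mul {M u : Fq[X]} (hM : M.Monic) (hM0 : 0 < M.natDegree) (hu : u.Monic) :
    (1 + M * u).Monic ∧ (1 + M * u).natDegree = M.natDegree + u.natDegree := by
  have hMu := hM.mul hu
  have hdeg := hM.natDegree_mul hu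
  constructor
  · refine hMu.add_of_right ?_
    rw [degree_one, degree_eq_natDegree hMu.ne_zero, hdeg]
    exact_mod_cast (by omega : 0 < M.natDegree + u.natDegree)
  · rw [natDegree_add_eq_right_of_natDegree_lt, hdeg]
    rw [natDegree_one, hdeg]
    omega

/-- Monic polynomials congruent to `1` modulo `M`. -/
noncomputable def oneMod (M : Fq[X]) (Y : ℕ) : Finset Fq[X] :=
  (monicsLE Fq Y).image fun u => 1 + M * u

lemma sum_oneMod {M : Fq[X]} (hM : M.Monic) (Y : ℕ) (h : Fq[X] → ℝ) :
    ∑ f ∈ oneMod M Y, h f = ∑ u ∈ monicsLE Fq Y, h (1 + M * u) :=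
  Finset.sum_image fun _ _ _ _ h => mul_left_cancel₀ hM.ne_zero (add_left_cancel h)

lemma wt_one_add_mul {M u : Fq[X]} (hM : M.Monic) (hM0 : 0 < M.natDegree) (hu : u.Monic) :
    wt (1 + M * u) = wt M * wt u := by
  rw [← wt_mul hM hu, wt, wt, (monic_one_add_mul hM hM0 hu).2, hM.natDegree_mul hu]

lemma sum_wt_sq_oneMod {M : Fq[X]} (hM : M.Monic) (hM0 : 0 < M.natDegree) (Y : ℕ) :
    ∑ f ∈ oneMod M Y, wt f ^ 2 = wt M ^ 2 * (Y + 1) := by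
  rw [sum_oneMod hM, ← sum_wt_sq_monicsLE (Fq := Fq), Finset.mul_sum]
  refine Finset.sum_congr rfl fun u hu => ?_
  rw [wt_one_add_mul hM hM0 (mem_monicsLE.1 hu).1, mul_pow]

lemma wt_le_wt {f g : Fq[X]} (h : f.natDegree ≤ g.natDegree) : wt g ≤ wt f :=
  pow_le_pow_of_le_one (inv_pos.2 sqrtCard_pos).le (inv_le_one_of_one_le₀ one_lt_sqrtCard.le) h

lemma sum_wt_sq_oneMod_filter_dvd_le {M : Fq[X]} (hM : M.Monic) (hM0 : 0 < M.natDegree) {Y : ℕ}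
    (hY : 1 ≤ wt M ^ 2 * ((Y : ℝ) + 1)) {e : Fq[X]} (he : e.Monic) :
    ∑ f ∈ (oneMod M Y).filter (e ∣ ·), wt f ^ 2 ≤
      (∑ f ∈ oneMod M Y, wt f ^ 2) * (2 * wt e ^ 2) := by
  set T := (monicsLE Fq Y).filter (fun u => e ∣ 1 + M * u) with hT
  have hsub : ∀ u ∈ T, ∀ u' ∈ T, e ∣ u - u' := by
    intro u hu u' hu'
    rw [hT, Finset.mem_filter] at hu hu'
    have hc : IsCoprime e M := by
      obtain ⟨v, hv⟩ := hu.2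
      exact ⟨v, -u, by linear_combination -hv⟩
    refine hc.dvd_of_dvd_mul_left ?_
    have := dvd_sub hu.2 hu'.2
    rwa [add_sub_add_left_eq_sub, ← mul_sub] at this
  rw [sum_wt_sq_oneMod hM hM0, Finset.sum_filter, sum_oneMod hM, ← Finset.sum_filter,
    ← Finset.sum_filter_add_sum_filter_not T (fun u => e.natDegree ≤ u.natDegree)]
  have h1 : ∑ u ∈ T.filter (fun u => e.natDegree ≤ u.natDegree), wt (1 + M * u) ^ 2 ≤
      wt M ^ 2 * (Y + 1) * wt e ^ 2 := by
    have hmem : ∀ u ∈ T.filter (fun u => e.natDegree ≤ u.natDegree),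
        u.Monic ∧ u.natDegree ≤ Y ∧ (u /ₘ e).Monic ∧
          u.natDegree = e.natDegree + (u /ₘ e).natDegree := by
      intro u hu
      rw [Finset.mem_filter, hT, Finset.mem_filter, mem_monicsLE] at hu
      refine ⟨hu.1.1.1, hu.1.1.2, ?_, ?_⟩
      · rw [Monic, leadingCoeff_divByMonic_of_monic he]
        · exact hu.1.1.1
        · rw [degree_eq_natDegree he.ne_zero, degree_eq_natDegree hu.1.1.1.ne_zero]
          exact_mod_cast hu.2
      · rw [natDegree_divByMonic u he]
        omega
    have h2 : ∀ u ∈ T.filter (fun u => e.natDegree ≤ u.natDegree),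
        wt (1 + M * u) ^ 2 = wt M ^ 2 * wt e ^ 2 * wt (u /ₘ e) ^ 2 := by
      intro u hu
      obtain ⟨hu1, -, hu2, hu3⟩ := hmem u hu
      rw [wt_one_add_mul hM hM0 hu1, wt.eq_1 u, hu3, pow_add]
      simp only [wt]
      ring
    rw [Finset.sum_congr rfl h2, ← Finset.mul_sum]
    have h3 : ∑ u ∈ T.filter (fun u => e.natDegree ≤ u.natDegree), wt (u /ₘ e) ^ 2 ≤ Y + 1 := by
      rw [← sum_wt_sq_monicsLE (Fq := Fq),
        ← Finset.sum_image (f := fun v : Fq[X] => wt v ^ 2) (g := fun u => u /ₘ e)]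
      · refine Finset.sum_le_sum_of_subset_of_nonneg ?_ fun v _ _ => by positivity
        intro v hv
        obtain ⟨u, hu, rfl⟩ := Finset.mem_image.1 hv
        obtain ⟨-, hu1, hu2, hu3⟩ := hmem u hu
        exact mem_monicsLE.2 ⟨hu2, by omega⟩
      · intro u hu u' hu' heq
        have hmod := modByMonic_eq_of_dvd_sub he
          (hsub u (Finset.mem_filter.1 hu).1 u' (Finset.mem_filter.1 hu').1)
        dsimp only at heq
        rw [← modByMonic_add_div u e, ← modByMonic_add_div u' e, hmod, heq]
    have : 0 ≤ wt M ^ 2 * wt e ^ 2 := by positivity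
    nlinarith
  have h2 : ∑ u ∈ T.filter (fun u => ¬e.natDegree ≤ u.natDegree), wt (1 + M * u) ^ 2 ≤
      wt M ^ 2 * (Y + 1) * wt e ^ 2 := by
    refine (Finset.sum_le_card_nsmul _ _ (wt e ^ 2) fun u hu => ?_).trans ?_
    · rw [Finset.mem_filter, hT, Finset.mem_filter, mem_monicsLE] at hu
      refine pow_le_pow_left₀ (wt_pos _).le (wt_le_wt ?_) 2
      exact natDegree_le_of_dvd hu.1.2 (monic_one_add_mul hM hM0 hu.1.1.1).1.ne_zero
    · have hcard : (T.filter (fun u => ¬e.natDegree ≤ u.natDegree)).card ≤ 1 := by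
        rw [Finset.card_le_one]
        intro u hu u' hu'
        rw [Finset.mem_filter, not_le] at hu hu'
        have h3 := hsub u hu.1 u' hu'.1
        by_contra hne
        have h4 := natDegree_le_of_dvd h3 (sub_ne_zero.2 hne)
        have h5 := natDegree_sub_le u u'
        have := max_lt hu.2 hu'.2
        omega
      rw [nsmul_eq_mul]
      have hcard' : ((T.filter (fun u => ¬e.natDegree ≤ u.natDegree)).card : ℝ) ≤ 1 := by
        exact_mod_cast hcard
      exact mul_le_mul_of_nonneg_right (hcard'.trans hY) (by positivity)
  linarith

lemma wt_sq_eq (f : Fq[X]) : wt f ^ 2 = ((Fintype.card Fq : ℝ) ^ f.natDegree)⁻¹ := by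
  rw [wt, card_pow_eq, ← pow_mul, mul_comm, inv_pow]

lemma card_sqfrees_filter_dvd_le {N : ℕ} (hN : 2 ≤ N) {e : Fq[X]} (he : e.Monic) :
    (((sqfrees Fq N).filter (e ∣ ·)).card : ℝ) ≤ (sqfrees Fq N).card * (2 * wt e ^ 2) := by
  have hq : (0 : ℝ) < Fintype.card Fq := by exact_mod_cast Fintype.card_pos
  have h1 : ((sqfrees Fq N).filter (e ∣ ·)).card ≤ ((monics Fq N).filter (e ∣ ·)).card :=
    Finset.card_le_card <| Finset.filter_subset_filter _ fun D hD =>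
      mem_monics.2 (mem_sqfrees.1 hD).1
  rcases le_or_gt e.natDegree N with hd | hd
  · rw [Finset.card_eq_sum_ones ((monics Fq N).filter _), sum_monics_filter_dvd he hd,
      ← Finset.card_eq_sum_ones, card_monics] at h1
    have h2 : (((sqfrees Fq N).filter (e ∣ ·)).card : ℝ) ≤
        (Fintype.card Fq : ℝ) ^ (N - e.natDegree) := by exact_mod_cast h1
    refine h2.trans ?_
    rw [wt_sq_eq, ← mul_assoc, mul_comm _ (2 : ℝ), ← div_eq_mul_inv, le_div_iff₀ (by positivity),
      ← pow_add, Nat.sub_add_cancel hd]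
    exact card_sqfrees_ge hN
  · rw [monics_filter_dvd_eq_empty hd, Finset.card_empty, Nat.le_zero] at h1
    rw [h1]
    push_cast
    positivity

lemma sum_wt_pow_four_le (X y : ℕ) :
    ∑ e ∈ (monicsLE Fq X).filter (fun e => y < e.natDegree), wt e ^ 4 ≤ (1 / 2 : ℝ) ^ y := by
  have hq : (2 : ℝ) ≤ Fintype.card Fq := by exact_mod_cast Fintype.one_lt_card (α := Fq)
  rw [Finset.sum_filter, sum_monicsLE]
  have h1 : ∀ n ∈ Finset.range (X + 1),
      ∑ f ∈ monics Fq n, (if y < f.natDegree then wt f ^ 4 else 0) ≤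
        if y < n then (1 / 2 : ℝ) ^ n else 0 := by
    intro n _
    split_ifs with h
    · rw [Finset.sum_congr rfl (g := fun f => ((Fintype.card Fq : ℝ) ^ n)⁻¹ * wt f ^ 2),
        ← Finset.mul_sum, sum_wt_sq_monics, mul_one, ← inv_pow]
      · refine pow_le_pow_left₀ (by positivity) ?_ n
        rw [one_div]
        exact inv_anti₀ two_pos hq
      · intro f hf
        rw [(mem_monics.1 hf).2, if_pos h, ← (mem_monics.1 hf).2, ← wt_sq_eq]
        ring
    · refine le_of_eq (Finset.sum_eq_zero fun f hf => ?_)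
      rw [(mem_monics.1 hf).2, if_neg h]
  refine (Finset.sum_le_sum h1).trans ?_
  rw [← Finset.sum_filter]
  have h2 : (Finset.range (X + 1)).filter (y < ·) = Finset.Ico (y + 1) (X + 1) := by
    ext n
    simp only [Finset.mem_filter, Finset.mem_range, Finset.mem_Ico]
    omega
  rw [h2]
  refine (geom_sum_Ico_le_of_lt_one (by norm_num) (by norm_num)).trans (le_of_eq ?_)
  rw [pow_succ]
  ring

lemma isCoprime_of_forall_monic {f g : Fq[X]} (hf : f.Monic)
    (h : ∀ P : Fq[X], P.Monic → Irreducible P → P ∣ f → ¬P ∣ g) : IsCoprime f g := by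
  refine isCoprime_of_irreducible_dvd (fun h0 => hf.ne_zero h0.1) fun z hz hzf hzg => ?_
  have ha := (associated_normalize z).symm
  exact h (normalize z) (monic_normalize hz.ne_zero) (ha.symm.irreducible hz)
    (ha.dvd.trans hzf) (ha.dvd.trans hzg)

lemma natDegree_assemble_le {k : ℕ} {s : PairIndex k → Fq[X]} (hs : ∀ p, (s p).Monic) {X : ℕ}
    (hX : ∀ p, (s p).natDegree ≤ X) (i : Fin k) :
    (assemble s i).natDegree ≤ 2 * (k * (k + 1) / 2 * X) := by
  have h : ∀ A : Finset (PairIndex k), (∏ p ∈ A, s p).natDegree ≤ k * (k + 1) / 2 * X := by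
    intro A
    rw [natDegree_prod_of_monic _ _ fun p _ => hs p]
    refine (Finset.sum_le_card_nsmul _ _ X fun p _ => hX p).trans ?_
    rw [smul_eq_mul, ← card_pairIndex]
    exact Nat.mul_le_mul_right _ (Finset.card_le_univ A)
  rw [assemble, (monic_prod_of_monic _ _ fun p _ => hs p).natDegree_mul
    (monic_prod_of_monic _ _ fun p _ => hs p), two_mul]
  exact add_le_add (h _) (h _)

lemma sum_sum_isSquare_ge {k y Y x N : ℕ} (hN : 2 ≤ N) (hy : 0 < y)
    (hy2 : ((k * (k + 1) / 2 : ℕ) + 1 : ℝ) ^ 2 * (4 * (1 / 2) ^ y) ≤ 1 / 2)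
    (hY : 1 ≤ wt (smallProd Fq y) ^ 2 * ((Y : ℝ) + 1))
    (hx : 2 * (k * (k + 1) / 2 * ((smallProd Fq y).natDegree + Y)) ≤ x) :
    (sqfrees Fq N).card * (wt (smallProd Fq y) ^ 2 * ((Y : ℝ) + 1)) ^ (k * (k + 1) / 2) / 2 ≤
      ∑ D ∈ sqfrees Fq N, ∑ t ∈ (monicTuples Fq k x).filter (fun t => IsSquare (∏ i, t i)),
        wt (∏ i, t i) * (jacobi D (∏ i, t i) : ℝ) := by
  set M := smallProd Fq y with hMdef
  have hM : M.Monic := monic_smallProd y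
  have hM0 : 0 < M.natDegree := natDegree_smallProd_pos hy
  set X := M.natDegree + Y with hX
  let S : Option (PairIndex k) → Finset Fq[X] := fun a =>
    a.elim (sqfrees Fq N) fun _ => oneMod M Y
  let w : Option (PairIndex k) → Fq[X] → ℝ := fun a => a.elim (fun _ => 1) fun _ f => wt f ^ 2
  set E := (monicsLE Fq X).filter (fun e => y < e.natDegree) with hE
  have hw : ∀ a f, 0 ≤ w a f := by
    rintro (_ | p) f
    · exact zero_le_one
    · exact sq_nonneg _
  have hdvd : ∀ a, ∀ e ∈ E,
      ∑ f ∈ (S a).filter (e ∣ ·), w a f ≤ (∑ f ∈ S a, w a f) * (2 * wt e ^ 2) := by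
    intro a e he
    have hem : e.Monic := (mem_monicsLE.1 (Finset.mem_filter.1 he).1).1
    rcases a with _ | p
    · simp only [S, w, Option.elim, Finset.sum_const, nsmul_eq_mul, mul_one]
      exact card_sqfrees_filter_dvd_le hN hem
    · exact sum_wt_sq_oneMod_filter_dvd_le hM hM0 hY hem
  have hW : ∏ a, ∑ f ∈ S a, w a f =
      (sqfrees Fq N).card * (wt M ^ 2 * ((Y : ℝ) + 1)) ^ (k * (k + 1) / 2) := by
    rw [Fintype.prod_option]
    simp only [S, w, Option.elim, Finset.sum_const, nsmul_eq_mul, mul_one, Finset.prod_const,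
      sum_wt_sq_oneMod hM hM0, Finset.card_univ, card_pairIndex]
  have hbad := sum_piFinset_exists_common_dvd_le S w hw E hdvd
  have hcard : Fintype.card (Option (PairIndex k)) = k * (k + 1) / 2 + 1 := by
    rw [Fintype.card_option, card_pairIndex]
  rw [hcard, hW] at hbad
  have htot : ∑ s ∈ Fintype.piFinset S, ∏ a, w a (s a) =
      (sqfrees Fq N).card * (wt M ^ 2 * ((Y : ℝ) + 1)) ^ (k * (k + 1) / 2) := by
    rw [← hW, Finset.prod_univ_sum]
  rw [← Finset.sum_filter_add_sum_filter_not _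
    (fun s => ∃ a b, a ≠ b ∧ ∃ e ∈ E, e ∣ s a ∧ e ∣ s b)] at htot
  set V := (sqfrees Fq N).card * (wt M ^ 2 * ((Y : ℝ) + 1)) ^ (k * (k + 1) / 2) with hV
  have hV0 : 0 ≤ V := by positivity
  have hbad2 : ((k * (k + 1) / 2 + 1 : ℕ) : ℝ) ^ 2 * (4 * ∑ e ∈ E, wt e ^ 4) * V ≤ 1 / 2 * V := by
    refine mul_le_mul_of_nonneg_right (le_trans ?_ hy2) hV0
    push_cast
    gcongr
    exact sum_wt_pow_four_le X y
  set G := (Fintype.piFinset S).filter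
    (fun s => ¬∃ a b, a ≠ b ∧ ∃ e ∈ E, e ∣ s a ∧ e ∣ s b) with hG
  have hbad3 : ∑ s ∈ (Fintype.piFinset S).filter
      (fun s => ∃ a b, a ≠ b ∧ ∃ e ∈ E, e ∣ s a ∧ e ∣ s b), ∏ a, w a (s a) ≤ 1 / 2 * V := by
    refine le_trans (le_of_eq ?_) (hbad.trans hbad2)
    congr!
  have hgood : V / 2 ≤ ∑ s ∈ G, ∏ a, w a (s a) := by linarith
  refine hgood.trans ?_
  have hGS : ∀ s ∈ G, s none ∈ sqfrees Fq N ∧ (∀ p, (s (some p)).Monic ∧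
      (s (some p)).natDegree ≤ X ∧ ∃ u, s (some p) = 1 + M * u) := by
    intro s hs
    have hs1 := Fintype.mem_piFinset.1 (Finset.mem_filter.1 hs).1
    refine ⟨hs1 none, fun p => ?_⟩
    obtain ⟨u, hu, hup⟩ := Finset.mem_image.1 (hs1 (some p))
    rw [mem_monicsLE] at hu
    obtain ⟨h1, h2⟩ := monic_one_add_mul hM hM0 hu.1
    rw [← hup]
    exact ⟨h1, by omega, u, rfl⟩
  have hcop : ∀ s ∈ G, ∀ p a, some p ≠ a → IsCoprime (s (some p)) (s a) := by
    intro s hs p a hpa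
    obtain ⟨h1, h2, u, hu⟩ := (hGS s hs).2 p
    refine isCoprime_of_forall_monic h1 fun P hPm hP hP1 hP2 => ?_
    refine (Finset.mem_filter.1 hs).2 ⟨some p, a, hpa, P, ?_, hP1, hP2⟩
    rw [hE, Finset.mem_filter, mem_monicsLE]
    refine ⟨⟨hPm, (natDegree_le_of_dvd hP1 h1.ne_zero).trans h2⟩, ?_⟩
    by_contra hlt
    have hPM : P ∣ M := dvd_smallProd hPm hP.natDegree_pos (not_lt.1 hlt)
    rw [hu] at hP1
    exact hP.not_isUnit (isUnit_of_dvd_one ((dvd_add_left (hPM.mul_right u)).1 hP1))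
  let φ : (Option (PairIndex k) → Fq[X]) → Fq[X] × (Fin k → Fq[X]) := fun s =>
    (s none, assemble fun p => s (some p))
  have hφ : Set.InjOn φ G := by
    intro s hs s' hs' heq
    have h1 := assemble_injOn (fun p => ((hGS s hs).2 p).1) (fun p => ((hGS s' hs').2 p).1)
      (fun p q hpq => hcop s hs p (some q) fun h => hpq (Option.some.inj h))
      (fun p q hpq => hcop s' hs' p (some q) fun h => hpq (Option.some.inj h))
      (congrArg Prod.snd heq)
    funext a
    rcases a with _ | p
    · exact congrArg Prod.fst heq
    · exact congrFun h1 p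
  have hterm : ∀ s ∈ G, ∏ a, w a (s a) =
      wt (∏ i, (φ s).2 i) * (jacobi (φ s).1 (∏ i, (φ s).2 i) : ℝ) := by
    intro s hs
    have hm : ∀ p, (s (some p)).Monic := fun p => ((hGS s hs).2 p).1
    have hj : jacobi (s none) (∏ i, assemble (fun p => s (some p)) i) = 1 := by
      rw [prod_assemble, jacobi_mul_self _ (monic_prod_of_monic _ _ fun p _ => hm p), if_pos]
      exact IsCoprime.prod_right fun p _ => (hcop s hs p none (by simp)).symm
    simp only [φ]
    rw [hj, Int.cast_one, mul_one, wt_prod_assemble hm, Fintype.prod_option]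
    simp only [w, Option.elim, one_mul]
  rw [Finset.sum_congr rfl hterm, ← Finset.sum_image
    (f := fun z : Fq[X] × (Fin k → Fq[X]) => wt (∏ i, z.2 i) * (jacobi z.1 (∏ i, z.2 i) : ℝ)) hφ,
    ← Finset.sum_product']
  refine Finset.sum_le_sum_of_subset_of_nonneg ?_ ?_
  · intro z hz
    obtain ⟨s, hs, rfl⟩ := Finset.mem_image.1 hz
    have hm : ∀ p, (s (some p)).Monic := fun p => ((hGS s hs).2 p).1
    rw [Finset.mem_product, Finset.mem_filter, mem_monicTuples]
    refine ⟨(hGS s hs).1, fun i => ⟨monic_assemble hm i, ?_⟩, _, prod_assemble _⟩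
    exact (natDegree_assemble_le hm (fun p => ((hGS s hs).2 p).2.1) i).trans hx
  · intro z hz _
    rw [Finset.mem_product, Finset.mem_filter] at hz
    refine mul_nonneg (wt_pos _).le ?_
    exact_mod_cast jacobi_nonneg_of_isSquare _ (monic_prod_of_mem_monicTuples hz.2.1) hz.2.2

lemma exists_sum_isSquare_ge (k : ℕ) (hk : 0 < k) : ∃ c : ℝ, 0 < c ∧ ∃ G : ℕ, ∀ g : ℕ, G ≤ g →
    c * ((sqfrees Fq (2 * g + 1)).card * (g : ℝ) ^ (k * (k + 1) / 2)) ≤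
      ∑ D ∈ sqfrees Fq (2 * g + 1),
        ∑ t ∈ (monicTuples Fq k (g / (32 * k))).filter (fun t => IsSquare (∏ i, t i)),
          wt (∏ i, t i) * (jacobi D (∏ i, t i) : ℝ) := by
  set n := k * (k + 1) / 2 with hn
  have hn0 : 0 < n := Nat.div_pos (by nlinarith) two_pos
  obtain ⟨y, hy0, hy⟩ : ∃ y : ℕ, 0 < y ∧ ((n : ℝ) + 1) ^ 2 * (4 * (1 / 2) ^ y) ≤ 1 / 2 := by
    have h : Tendsto (fun y : ℕ => ((n : ℝ) + 1) ^ 2 * (4 * (1 / 2 : ℝ) ^ y)) atTop (nhds 0) := by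
      simpa using ((tendsto_pow_atTop_nhds_zero_of_lt_one (by norm_num : (0 : ℝ) ≤ 1 / 2)
        (by norm_num)).const_mul 4).const_mul (((n : ℝ) + 1) ^ 2)
    obtain ⟨y, hy⟩ := ((h.eventually_le_const (by norm_num : (0 : ℝ) < 1 / 2)).and
      (eventually_gt_atTop 0)).exists
    exact ⟨y, hy.2, hy.1⟩
  set d := (smallProd Fq y).natDegree with hd
  set w := wt (smallProd Fq y) ^ 2 with hw
  have hw0 : 0 < w := pow_pos (wt_pos _) _
  set m := 64 * k * n with hm
  have hm0 : 0 < m := by positivity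
  have hmR : (0 : ℝ) < m := by exact_mod_cast hm0
  refine ⟨(w / (2 * m)) ^ n / 2, by positivity, max (2 * m * d) ⌈2 * m / w⌉₊ + 1, fun g hg => ?_⟩
  have hg1 : 2 * m * d ≤ g := (le_max_left _ _).trans ((Nat.le_succ _).trans hg)
  have hg2 : 2 * m / w ≤ g := (Nat.le_ceil _).trans
    (by exact_mod_cast (le_max_right (2 * m * d) _).trans ((Nat.le_succ _).trans hg))
  have hdle : d ≤ g / m := (Nat.le_div_iff_mul_le hm0).2 (by nlinarith)
  have hYr : (g : ℝ) / (2 * m) ≤ ((g / m - d : ℕ) : ℝ) + 1 := by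
    have h1 : (g : ℝ) < m * ((g / m : ℕ) : ℝ) + m := by
      exact_mod_cast Nat.lt_mul_div_succ g hm0
    have h2 : 2 * (m : ℝ) * d ≤ g := by exact_mod_cast hg1
    rw [Nat.cast_sub hdle, div_le_iff₀ (by positivity)]
    nlinarith
  have hle : w / (2 * m) * g ≤ w * (((g / m - d : ℕ) : ℝ) + 1) := by
    rw [div_mul_eq_mul_div, mul_div_assoc]
    exact mul_le_mul_of_nonneg_left hYr hw0.le
  have hone : 1 ≤ w / (2 * m) * g := by
    rw [div_le_iff₀ hw0] at hg2
    rw [div_mul_eq_mul_div, le_div_iff₀ (by positivity)]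
    linarith
  have hx : 2 * (n * (d + (g / m - d))) ≤ g / (32 * k) := by
    rw [Nat.add_sub_cancel' hdle, ← mul_assoc, show m = 32 * k * (2 * n) by rw [hm]; ring,
      ← Nat.div_div_eq_div_mul]
    exact Nat.mul_div_le _ _
  have hge : 1 ≤ g := (Nat.le_add_left _ _).trans hg
  refine le_trans ?_ (sum_sum_isSquare_ge (k := k) (N := 2 * g + 1) (by omega) hy0 hy
    (hone.trans hle) hx)
  have := pow_le_pow_left₀ (by positivity) hle n
  rw [mul_pow] at this
  calc _ = (sqfrees Fq (2 * g + 1)).card * ((w / (2 * m)) ^ n * (g : ℝ) ^ n) / 2 := by ring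
    _ ≤ _ := by gcongr

lemma sqrtCard_pow_le_card_sqfrees {g : ℕ} (hg : 1 ≤ g) :
    sqrtCard Fq ^ (4 * g + 2) ≤ 2 * (sqfrees Fq (2 * g + 1)).card := by
  have := card_sqfrees_ge (Fq := Fq) (N := 2 * g + 1) (by omega)
  rwa [card_pow_eq, show 2 * (2 * g + 1) = 4 * g + 2 by ring] at this

lemma eventually_error_le (p n : ℕ) {ε : ℝ} (hε : 0 < ε) : ∀ᶠ g : ℕ in atTop,
    5 * ((g : ℝ) + 1) ^ p * sqrtCard Fq ^ (4 * g - g / 8) ≤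
      ε * ((sqfrees Fq (2 * g + 1)).card * (g : ℝ) ^ n) := by
  have hQ := one_lt_sqrtCard (Fq := Fq)
  have hQ0 := sqrtCard_pos (Fq := Fq)
  have h8 : Tendsto (fun g : ℕ => g / 8 + 1) atTop atTop :=
    (tendsto_add_atTop_nat 1).comp (Nat.tendsto_div_const_atTop (by norm_num : (8 : ℕ) ≠ 0))
  have h := (tendsto_pow_const_div_const_pow_of_one_lt p hQ).comp h8
  filter_upwards [h.eventually_le_const (show 0 < ε / (10 * 8 ^ p) by positivity),
    eventually_ge_atTop 1] with g hg hg1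
  simp only [Function.comp_apply] at hg
  rw [div_le_div_iff₀ (by positivity) (by positivity)] at hg
  have h1 : ((g : ℝ) + 1) ^ p ≤ 8 ^ p * ((g / 8 + 1 : ℕ) : ℝ) ^ p := by
    rw [← mul_pow]
    refine pow_le_pow_left₀ (by positivity) ?_ _
    exact_mod_cast (by omega : g + 1 ≤ 8 * (g / 8 + 1))
  have h2 : (1 : ℝ) ≤ (g : ℝ) ^ n := one_le_pow₀ (by exact_mod_cast hg1)
  have h3 : 10 * ((g : ℝ) + 1) ^ p ≤ ε * sqrtCard Fq ^ (g / 8 + 2) := by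
    calc 10 * ((g : ℝ) + 1) ^ p ≤ 10 * (8 ^ p * ((g / 8 + 1 : ℕ) : ℝ) ^ p) := by gcongr
      _ ≤ ε * sqrtCard Fq ^ (g / 8 + 1) := by linarith
      _ ≤ _ := by gcongr <;> first | exact hQ.le | omega
  calc 5 * ((g : ℝ) + 1) ^ p * sqrtCard Fq ^ (4 * g - g / 8)
      = 10 * ((g : ℝ) + 1) ^ p * sqrtCard Fq ^ (4 * g - g / 8) / 2 := by ring
    _ ≤ ε * sqrtCard Fq ^ (g / 8 + 2) * sqrtCard Fq ^ (4 * g - g / 8) / 2 := by gcongr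
    _ = ε * (sqrtCard Fq ^ (4 * g + 2) / 2) := by
      rw [mul_assoc, ← pow_add, show g / 8 + 2 + (4 * g - g / 8) = 4 * g + 2 by omega]; ring
    _ ≤ ε * ((sqfrees Fq (2 * g + 1)).card * 1) := by
      have := sqrtCard_pow_le_card_sqfrees (Fq := Fq) hg1
      gcongr
      linarith
    _ ≤ _ := by gcongr

lemma mul_pow_le_add_of_even {j : ℕ} (hj : Even (j + 1)) (a b : ℝ) {r : ℝ} (hr : 0 < r) :
    a * b ^ j ≤ a ^ (j + 1) / r ^ j + r * b ^ (j + 1) := by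
  rw [← hj.pow_abs a, ← hj.pow_abs b]
  refine (le_abs_self _).trans ?_
  rw [abs_mul, abs_pow]
  rcases le_total |a| (r * |b|) with h | h
  · calc |a| * |b| ^ j ≤ r * |b| * |b| ^ j := by gcongr
      _ = r * |b| ^ (j + 1) := by ring
      _ ≤ _ := le_add_of_nonneg_left (by positivity)
  · have h' : |b| ≤ |a| / r := by rwa [le_div_iff₀ hr, mul_comm]
    calc |a| * |b| ^ j ≤ |a| * (|a| / r) ^ j := by gcongr
      _ = |a| ^ (j + 1) / r ^ j := by rw [div_pow]; ring
      _ ≤ _ := le_add_of_nonneg_right (by positivity)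

lemma exists_moment_ge_of_ringChar_ne_two (hq : ringChar Fq ≠ 2) {j : ℕ} (hj : Even (j + 1)) :
    ∃ c : ℝ, 0 < c ∧ ∃ G : ℕ, ∀ g : ℕ, G ≤ g →
      c * ((sqfrees Fq (2 * g + 1)).card * (g : ℝ) ^ ((j + 1) * (j + 1 + 1) / 2)) ≤
        ∑ D ∈ sqfrees Fq (2 * g + 1), LhalfR D ^ (j + 1) := by
  obtain ⟨c, hc, G, hG⟩ := exists_sum_isSquare_ge (Fq := Fq) (j + 1) j.succ_pos
  obtain ⟨G', hG'⟩ := eventually_atTop.1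
    (eventually_error_le (Fq := Fq) (j + 3) ((j + 1) * (j + 1 + 1) / 2) (half_pos hc))
  set n := (j + 1) * (j + 1 + 1) / 2
  set r := c / (2 * (1 + c / 2)) with hr
  have hr0 : 0 < r := by positivity
  refine ⟨r ^ j * (c / 2), by positivity, G + G' + 2, fun g hg => ?_⟩
  have hlow := hG g (by omega)
  have herr := hG' g (by omega)
  set V := (sqfrees Fq (2 * g + 1)).card * (g : ℝ) ^ n with hV
  set x := g / (32 * (j + 1)) with hx
  have hx1 : x * (32 * (j + 1)) ≤ g := Nat.div_mul_le_self _ _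
  have hx8 : 8 * (j * x) ≤ g := by nlinarith
  have hxg : (j + 1) * x + 1 ≤ g := by nlinarith
  have hxg' : x ≤ g - 1 := by
    have : x ≤ (j + 1) * x := Nat.le_mul_of_pos_left _ j.succ_pos
    omega
  simp_rw [← squarePart_self_eq] at hlow
  have key : ∀ y, x ≤ y → y ≤ g →
      c / 2 * V ≤ ∑ D ∈ sqfrees Fq (2 * g + 1), trunc D y * trunc D x ^ j := by
    intro y hxy hyg
    have h1 := (abs_le.1 (abs_sum_trunc_sub_squarePart_le (Fq := Fq) hq hyg hx8)).1
    have h2 : ∑ D ∈ sqfrees Fq (2 * g + 1), squarePart D j x x ≤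
        ∑ D ∈ sqfrees Fq (2 * g + 1), squarePart D j x y :=
      Finset.sum_le_sum fun D _ => squarePart_mono D j x hxy
    linarith
  have hS2 : ∑ D ∈ sqfrees Fq (2 * g + 1), trunc D x ^ (j + 1) ≤ (1 + c / 2) * V := by
    have h1 := (abs_le.1 (abs_sum_trunc_sub_squarePart_le (Fq := Fq) hq
      (hxg'.trans (Nat.sub_le _ _)) hx8)).2
    have h2 : ∑ D ∈ sqfrees Fq (2 * g + 1), squarePart D j x x ≤ V := by
      rw [hV, ← nsmul_eq_mul]
      refine Finset.sum_le_card_nsmul _ _ _ fun D _ => (squarePart_self_le D j x).trans ?_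
      refine pow_le_pow_left₀ (by positivity) ?_ _
      exact_mod_cast hxg
    simp_rw [pow_succ' _ j]
    linarith
  have hS1 : c * V ≤ ∑ D ∈ sqfrees Fq (2 * g + 1), LhalfR D * trunc D x ^ j := by
    have h : ∑ D ∈ sqfrees Fq (2 * g + 1), LhalfR D * trunc D x ^ j =
        ∑ D ∈ sqfrees Fq (2 * g + 1), trunc D g * trunc D x ^ j +
        ∑ D ∈ sqfrees Fq (2 * g + 1), trunc D (g - 1) * trunc D x ^ j := by
      rw [← Finset.sum_add_distrib]
      refine Finset.sum_congr rfl fun D hD => ?_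
      obtain ⟨⟨hDm, hDd⟩, hDs⟩ := mem_sqfrees.1 hD
      rw [LhalfR_eq_trunc_add_trunc hq hDm hDs hDd (by omega), add_mul]
    linarith [key g (hxg'.trans (Nat.sub_le _ _)) le_rfl, key (g - 1) hxg' (Nat.sub_le _ _)]
  have hsum : ∑ D ∈ sqfrees Fq (2 * g + 1), LhalfR D * trunc D x ^ j ≤
      (∑ D ∈ sqfrees Fq (2 * g + 1), LhalfR D ^ (j + 1)) / r ^ j +
        r * ∑ D ∈ sqfrees Fq (2 * g + 1), trunc D x ^ (j + 1) := by
    rw [Finset.sum_div, Finset.mul_sum, ← Finset.sum_add_distrib]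
    exact Finset.sum_le_sum fun D _ => mul_pow_le_add_of_even hj _ _ hr0
  have hrS : r * ∑ D ∈ sqfrees Fq (2 * g + 1), trunc D x ^ (j + 1) ≤ c / 2 * V := by
    calc _ ≤ r * ((1 + c / 2) * V) := by gcongr
      _ = c / 2 * V := by
        rw [hr]
        field_simp
  rw [mul_assoc, mul_comm, ← le_div_iff₀ (pow_pos hr0 j)]
  linarith

lemma trunc_le_LhalfR (hq : ringChar Fq = 2) (D : Fq[X]) {x : ℕ} (hx : x < D.natDegree) :
    trunc D x ≤ LhalfR D := by
  rw [trunc_eq, LhalfR_eq]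
  refine Finset.sum_le_sum_of_subset_of_nonneg (Finset.range_subset_range.2 hx) fun n _ _ => ?_
  have : 0 ≤ charSum D n := Finset.sum_nonneg fun f hf => jacobi_nonneg hq D (mem_monics.1 hf).1
  have := sqrtCard_pos (Fq := Fq)
  positivity

lemma exists_moment_ge_of_ringChar_eq_two (hq : ringChar Fq = 2) {k : ℕ} (hk : 0 < k) :
    ∃ c : ℝ, 0 < c ∧ ∃ G : ℕ, ∀ g : ℕ, G ≤ g →
      c * ((sqfrees Fq (2 * g + 1)).card * (g : ℝ) ^ (k * (k + 1) / 2)) ≤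
        ∑ D ∈ sqfrees Fq (2 * g + 1), LhalfR D ^ k := by
  obtain ⟨c, hc, G, hG⟩ := exists_sum_isSquare_ge (Fq := Fq) k hk
  refine ⟨c, hc, G, fun g hg => (hG g hg).trans (Finset.sum_le_sum fun D hD => ?_)⟩
  have hterm : ∀ f : Fq[X], f.Monic → 0 ≤ wt f * (jacobi D f : ℝ) := fun f hf =>
    mul_nonneg (wt_pos f).le (by exact_mod_cast jacobi_nonneg hq D hf)
  have hx : g / (32 * k) < D.natDegree := by
    rw [(mem_sqfrees.1 hD).1.2]
    have := Nat.div_le_self g (32 * k)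
    omega
  calc _ ≤ ∑ t ∈ monicTuples Fq k (g / (32 * k)), wt (∏ i, t i) * (jacobi D (∏ i, t i) : ℝ) :=
        Finset.sum_le_sum_of_subset_of_nonneg (Finset.filter_subset _ _) fun t ht _ =>
          hterm _ (monic_prod_of_mem_monicTuples ht)
    _ = trunc D (g / (32 * k)) ^ k := (trunc_pow_eq _ _ _).symm
    _ ≤ _ := pow_le_pow_left₀ (Finset.sum_nonneg fun f hf => hterm f (mem_monicsLE.1 hf).1)
      (trunc_le_LhalfR hq D hx) _

lemma Hset_eq_coe_sqfrees (g : ℕ) : Hset Fq g = ↑(sqfrees Fq (2 * g + 1)) := by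
  ext D
  rw [Finset.mem_coe, mem_sqfrees]
  exact ⟨fun h => ⟨⟨h.1, h.2.2⟩, h.2.1⟩, fun h => ⟨h.1.1, h.2, h.1.2⟩⟩

/-- Main theorem: lower bound for the `k`-th moment of `L(1/2, χ_D)`
over `H_{2g+1}`, for even `k ≥ 2`. -/
theorem main_theorem (k : ℕ) (hke : Even k) (hk : 2 ≤ k) :
    ∃ c : ℝ, 0 < c ∧ ∃ G : ℕ, ∀ g : ℕ, G ≤ g →
      c * (g : ℝ) ^ (k * (k + 1) / 2)
        ≤ (Set.ncard (Hset Fq g) : ℝ)⁻¹ * ∑ᶠ D ∈ Hset Fq g, LhalfR D ^ k := by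
  obtain ⟨c, hc, G, hG⟩ : ∃ c : ℝ, 0 < c ∧ ∃ G : ℕ, ∀ g : ℕ, G ≤ g →
      c * ((sqfrees Fq (2 * g + 1)).card * (g : ℝ) ^ (k * (k + 1) / 2)) ≤
        ∑ D ∈ sqfrees Fq (2 * g + 1), LhalfR D ^ k := by
    by_cases hq : ringChar Fq = 2
    · exact exists_moment_ge_of_ringChar_eq_two hq (by omega)
    · obtain ⟨j, rfl⟩ : ∃ j, k = j + 1 := ⟨k - 1, by omega⟩
      exact exists_moment_ge_of_ringChar_ne_two hq hke
  refine ⟨c, hc, G + 1, fun g hg => ?_⟩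
  have hpos : (0 : ℝ) < (sqfrees Fq (2 * g + 1)).card := by
    have := sqrtCard_pow_le_card_sqfrees (Fq := Fq) (g := g) (by omega)
    have := pow_pos (sqrtCard_pos (Fq := Fq)) (4 * g + 2)
    linarith
  rw [Hset_eq_coe_sqfrees, finsum_mem_coe_finset, Set.ncard_coe_finset, inv_mul_eq_div,
    le_div_iff₀ hpos]
  linarith [hG g (by omega)]
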